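/- arXiv:math/9508219 — 3 statements merged into one kernel-verified Lean document; each statement's English description precedes it below -/
import Mathlib

section
/- Up to coordinate permutation, there are exactly two binary linear [21,5,10] codes. -/
/-- A binary linear [21,5,10] code. -/
def IsCode21_5_10 (C : Submodule (ZMod 2) (Fin 21 → ZMod 2)) : Prop :=
  Module.finrank (ZMod 2) C = 5 ∧ ∀ v ∈ C, v ≠ 0 → 10 ≤ hammingNorm v

/-- Equivalence of codes of length `n` by permutation of coordinates. -/
def CodePermEquiv {n : ℕ} (C D : Submodule (ZMod 2) (Fin n → ZMod 2)) : Prop :=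
  ∃ σ : Equiv.Perm (Fin n),
    Submodule.map (LinearMap.funLeft (ZMod 2) (ZMod 2) σ) C = D

namespace Code21

open Matrix
open scoped Finset

/-- Messages of a code of dimension `5`; also the columns of its generator matrices. -/
abbrev Vec5 := Fin 5 → ZMod 2

/-- The nontrivial character of `ZMod 2`. -/
def chi (a : ZMod 2) : ℤ := if a = 0 then 1 else -1

lemma chi_zero : chi 0 = 1 := rfl

lemma chi_add (a b : ZMod 2) : chi (a + b) = chi a * chi b := by
  revert a b; decide

lemma zmod2_eq_one {a : ZMod 2} (h : a ≠ 0) : a = 1 := by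
  revert a; decide

lemma Vec5.add_self (y : Vec5) : y + y = 0 := CharTwo.add_self_eq_zero y

lemma sum_chi (y : Vec5) : ∑ u : Vec5, chi (u ⬝ᵥ y) = if y = 0 then 32 else 0 := by
  split_ifs with h
  · subst h
    simp [chi_zero]
  · obtain ⟨k, hk⟩ := Function.ne_iff.mp h
    have key : ∑ u : Vec5, chi (u ⬝ᵥ y) = ∑ u : Vec5, -chi (u ⬝ᵥ y) := by
      refine Fintype.sum_equiv (Equiv.addRight (Pi.single k 1)) _ _ fun u => ?_
      have h1 : chi 1 = -1 := by decide
      simp [add_dotProduct, chi_add, zmod2_eq_one hk, h1]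
    rw [Finset.sum_neg_distrib] at key
    linarith

lemma sum_chi' (u : Vec5) : ∑ y : Vec5, chi (u ⬝ᵥ y) = if u = 0 then 32 else 0 := by
  simp_rw [dotProduct_comm u]
  exact sum_chi u

/-- The Walsh–Hadamard transform. -/
def walsh (f : Vec5 → ℤ) (y : Vec5) : ℤ := ∑ u, f u * chi (u ⬝ᵥ y)

/-- The restriction of `f` to the hyperplane orthogonal to `z`, extended by zero. -/
def slice (f : Vec5 → ℤ) (z u : Vec5) : ℤ := if u ⬝ᵥ z = 0 then f u else 0

lemma walsh_zero (f : Vec5 → ℤ) : walsh f 0 = ∑ u, f u := by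
  simp [walsh, chi_zero]

lemma two_mul_walsh_slice (f : Vec5 → ℤ) (z y : Vec5) :
    2 * walsh (slice f z) y = walsh f y + walsh f (y + z) := by
  simp only [walsh, Finset.mul_sum, ← Finset.sum_add_distrib]
  refine Finset.sum_congr rfl fun u _ => ?_
  rw [dotProduct_add, chi_add]
  by_cases h : u ⬝ᵥ z = 0
  · simp [slice, h, chi_zero]; ring
  · simp [slice, h, chi]

lemma slice_nonneg {f : Vec5 → ℤ} (hf : ∀ u, 0 ≤ f u) (z u : Vec5) : 0 ≤ slice f z u := by
  unfold slice; split_ifs <;> simp [hf]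

lemma slice_le {f : Vec5 → ℤ} (hf : ∀ u, 0 ≤ f u) (z u : Vec5) : slice f z u ≤ f u := by
  unfold slice; split_ifs <;> simp [hf]

lemma walsh_zero_nonneg {f : Vec5 → ℤ} (hf : ∀ u, 0 ≤ f u) : 0 ≤ walsh f 0 := by
  rw [walsh_zero]; exact Finset.sum_nonneg fun u _ => hf u

lemma walsh_slice_le {f : Vec5 → ℤ} (hf : ∀ u, 0 ≤ f u) (z : Vec5) :
    walsh (slice f z) 0 ≤ walsh f 0 := by
  simp only [walsh_zero]; exact Finset.sum_le_sum fun u _ => slice_le hf z u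

/-- A nonnegative function that is supported on every hyperplane vanishes off `0`. -/
lemma walsh_zero_eq_zero {f : Vec5 → ℤ} (hf : ∀ u, 0 ≤ f u) (h0 : f 0 = 0)
    (h : ∀ z, walsh f 0 ≤ walsh (slice f z) 0) : walsh f 0 = 0 := by
  rw [walsh_zero]
  refine Finset.sum_eq_zero fun u _ => ?_
  by_contra hu
  refine hu ?_
  suffices u = 0 by rw [this, h0]
  refine dotProduct_eq_zero u fun z => ?_
  by_contra hz
  have hlt : walsh (slice f z) 0 < walsh f 0 := by
    simp only [walsh_zero]
    refine Finset.sum_lt_sum (fun u _ => slice_le hf z u) ⟨u, Finset.mem_univ u, ?_⟩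
    have := (hf u).lt_of_ne' hu
    simpa [slice, hz] using this
  exact absurd (h z) hlt.not_ge

lemma slice_self (f : Vec5 → ℤ) (z : Vec5) : slice (slice f z) z = slice f z := by
  ext u; unfold slice; split_ifs <;> rfl

lemma slice_zero (f : Vec5 → ℤ) : slice f 0 = f := by
  ext u; simp [slice]

lemma slice_comm (f : Vec5 → ℤ) (y z : Vec5) :
    slice (slice f y) z = slice (slice f z) y := by
  ext u; unfold slice; split_ifs <;> rfl

lemma slice_add (f : Vec5 → ℤ) (y z : Vec5) :
    slice (slice f y) (y + z) = slice (slice f y) z := by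
  ext u
  unfold slice
  by_cases h : u ⬝ᵥ y = 0 <;> simp [h, dotProduct_add]

/-- No nonnegative function of total mass `2` vanishing at `0` has transform `2` modulo `8`
at each point whose hyperplane misses part of its support. -/
lemma walsh_zero_ne_two {f : Vec5 → ℤ} (hf : ∀ u, 0 ≤ f u) (h0 : f 0 = 0)
    (h : ∀ z, slice f z = f ∨ 8 ∣ walsh f z - 2) : walsh f 0 ≠ 2 := by
  intro h2
  have := walsh_zero_eq_zero hf h0 fun z => ?_
  · omega
  rcases h z with hz | hz
  · rw [hz]
  · have h4 : 2 * walsh (slice f z) 0 = walsh f 0 + walsh f z := by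
      rw [two_mul_walsh_slice, zero_add]
    have h6 := walsh_zero_nonneg (slice_nonneg hf z)
    have h7 := walsh_slice_le hf z
    omega

lemma sum_walsh_sq (f : Vec5 → ℤ) : ∑ y, walsh f y ^ 2 = 32 * ∑ u, f u ^ 2 := by
  have expand (y : Vec5) :
      walsh f y ^ 2 = ∑ u, ∑ v, f u * f v * chi ((u + v) ⬝ᵥ y) := by
    rw [walsh, sq, Finset.sum_mul_sum]
    refine Finset.sum_congr rfl fun u _ => Finset.sum_congr rfl fun v _ => ?_
    rw [add_dotProduct, chi_add]; ring
  simp_rw [expand]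
  rw [Finset.sum_comm, Finset.mul_sum]
  refine Finset.sum_congr rfl fun u _ => ?_
  rw [Finset.sum_comm]
  simp_rw [← Finset.mul_sum, sum_chi', CharTwo.add_eq_zero]
  simp; ring

lemma card_ne_zero {u : Vec5} (hu : u ≠ 0) : #{x : Vec5 | u ⬝ᵥ x ≠ 0} = 16 := by
  have key (x : Vec5) : 2 * (if u ⬝ᵥ x ≠ 0 then (1 : ℤ) else 0) = 1 - chi (u ⬝ᵥ x) := by
    unfold chi; split_ifs <;> simp_all
  have := Finset.sum_congr (rfl : (Finset.univ : Finset Vec5) = Finset.univ) fun x _ => key x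
  rw [← Finset.mul_sum, Finset.sum_sub_distrib, sum_chi', if_neg hu, Finset.sum_boole] at this
  simp at this
  simp; omega

lemma card_ne_zero_and {u v : Vec5} (hu : u ≠ 0) (hv : v ≠ 0) (huv : u ≠ v) :
    #{x : Vec5 | u ⬝ᵥ x ≠ 0 ∧ v ⬝ᵥ x ≠ 0} = 8 := by
  have key (x : Vec5) : 4 * (if u ⬝ᵥ x ≠ 0 ∧ v ⬝ᵥ x ≠ 0 then (1 : ℤ) else 0) =
      1 - chi (u ⬝ᵥ x) - chi (v ⬝ᵥ x) + chi ((u + v) ⬝ᵥ x) := by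
    rw [add_dotProduct, chi_add]
    unfold chi; split_ifs <;> simp_all
  have := Finset.sum_congr (rfl : (Finset.univ : Finset Vec5) = Finset.univ) fun x _ => key x
  rw [← Finset.mul_sum, Finset.sum_add_distrib, Finset.sum_sub_distrib, Finset.sum_sub_distrib,
    sum_chi', sum_chi', sum_chi', if_neg hu, if_neg hv,
    if_neg (by rwa [CharTwo.add_eq_zero]), Finset.sum_boole] at this
  simp at this
  simp; omega

lemma card_ne_zero_and_eq_zero {u v : Vec5} (hu : u ≠ 0) (hv : v ≠ 0) (huv : u ≠ v) :
    #{x : Vec5 | u ⬝ᵥ x ≠ 0 ∧ v ⬝ᵥ x = 0} = 8 := by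
  have h := Finset.card_filter_add_card_filter_not (s := {x : Vec5 | u ⬝ᵥ x ≠ 0})
    (fun x => v ⬝ᵥ x ≠ 0)
  simp only [Finset.filter_filter, not_not] at h
  rw [card_ne_zero hu, card_ne_zero_and hu hv huv] at h
  omega

variable {g : Fin 21 → Vec5}

/-- The weight of the codeword with message `u` in the code whose generator matrix has
columns `g`. -/
def weight (g : Fin 21 → Vec5) (u : Vec5) : ℕ := #{i | u ⬝ᵥ g i ≠ 0}

/-- The number of times `y` occurs as a column. -/
def mult (g : Fin 21 → Vec5) (y : Vec5) : ℤ := ∑ i, if g i = y then 1 else 0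

/-- The columns `g` generate a code of dimension `5` and minimum distance at least `10`. -/
def IsGood (g : Fin 21 → Vec5) : Prop := ∀ u, u ≠ 0 → 10 ≤ weight g u

/-- The excess of the weight over the minimum distance, and `0` at the zero message. -/
def excess (g : Fin 21 → Vec5) (u : Vec5) : ℤ := if u = 0 then 0 else (weight g u : ℤ) - 10

lemma mult_nonneg (g : Fin 21 → Vec5) (y : Vec5) : 0 ≤ mult g y :=
  Finset.sum_nonneg fun i _ => by split_ifs <;> simp

lemma sum_mult (g : Fin 21 → Vec5) : ∑ y, mult g y = 21 := by
  unfold mult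
  rw [Finset.sum_comm]
  simp

lemma excess_zero (g : Fin 21 → Vec5) : excess g 0 = 0 := if_pos rfl

lemma IsGood.excess_nonneg (hg : IsGood g) (u : Vec5) : 0 ≤ excess g u := by
  unfold excess
  split_ifs with h
  · rfl
  · have := hg u h
    omega

lemma two_mul_excess (g : Fin 21 → Vec5) (u : Vec5) :
    2 * excess g u = 1 - ∑ i, chi (u ⬝ᵥ g i) + if u = 0 then 20 else 0 := by
  have key : ∑ i, chi (u ⬝ᵥ g i) = 21 - 2 * (weight g u : ℤ) := by
    have h (i : Fin 21) :
        chi (u ⬝ᵥ g i) = 1 - 2 * if u ⬝ᵥ g i ≠ 0 then 1 else 0 := by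
      unfold chi; split_ifs <;> simp_all
    simp_rw [h, Finset.sum_sub_distrib, ← Finset.mul_sum, Finset.sum_boole]
    simp [weight]
  unfold excess
  split_ifs with h
  · subst h
    simp [chi_zero]
  · rw [key]; ring

lemma walsh_excess (g : Fin 21 → Vec5) (y : Vec5) :
    walsh (excess g) y = 10 + (if y = 0 then 16 else 0) - 16 * mult g y := by
  have key : 2 * walsh (excess g) y = (∑ u : Vec5, chi (u ⬝ᵥ y)) -
      (∑ i, ∑ u : Vec5, chi (u ⬝ᵥ (g i + y))) + 20 := by
    rw [Finset.sum_comm, ← Finset.sum_sub_distrib, walsh, Finset.mul_sum]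
    have h20 : (20 : ℤ) = ∑ u : Vec5, (if u = 0 then 20 else 0) * chi (u ⬝ᵥ y) := by
      simp [chi_zero]
    rw [h20, ← Finset.sum_add_distrib]
    refine Finset.sum_congr rfl fun u _ => ?_
    rw [← mul_assoc, two_mul_excess]
    simp_rw [dotProduct_add, chi_add, ← Finset.sum_mul]
    ring
  simp_rw [sum_chi, CharTwo.add_eq_zero] at key
  have h32 : (∑ i, if g i = y then (32 : ℤ) else 0) = 32 * mult g y := by
    rw [mult, Finset.mul_sum]
    simp
  rw [h32] at key
  split_ifs at key ⊢ <;> linarith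

lemma walsh_excess_zero (g : Fin 21 → Vec5) : walsh (excess g) 0 = 26 - 16 * mult g 0 := by
  simp [walsh_excess]

lemma walsh_excess_of_ne (g : Fin 21 → Vec5) {y : Vec5} (hy : y ≠ 0) :
    walsh (excess g) y = 10 - 16 * mult g y := by
  simp [walsh_excess, hy]

lemma IsGood.mult_zero_add_mult_le (hg : IsGood g) {y : Vec5} (hy : y ≠ 0) :
    mult g 0 + mult g y ≤ 1 := by
  set f := slice (excess g) y with hf
  have hf0 : ∀ u, 0 ≤ f u := slice_nonneg hg.excess_nonneg y
  have h1 : 2 * walsh f 0 = 36 - 16 * (mult g 0 + mult g y) := by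
    rw [two_mul_walsh_slice, zero_add, walsh_excess_zero, walsh_excess_of_ne g hy]
    ring
  by_contra! hlt
  have hnonneg := walsh_zero_nonneg hf0
  have h2 : walsh f 0 = 2 := by omega
  refine walsh_zero_ne_two hf0 (by simp [hf, slice, excess]) (fun z => ?_) h2
  rcases eq_or_ne z 0 with rfl | hz
  · exact .inl (slice_zero f)
  rcases eq_or_ne z y with rfl | hzy
  · exact .inl (slice_self _ _)
  have h5 : 2 * walsh f z = 20 - 16 * (mult g z + mult g (z + y)) := by
    rw [two_mul_walsh_slice, walsh_excess_of_ne g hz,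
      walsh_excess_of_ne g (by rwa [Ne, CharTwo.add_eq_zero])]
    ring
  right
  omega

lemma IsGood.mult_zero (hg : IsGood g) : mult g 0 = 0 := by
  by_contra h0
  have hpos := (mult_nonneg g 0).lt_of_ne' h0
  have hsum := sum_mult g
  rw [Finset.sum_eq_single 0] at hsum
  · have := hg.mult_zero_add_mult_le (y := Pi.single 0 1) (by simp)
    have := walsh_zero_nonneg hg.excess_nonneg
    rw [walsh_excess_zero] at this
    omega
  · intro y _ hy
    have := hg.mult_zero_add_mult_le hy
    have := mult_nonneg g y
    omega
  · simp

lemma IsGood.mult_le (hg : IsGood g) (y : Vec5) : mult g y ≤ 1 := by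
  rcases eq_or_ne y 0 with rfl | hy
  · rw [hg.mult_zero]; norm_num
  · have := hg.mult_zero_add_mult_le hy
    rwa [hg.mult_zero, zero_add] at this

lemma IsGood.injective (hg : IsGood g) : Function.Injective g := by
  intro i j hij
  by_contra hne
  have h := hg.mult_le (g j)
  have : ∑ k ∈ {i, j}, (if g k = g j then (1 : ℤ) else 0) ≤ mult g (g j) :=
    Finset.sum_le_sum_of_subset_of_nonneg (Finset.subset_univ _)
      fun k _ _ => by split_ifs <;> simp
  rw [Finset.sum_pair hne, if_pos hij, if_pos rfl] at this
  omega

lemma IsGood.ne_zero (hg : IsGood g) (i : Fin 21) : g i ≠ 0 := by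
  intro h
  have h0 := hg.mult_zero
  rw [mult, Finset.sum_eq_zero_iff_of_nonneg fun k _ => by split_ifs <;> simp] at h0
  simpa [h] using h0 i (Finset.mem_univ i)

lemma weight_cast (g : Fin 21 → Vec5) (u : Vec5) : (weight g u : ZMod 2) = u ⬝ᵥ ∑ i, g i := by
  have key (a : ZMod 2) : a = if a ≠ 0 then 1 else 0 := by revert a; decide
  rw [dotProduct_sum, Finset.sum_congr rfl fun i _ => key _, Finset.sum_boole, weight]

lemma IsGood.mult_apply (hg : IsGood g) (i : Fin 21) : mult g (g i) = 1 := by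
  simp [mult, hg.injective.eq_iff]

lemma IsGood.walsh_excess_zero (hg : IsGood g) : walsh (excess g) 0 = 26 := by
  rw [Code21.walsh_excess_zero, hg.mult_zero]; rfl

lemma two_mul_walsh_indicator (s y : Vec5) :
    2 * walsh (fun u => if u ⬝ᵥ s ≠ 0 then 1 else 0) y =
      (if y = 0 then 32 else 0) - if y = s then 32 else 0 := by
  simp_rw [← CharTwo.add_eq_zero (a := y) (b := s), ← sum_chi]
  rw [walsh, Finset.mul_sum, ← Finset.sum_sub_distrib]
  refine Finset.sum_congr rfl fun u _ => ?_
  rw [dotProduct_add, chi_add]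
  by_cases hu : u ⬝ᵥ s = 0
  · simp [hu, chi_zero]
  · simp [zmod2_eq_one hu, show chi 1 = -1 from rfl]; ring

lemma IsGood.indicator_add_slice_le (hg : IsGood g) (u : Vec5) :
    (if u ⬝ᵥ ∑ i, g i ≠ 0 then 1 else 0) + slice (excess g) (∑ i, g i) u ≤ excess g u := by
  rw [slice]
  by_cases hu : u ⬝ᵥ ∑ i, g i = 0
  · simp [hu]
  · have hu0 : u ≠ 0 := by rintro rfl; simp at hu
    have h10 := hg u hu0
    have : weight g u ≠ 10 := by
      intro h
      have h' := weight_cast g u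
      rw [h] at h'
      exact hu (h'.symm.trans (by decide))
    simp only [hu, excess, hu0, ne_eq, not_false_eq_true, if_true, if_false]
    omega

lemma IsGood.walsh_slice_sum (hg : IsGood g) (hs : ∑ i, g i ≠ 0) :
    walsh (slice (excess g) (∑ i, g i)) 0 = 10 ∧ ∀ y, y ≠ 0 → y ≠ ∑ i, g i →
      walsh (slice (excess g) (∑ i, g i)) y = 10 - 16 * mult g y := by
  have hodd := hg.indicator_add_slice_le
  set s := ∑ i, g i
  set f := slice (excess g) s with hf
  have hsum := two_mul_walsh_indicator s 0
  rw [if_pos rfl, if_neg hs.symm, walsh_zero] at hsum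
  have hle : 16 + walsh f 0 ≤ 26 := by
    rw [← hg.walsh_excess_zero, walsh_zero, walsh_zero,
      show (16 : ℤ) = ∑ u : Vec5, if u ⬝ᵥ s ≠ 0 then 1 else 0 by omega,
      ← Finset.sum_add_distrib]
    exact Finset.sum_le_sum fun u _ => hodd u
  have hfs : 2 * walsh f 0 = 26 + (10 - 16 * mult g s) := by
    rw [two_mul_walsh_slice, hg.walsh_excess_zero, zero_add, walsh_excess_of_ne g hs]
  have hms := hg.mult_le s
  have hf10 : walsh f 0 = 10 := by omega
  refine ⟨hf10, fun y hy hys => ?_⟩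
  have hpt (u : Vec5) : (if u ⬝ᵥ s ≠ 0 then 1 else 0) + f u = excess g u := by
    refine (Finset.sum_eq_sum_iff_of_le (s := Finset.univ) fun u _ => hodd u).mp ?_ u
      (Finset.mem_univ u)
    rw [Finset.sum_add_distrib, ← walsh_zero f, ← walsh_zero (excess g), hg.walsh_excess_zero]
    omega
  have hind := two_mul_walsh_indicator s y
  rw [if_neg hy, if_neg hys] at hind
  have : walsh (excess g) y = walsh (fun u => if u ⬝ᵥ s ≠ 0 then 1 else 0) y + walsh f y := by
    simp only [walsh, ← Finset.sum_add_distrib, ← add_mul, hpt]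
  rw [walsh_excess_of_ne g hy] at this
  omega

lemma IsGood.sum_eq_zero (hg : IsGood g) : ∑ i, g i = 0 := by
  by_contra hs
  obtain ⟨hf10, hfy⟩ := hg.walsh_slice_sum hs
  have hf0 := slice_nonneg hg.excess_nonneg (∑ i, g i)
  set s := ∑ i, g i
  set f := slice (excess g) s with hf
  obtain ⟨i, hi⟩ : ∃ i, g i ≠ s := by
    by_contra! h
    exact absurd (hg.injective ((h 0).trans (h 1).symm)) (by decide)
  have h2 : walsh (slice f (g i)) 0 = 2 := by
    have : 2 * walsh (slice f (g i)) 0 = 10 + (10 - 16 * 1) := by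
      rw [two_mul_walsh_slice, zero_add, hf10, hfy _ (hg.ne_zero i) hi, hg.mult_apply]
    omega
  refine walsh_zero_ne_two (slice_nonneg hf0 _) (by simp [hf, slice, excess]) (fun z => ?_) h2
  rcases eq_or_ne z 0 with rfl | hz
  · exact .inl (slice_zero _)
  rcases eq_or_ne z s with rfl | hzs
  · left
    rw [slice_comm, hf, slice_self]
  rcases eq_or_ne z (g i) with rfl | hzy
  · exact .inl (slice_self _ _)
  rcases eq_or_ne z (g i + s) with rfl | hzys
  · left
    rw [slice_add, slice_comm, hf, slice_self]
  have h5 : 2 * walsh (slice f (g i)) z = 20 - 16 * (mult g z + mult g (z + g i)) := by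
    rw [two_mul_walsh_slice, hfy z hz hzs, hfy (z + g i) (hzy ∘ CharTwo.add_eq_zero.mp)]
    · ring
    · rintro h
      refine hzys ?_
      rw [← h, add_comm z, ← add_assoc, Vec5.add_self, zero_add]
  right
  omega

lemma IsGood.even_weight (hg : IsGood g) (u : Vec5) : Even (weight g u) := by
  rw [← ZMod.natCast_eq_zero_iff_even, weight_cast, hg.sum_eq_zero, dotProduct_zero]

lemma card_filter_le {g : Fin 21 → Vec5} (hg : Function.Injective g) (p : Vec5 → Prop)
    [DecidablePred p] : #{i | p (g i)} ≤ #{x | p x} :=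
  Finset.card_le_card_of_injOn g (by intro i; simp) hg.injOn

lemma IsGood.weight_le (hg : IsGood g) (u : Vec5) : weight g u ≤ 16 := by
  rcases eq_or_ne u 0 with rfl | hu
  · simp [weight]
  · exact (card_filter_le hg.injective _).trans_eq (card_ne_zero hu)

lemma IsGood.sum_excess (hg : IsGood g) : ∑ u, excess g u = 26 := by
  rw [← walsh_zero, hg.walsh_excess_zero]

lemma IsGood.sum_excess_sq (hg : IsGood g) : ∑ u, excess g u ^ 2 = 76 := by
  have h (y : Vec5) :
      walsh (excess g) y ^ 2 = 100 + (if y = 0 then 576 else 0) - 64 * mult g y := by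
    rcases eq_or_ne y 0 with rfl | hy
    · rw [hg.walsh_excess_zero, hg.mult_zero]; rfl
    · rw [walsh_excess_of_ne g hy, if_neg hy]
      have h0 := mult_nonneg g y
      have h1 := hg.mult_le y
      interval_cases mult g y <;> norm_num
  have := sum_walsh_sq (excess g)
  simp_rw [h, Finset.sum_sub_distrib, Finset.sum_add_distrib, ← Finset.mul_sum, sum_mult] at this
  simp at this
  omega

/-- Some codeword has weight `16`, or exactly three codewords have weight `14`. -/
lemma IsGood.exists_weight (hg : IsGood g) :
    (∃ h, weight g h = 16) ∨ #{u | weight g u = 14} = 3 := by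
  rw [or_iff_not_imp_left]
  intro hne
  push Not at hne
  have key (u : Vec5) : excess g u ^ 2 - 2 * excess g u =
      8 * if weight g u = 14 then 1 else 0 := by
    rcases eq_or_ne u 0 with rfl | hu
    · simp [excess_zero, weight]
    · have h10 := hg u hu
      have h16 := hg.weight_le u
      obtain ⟨k, hk⟩ := hg.even_weight u
      have hk' : k = 5 ∨ k = 6 ∨ k = 7 := by
        have := hne u
        omega
      rcases hk' with rfl | rfl | rfl <;> simp [excess, hu, hk]
  have := Finset.sum_congr (rfl : (Finset.univ : Finset Vec5) = Finset.univ) fun u _ => key u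
  rw [← Finset.mul_sum, Finset.sum_sub_distrib, ← Finset.mul_sum, hg.sum_excess_sq,
    hg.sum_excess, Finset.sum_boole] at this
  push_cast at this
  omega

/-- The vector of the five lowest binary digits of `n`. -/
def bits (n : ℕ) : Vec5 := fun k => if n.testBit k then 1 else 0

/-- All points of `PG(4, 2)` outside a plane and a line that are disjoint. -/
def belovColumns (j : Fin 21) : Vec5 := bits (4 * (j / 3 + 1) + (j % 3 + 1))

/-- All points of `PG(4, 2)` outside a hyperplane, and a frame of that hyperplane. -/
def frameColumns (j : Fin 21) : Vec5 := bits (if j < 4 then 2 ^ (j : ℕ) else j + 11)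

lemma exists_belovColumns {x : Vec5} (h : ¬(x 0 = 0 ∧ x 1 = 0)) (h0 : x ≠ ![1, 0, 0, 0, 0])
    (h1 : x ≠ ![0, 1, 0, 0, 0]) (h01 : x ≠ ![1, 1, 0, 0, 0]) : ∃ j, x = belovColumns j := by
  revert x; decide +kernel

lemma exists_frameColumns {x : Vec5} (h : x 4 = 1) : ∃ j, x = frameColumns j := by
  revert x; decide +kernel

lemma exists_frameColumns_of_apply_eq_zero {x : Vec5} (h4 : x 4 = 0)
    (h : (∃ k, x = Pi.single k 1) ∨ ∀ k, k ≠ 4 → x k ≠ 0) : ∃ j, x = frameColumns j := by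
  revert x; decide +kernel

lemma isGood_belovColumns : IsGood belovColumns := by
  unfold IsGood; decide +kernel

lemma isGood_frameColumns : IsGood frameColumns := by
  unfold IsGood; decide +kernel

lemma weight_belovColumns_ne (u : Vec5) : weight belovColumns u ≠ 16 := by
  revert u; decide +kernel

lemma weight_frameColumns : weight frameColumns ![0, 0, 0, 0, 1] = 16 := by
  decide +kernel

lemma weight_zero (g : Fin 21 → Vec5) : weight g 0 = 0 := by
  simp [weight]

lemma weight_add (g : Fin 21 → Vec5) (u v : Vec5) :
    weight g (u + v) + 2 * #{i | u ⬝ᵥ g i ≠ 0 ∧ v ⬝ᵥ g i ≠ 0} = weight g u + weight g v := by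
  have key (a b : ZMod 2) : (if a + b ≠ 0 then 1 else 0) + 2 * (if a ≠ 0 ∧ b ≠ 0 then 1 else 0) =
      (if a ≠ 0 then 1 else 0) + if b ≠ 0 then 1 else 0 := by
    revert a b; decide
  simp only [weight, Finset.card_filter, Finset.mul_sum, ← Finset.sum_add_distrib,
    add_dotProduct, key]

lemma weight_eq_card_add (g : Fin 21 → Vec5) (u v : Vec5) :
    weight g u = #{i | u ⬝ᵥ g i ≠ 0 ∧ v ⬝ᵥ g i ≠ 0} + #{i | u ⬝ᵥ g i ≠ 0 ∧ v ⬝ᵥ g i = 0} := by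
  have h := Finset.card_filter_add_card_filter_not (s := {i | u ⬝ᵥ g i ≠ 0})
    (fun i => v ⬝ᵥ g i ≠ 0)
  simp only [Finset.filter_filter, not_not] at h
  exact h.symm

lemma exists_notMem_range {g : Fin 21 → Vec5} {p : Vec5 → Prop} [DecidablePred p]
    (h : #{i | p (g i)} < #{x | p x}) : ∃ x, p x ∧ ∀ i, g i ≠ x := by
  by_contra! hall
  refine h.not_ge ((Finset.card_le_card (t := Finset.image g {i | p (g i)}) fun x hx => ?_).trans
    Finset.card_image_le)
  obtain ⟨i, rfl⟩ := hall x (by simpa using hx)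
  exact Finset.mem_image_of_mem g (by simpa using hx)

/-- If `h` has weight `16`, every other hyperplane misses at least two of the columns orthogonal
to `h`. -/
lemma IsGood.two_le_card (hg : IsGood g) {h w : Vec5} (hh : weight g h = 16) (hw : w ≠ 0)
    (hwh : w ≠ h) : 2 ≤ #{i | w ⬝ᵥ g i ≠ 0 ∧ h ⬝ᵥ g i = 0} := by
  have hh0 : h ≠ 0 := by rintro rfl; simp [weight_zero] at hh
  have h1 := weight_eq_card_add g w h
  have h2 := card_filter_le hg.injective fun x => w ⬝ᵥ x ≠ 0 ∧ h ⬝ᵥ x ≠ 0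
  rw [card_ne_zero_and hw hh0 hwh] at h2
  have h3 := hg w hw
  omega

lemma single_vecMul_dotProduct (A : Matrix (Fin 5) (Fin 5) (ZMod 2)) (y : Vec5) (k : Fin 5) : 
    (Pi.single k 1 ᵥ* A) ⬝ᵥ y = (A *ᵥ y) k := by
  rw [← dotProduct_mulVec, single_one_dotProduct]

lemma IsGood.exists_frameColumns (hg : IsGood g) {h : Vec5} (hh : weight g h = 16) :
    ∃ A : Matrix (Fin 5) (Fin 5) (ZMod 2), IsUnit A ∧ ∀ i, ∃ j, g i = A *ᵥ frameColumns j := by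
  have hh0 : h ≠ 0 := by rintro rfl; simp [weight_zero] at hh
  have hcard : #{i | h ⬝ᵥ g i = 0} = 5 := by
    have := Finset.card_filter_add_card_filter_not (s := Finset.univ) (fun i => h ⬝ᵥ g i = 0)
    rw [Finset.card_univ, Fintype.card_fin] at this
    change _ + weight g h = 21 at this
    omega
  set s := Finset.orderEmbOfFin _ hcard with hs
  have hmem (i : Fin 21) : h ⬝ᵥ g i = 0 ↔ ∃ k, s k = i := by
    have := Finset.range_orderEmbOfFin _ hcard
    rw [← hs] at this
    rw [← Set.mem_range, this]
    simp
  obtain ⟨k₀, hk₀⟩ := Function.ne_iff.mp hh0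
  have two (w : Vec5) (hw : w ≠ 0) (hwh : w ≠ h) : ∃ k l, k < l ∧
      w ⬝ᵥ g (s k) ≠ 0 ∧ w ⬝ᵥ g (s l) ≠ 0 := by
    obtain ⟨i, hi, j, hj, hij⟩ := Finset.one_lt_card.mp (hg.two_le_card hh hw hwh)
    simp only [Finset.mem_filter, Finset.mem_univ, true_and, hmem] at hi hj
    obtain ⟨hi, k, rfl⟩ := hi
    obtain ⟨hj, l, rfl⟩ := hj
    rcases lt_trichotomy k l with hkl | rfl | hkl
    · exact ⟨k, l, hkl, hi, hj⟩
    · exact absurd rfl hij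
    · exact ⟨l, k, hkl, hj, hi⟩
  let c : Fin 5 → Vec5 := fun k => if k = 4 then Pi.single k₀ 1 else g (s k)
  let A : Matrix (Fin 5) (Fin 5) (ZMod 2) := (Matrix.of c)ᵀ
  have hc (w : Vec5) (k : Fin 5) : (w ᵥ* A) k = w ⬝ᵥ c k := rfl
  have hhs (k : Fin 5) : h ⬝ᵥ g (s k) = 0 := (hmem _).mpr ⟨k, rfl⟩
  have hA : IsUnit A := by
    rw [← vecMul_injective_iff_isUnit]
    refine (injective_iff_map_eq_zero (Matrix.vecMulLinear A)).mpr fun w hw => ?_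
    have hw' (k : Fin 5) : w ⬝ᵥ c k = 0 := congrFun hw k
    by_contra hw0
    obtain ⟨k, l, hkl, hk, -⟩ := two w hw0 (by
      rintro rfl
      have := hw' 4
      simp only [c, if_true, dotProduct_single_one] at this
      exact hk₀ this)
    have := hw' k
    simp only [c, if_neg (show k ≠ 4 by omega)] at this
    exact hk this
  have hcancel (y : Vec5) : A *ᵥ (A⁻¹ *ᵥ y) = y := by
    rw [mulVec_mulVec, mul_nonsing_inv _ ((isUnit_iff_isUnit_det _).mp hA), one_mulVec]
  have hinv : A⁻¹ * A = 1 := nonsing_inv_mul _ ((isUnit_iff_isUnit_det _).mp hA)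
  have hhA : h ᵥ* A = Pi.single 4 1 := by
    ext k
    rw [hc]
    by_cases hk : k = 4
    · subst hk
      simpa [c] using zmod2_eq_one hk₀
    · simp [c, hk, hhs]
  have hlast (y : Vec5) : (A⁻¹ *ᵥ y) 4 = h ⬝ᵥ y := by
    conv_rhs => rw [← hcancel y, dotProduct_mulVec, hhA, single_one_dotProduct]
  refine ⟨A, hA, fun i => ?_⟩
  suffices ∃ j, A⁻¹ *ᵥ g i = frameColumns j by
    obtain ⟨j, hj⟩ := this
    exact ⟨j, by rw [← hj, hcancel]⟩
  by_cases hi : h ⬝ᵥ g i = 0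
  · refine exists_frameColumns_of_apply_eq_zero ((hlast _).trans hi) ?_
    obtain ⟨k, rfl⟩ := (hmem i).mp hi
    by_cases hk : k = 4
    · right
      intro l hl hzero
      subst hk
      set w := Pi.single l 1 ᵥ* A⁻¹ with hw
      have hwA : w ᵥ* A = Pi.single l 1 := by rw [hw, vecMul_vecMul, hinv, vecMul_one]
      have hwc (m : Fin 5) (hm : m ≠ l) : w ⬝ᵥ c m = 0 := by rw [← hc, hwA, Pi.single_eq_of_ne hm]
      have hws (m : Fin 5) (hm : w ⬝ᵥ g (s m) ≠ 0) : m = l := by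
        by_contra hml
        by_cases hm4 : m = 4
        · subst hm4
          rw [single_vecMul_dotProduct] at hm
          exact hm hzero
        · have := hwc m hml
          simp only [c, if_neg hm4] at this
          exact hm this
      obtain ⟨m, m', hmm, h1, h2⟩ := two w
        (by
          intro h0
          rw [h0, zero_vecMul] at hwA
          simpa using congrFun hwA l)
        (by
          intro h0
          rw [h0, hhA] at hwA
          simpa [hl] using congrFun hwA l)
      exact hmm.ne ((hws m h1).trans (hws m' h2).symm)
    · left
      refine ⟨k, ?_⟩
      have : g (s k) = A *ᵥ Pi.single k 1 := by
        rw [mulVec_single_one]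
        ext r
        simp [A, c, hk]
      rw [this, mulVec_mulVec, hinv, one_mulVec]
  · exact Code21.exists_frameColumns ((hlast _).trans (zmod2_eq_one hi))

lemma IsGood.weight_add_ge (hg : IsGood g) {u v : Vec5} (hu : weight g u = 14)
    (hv : weight g v = 14) (huv : u ≠ v) : 12 ≤ weight g (u + v) := by
  have h := weight_add g u v
  have h' := card_filter_le hg.injective fun x => u ⬝ᵥ x ≠ 0 ∧ v ⬝ᵥ x ≠ 0
  rw [card_ne_zero_and (by rintro rfl; simp [weight_zero] at hu)
    (by rintro rfl; simp [weight_zero] at hv) huv] at h'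
  omega

/-- Three messages of weight `14` are linearly dependent. -/
lemma IsGood.add_add_eq_zero (hg : IsGood g) {u v w : Vec5} (hu : weight g u = 14)
    (hv : weight g v = 14) (hw : weight g w = 14) (huv : u ≠ v) (huw : u ≠ w) (hvw : v ≠ w) :
    u + v + w = 0 := by
  by_contra h0
  have key (a b c : ZMod 2) : (if a ≠ 0 then 1 else 0) + (if b ≠ 0 then 1 else 0) +
      (if c ≠ 0 then 1 else 0) + (if a + b ≠ 0 then 1 else 0) + (if a + c ≠ 0 then 1 else 0) +
      (if b + c ≠ 0 then 1 else 0) + (if a + b + c ≠ 0 then 1 else 0) ≤ 4 := by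
    revert a b c; decide
  have hsum : weight g u + weight g v + weight g w + weight g (u + v) + weight g (u + w) +
      weight g (v + w) + weight g (u + v + w) ≤ 84 := by
    simp only [weight, Finset.card_filter, ← Finset.sum_add_distrib, add_dotProduct]
    exact Finset.sum_le_card_nsmul _ _ _ fun i _ => key _ _ _
  have h1 := hg.weight_add_ge hu hv huv
  have h2 := hg.weight_add_ge hu hw huw
  have h3 := hg.weight_add_ge hv hw hvw
  have h4 := hg _ h0
  omega

/-- Points `a`, `b` separated by two functionals extend by the common kernel of the functionals
to a basis. -/
lemma exists_isUnit_of_dotProduct {u v a b : Vec5} (hua : u ⬝ᵥ a = 1) (hva : v ⬝ᵥ a = 0)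
    (hub : u ⬝ᵥ b = 0) (hvb : v ⬝ᵥ b = 1) :
    ∃ A : Matrix (Fin 5) (Fin 5) (ZMod 2), IsUnit A ∧ A *ᵥ ![1, 0, 0, 0, 0] = a ∧
      A *ᵥ ![0, 1, 0, 0, 0] = b ∧ (∀ x, u ⬝ᵥ A *ᵥ x = x 0) ∧ ∀ x, v ⬝ᵥ A *ᵥ x = x 1 := by
  let f : Vec5 →ₗ[ZMod 2] (Fin 2 → ZMod 2) := (Matrix.of ![u, v]).mulVecLin
  have hf (x : Vec5) : f x = ![u ⬝ᵥ x, v ⬝ᵥ x] := by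
    ext k; fin_cases k <;> rfl
  have hsurj : Function.Surjective f := fun y => by
    refine ⟨y 0 • a + y 1 • b, ?_⟩
    rw [hf]
    ext k; fin_cases k <;> simp [dotProduct_add, *]
  have hker : Module.finrank (ZMod 2) (LinearMap.ker f) = 3 := by
    have h := f.finrank_range_add_finrank_ker
    rw [LinearMap.range_eq_top.mpr hsurj] at h
    simp at h
    omega
  let p := Module.finBasisOfFinrankEq (ZMod 2) (LinearMap.ker f) hker
  have hp (k : Fin 3) : u ⬝ᵥ (p k : Vec5) = 0 ∧ v ⬝ᵥ (p k : Vec5) = 0 := by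
    have h : f (p k) = 0 := LinearMap.mem_ker.mp (p k).2
    rw [hf] at h
    exact ⟨congrFun h 0, congrFun h 1⟩
  let A : Matrix (Fin 5) (Fin 5) (ZMod 2) := (Matrix.of ![a, b, p 0, p 1, p 2])ᵀ
  have hA (x : Vec5) : A *ᵥ x = x 0 • a + x 1 • b +
      ((∑ k : Fin 3, x (k.natAdd 2) • p k : LinearMap.ker f) : Vec5) := by
    rw [mulVec_eq_sum, Fin.sum_univ_five, Fin.sum_univ_three]
    simp only [Submodule.coe_add, Submodule.coe_smul, ← add_assoc]
    simp [A]
    rfl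
  have hsum (y : LinearMap.ker f) : u ⬝ᵥ (y : Vec5) = 0 ∧ v ⬝ᵥ (y : Vec5) = 0 := by
    have h : f y = 0 := LinearMap.mem_ker.mp y.2
    rw [hf] at h
    exact ⟨congrFun h 0, congrFun h 1⟩
  have hu (x : Vec5) : u ⬝ᵥ A *ᵥ x = x 0 := by
    rw [hA, dotProduct_add, dotProduct_add, (hsum _).1]
    simp [*]
  have hv (x : Vec5) : v ⬝ᵥ A *ᵥ x = x 1 := by
    rw [hA, dotProduct_add, dotProduct_add, (hsum _).2]
    simp [*]
  refine ⟨A, ?_, ?_, ?_, hu, hv⟩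
  · rw [← mulVec_injective_iff_isUnit]
    refine (injective_iff_map_eq_zero A.mulVecLin).mpr fun x hx => ?_
    rw [mulVecLin_apply] at hx
    have h0 := hu x
    have h1 := hv x
    rw [hx, dotProduct_zero] at h0 h1
    rw [hA, ← h0, ← h1, zero_smul, zero_smul, zero_add, zero_add] at hx
    have h := Fintype.linearIndependent_iff.mp p.linearIndependent _ (Subtype.ext hx)
    ext k
    fin_cases k
    · exact h0.symm
    · exact h1.symm
    · exact h 0
    · exact h 1
    · exact h 2
  · rw [hA]; simp [Fin.sum_univ_three, Fin.natAdd]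
  · rw [hA]; simp [Fin.sum_univ_three, Fin.natAdd]

/-- A good code whose columns miss the plane `x 0 = x 1 = 0` and two points of a line disjoint
from it also misses the third one, if it misses another point of the same coset of the plane. -/
lemma IsGood.eq_of_notMem_range (hg : IsGood g) (hP : ∀ i, ¬(g i 0 = 0 ∧ g i 1 = 0))
    (ha : ∀ i, g i ≠ ![1, 0, 0, 0, 0]) (hb : ∀ i, g i ≠ ![0, 1, 0, 0, 0]) {c : Vec5}
    (hc0 : c 0 = 1) (hc1 : c 1 = 1) (hc : ∀ i, g i ≠ c) : c = ![1, 1, 0, 0, 0] := by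
  by_contra hne
  obtain ⟨k, hk2, hk⟩ : ∃ k : Fin 5, 2 ≤ k ∧ c k ≠ 0 := by
    by_contra! h
    refine hne ?_
    ext k
    fin_cases k
    · exact hc0
    · exact hc1
    · exact h 2 le_rfl
    · exact h 3 (by decide)
    · exact h 4 (by decide)
  let w : Vec5 := Pi.single 0 1 + Pi.single 1 1 + Pi.single k 1
  let T : Finset Vec5 := {x | w ⬝ᵥ x ≠ 0 ∧ ¬(x 0 = 0 ∧ x 1 = 0) ∧ x ≠ ![1, 0, 0, 0, 0] ∧
    x ≠ ![0, 1, 0, 0, 0]}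
  have hT : #T = 10 := by
    simp only [T, w]
    clear_value w
    clear * - hk2
    revert k; decide +kernel
  have hw : w ≠ 0 := fun h => by
    have : k ≠ 0 := by rintro rfl; simp at hk2
    simpa [w, this] using congrFun h 0
  have hwc : w ⬝ᵥ c ≠ 0 := by
    simp only [w, add_dotProduct, single_one_dotProduct, hc0, hc1, zmod2_eq_one hk]
    decide
  have hcT : c ∈ T := by
    simp only [T, Finset.mem_filter, Finset.mem_univ, true_and]
    refine ⟨hwc, by simp [hc0], ?_, ?_⟩ <;> rintro rfl
    · simp at hc1
    · simp at hc0
  have hle : weight g w ≤ #(T.erase c) := by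
    refine Finset.card_le_card_of_injOn g (fun i hi => ?_) hg.injective.injOn
    have hi' : w ⬝ᵥ g i ≠ 0 := by simpa using hi
    simp only [T, Finset.coe_erase, Set.mem_sdiff, Finset.mem_coe, Finset.mem_filter,
      Finset.mem_univ, true_and, Set.mem_singleton_iff]
    exact ⟨⟨hi', hP i, ha i, hb i⟩, hc i⟩
  rw [Finset.card_erase_of_mem hcT, hT] at hle
  have := hg w hw
  omega

lemma IsGood.of_mulVec {g' : Fin 21 → Vec5} {A : Matrix (Fin 5) (Fin 5) (ZMod 2)} (hA : IsUnit A)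
    (hg : IsGood g) (h : ∀ i, g i = A *ᵥ g' i) : IsGood g' := by
  intro u hu
  have hdet := (isUnit_iff_isUnit_det _).mp hA
  have huA : u = (u ᵥ* A⁻¹) ᵥ* A := by
    rw [vecMul_vecMul, nonsing_inv_mul _ hdet, vecMul_one]
  have := hg (u ᵥ* A⁻¹) (by rintro h0; rw [h0, zero_vecMul] at huA; exact hu huA)
  simp only [weight, h, dotProduct_mulVec] at this
  rwa [← huA] at this

lemma IsGood.exists_belovColumns (hg : IsGood g) (h3 : #{u | weight g u = 14} = 3) :
    ∃ A : Matrix (Fin 5) (Fin 5) (ZMod 2), IsUnit A ∧ ∀ i, ∃ j, g i = A *ᵥ belovColumns j := by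
  obtain ⟨u, v, w, huv, huw, hvw, huvw⟩ := Finset.card_eq_three.mp h3
  have hmem (x : Vec5) (hx : x ∈ ({u, v, w} : Finset Vec5)) : weight g x = 14 := by
    rw [← huvw] at hx; simpa using hx
  have hu := hmem u (by simp)
  have hv := hmem v (by simp)
  have hw := hmem w (by simp)
  have hadd := CharTwo.add_eq_zero.mp (hg.add_add_eq_zero hu hv hw huv huw hvw)
  rw [← hadd] at hw
  have hu0 : u ≠ 0 := by rintro rfl; simp [weight_zero] at hu
  have hv0 : v ≠ 0 := by rintro rfl; simp [weight_zero] at hv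
  have h1 := weight_add g u v
  have h2 := weight_eq_card_add g u v
  have h4 := weight_eq_card_add g v u
  simp only [and_comm (a := v ⬝ᵥ _ ≠ 0) (b := u ⬝ᵥ _ ≠ 0)] at h4
  have hP (i : Fin 21) : ¬(u ⬝ᵥ g i = 0 ∧ v ⬝ᵥ g i = 0) := by
    have hle : weight g u + #{i | v ⬝ᵥ g i ≠ 0 ∧ u ⬝ᵥ g i = 0} +
        #{i | u ⬝ᵥ g i = 0 ∧ v ⬝ᵥ g i = 0} = 21 := by
      have key (a b : ZMod 2) : (if a ≠ 0 then 1 else 0) + (if b ≠ 0 ∧ a = 0 then 1 else 0) +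
          (if a = 0 ∧ b = 0 then 1 else 0) = 1 := by
        revert a b; decide
      simp only [weight, Finset.card_filter, ← Finset.sum_add_distrib, key]
      rfl
    have h0 : #{i | u ⬝ᵥ g i = 0 ∧ v ⬝ᵥ g i = 0} = 0 := by omega
    rw [Finset.card_eq_zero, Finset.filter_eq_empty_iff] at h0
    exact h0 (Finset.mem_univ i)
  obtain ⟨a, ⟨hua, hva⟩, ha⟩ := exists_notMem_range (g := g)
    (p := fun x => u ⬝ᵥ x ≠ 0 ∧ v ⬝ᵥ x = 0) (by
      rw [card_ne_zero_and_eq_zero hu0 hv0 huv]; omega)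
  obtain ⟨b, ⟨hvb, hub⟩, hb⟩ := exists_notMem_range (g := g)
    (p := fun x => v ⬝ᵥ x ≠ 0 ∧ u ⬝ᵥ x = 0) (by
      rw [card_ne_zero_and_eq_zero hv0 hu0 huv.symm]; omega)
  obtain ⟨c, ⟨huc, hvc⟩, hc⟩ := exists_notMem_range (g := g)
    (p := fun x => u ⬝ᵥ x ≠ 0 ∧ v ⬝ᵥ x ≠ 0) (by
      rw [card_ne_zero_and hu0 hv0 huv]; omega)
  obtain ⟨A, hA, hAa, hAb, hAu, hAv⟩ :=
    exists_isUnit_of_dotProduct (zmod2_eq_one hua) hva hub (zmod2_eq_one hvb)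
  have hcancel (y : Vec5) : A *ᵥ (A⁻¹ *ᵥ y) = y := by
    rw [mulVec_mulVec, mul_nonsing_inv _ ((isUnit_iff_isUnit_det _).mp hA), one_mulVec]
  have hg' : IsGood fun i => A⁻¹ *ᵥ g i := hg.of_mulVec hA fun i => (hcancel _).symm
  have hne {x : Vec5} (hx : ∀ i, g i ≠ A *ᵥ x) (i : Fin 21) : A⁻¹ *ᵥ g i ≠ x := by
    rintro rfl
    exact hx i (hcancel _).symm
  have hP' (i : Fin 21) : ¬((A⁻¹ *ᵥ g i) 0 = 0 ∧ (A⁻¹ *ᵥ g i) 1 = 0) := by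
    rw [← hAu (A⁻¹ *ᵥ g i), ← hAv (A⁻¹ *ᵥ g i), hcancel]
    exact hP i
  have ha' := hne (hAa.symm ▸ ha)
  have hb' := hne (hAb.symm ▸ hb)
  have hc' := hne (x := A⁻¹ *ᵥ c) ((hcancel c).symm ▸ hc)
  have hcc := hg'.eq_of_notMem_range hP' ha' hb'
    (by rw [← hAu (A⁻¹ *ᵥ c), hcancel, zmod2_eq_one huc])
    (by rw [← hAv (A⁻¹ *ᵥ c), hcancel, zmod2_eq_one hvc]) hc'
  refine ⟨A, hA, fun i => ?_⟩
  obtain ⟨j, hj⟩ := Code21.exists_belovColumns (hP' i) (ha' i) (hb' i) (hcc ▸ hc' i)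
  exact ⟨j, by rw [← hj, hcancel]⟩

/-- The code whose generator matrix has columns `g`. -/
def codeOf (g : Fin 21 → Vec5) : Submodule (ZMod 2) (Fin 21 → ZMod 2) :=
  LinearMap.range (Matrix.of g).mulVecLin

lemma mem_codeOf {x : Fin 21 → ZMod 2} : x ∈ codeOf g ↔ ∃ u, ∀ i, u ⬝ᵥ g i = x i := by
  simp only [codeOf, LinearMap.mem_range, funext_iff]
  refine exists_congr fun u => forall_congr' fun i => ?_
  rw [dotProduct_comm]; rfl

lemma IsGood.isCode (hg : IsGood g) : IsCode21_5_10 (codeOf g) := by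
  constructor
  · rw [codeOf, LinearMap.finrank_range_of_inj]
    · simp
    · refine (injective_iff_map_eq_zero _).mpr fun u hu => ?_
      by_contra hu0
      have h10 := hg u hu0
      have (i : Fin 21) : u ⬝ᵥ g i = 0 := by
        rw [dotProduct_comm]; exact congrFun hu i
      simp [weight, this] at h10
  · intro x hx hx0
    obtain ⟨u, hu⟩ := mem_codeOf.mp hx
    have hu0 : u ≠ 0 := by
      rintro rfl
      refine hx0 (funext fun i => ?_)
      rw [← hu, zero_dotProduct]; rfl
    have := hg u hu0
    simp only [weight, hu] at this
    exact this

lemma exists_codeOf {C : Submodule (ZMod 2) (Fin 21 → ZMod 2)} (hC : IsCode21_5_10 C) :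
    ∃ g, IsGood g ∧ codeOf g = C := by
  obtain ⟨hdim, hmin⟩ := hC
  let e : Vec5 ≃ₗ[ZMod 2] C := LinearEquiv.ofFinrankEq _ _ (by simp [hdim])
  let M := LinearMap.toMatrix' (C.subtype ∘ₗ e.toLinearMap)
  have hM (u : Vec5) : M *ᵥ u = e u := LinearMap.toMatrix'_mulVec _ _
  refine ⟨fun i => M i, fun u hu => ?_, ?_⟩
  · have h10 := hmin (e u) (e u).2 (by simpa using hu)
    rw [← hM] at h10
    simp only [weight, dotProduct_comm u]
    exact h10
  · ext x
    simp only [codeOf, LinearMap.mem_range, mulVecLin_apply]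
    change (∃ u, M *ᵥ u = x) ↔ _
    simp only [hM]
    constructor
    · rintro ⟨u, rfl⟩
      exact (e u).2
    · intro hx
      exact ⟨e.symm ⟨x, hx⟩, by simp⟩

lemma codePermEquiv_of_mulVec {g' : Fin 21 → Vec5} {A : Matrix (Fin 5) (Fin 5) (ZMod 2)}
    (hA : IsUnit A) (hg : Function.Injective g) (h : ∀ i, ∃ j, g i = A *ᵥ g' j) :
    CodePermEquiv (codeOf g) (codeOf g') := by
  choose σ hσ using h
  have hinj : Function.Injective σ := fun i j hij => hg (by rw [hσ, hσ, hij])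
  let τ : Equiv.Perm (Fin 21) := Equiv.ofBijective σ (Finite.injective_iff_bijective.mp hinj)
  have hτ (j : Fin 21) : g (τ.symm j) = A *ᵥ g' j := by
    rw [hσ]
    exact congrArg (fun k => A *ᵥ g' k) (τ.apply_symm_apply j)
  refine ⟨τ.symm, ?_⟩
  ext x
  simp only [Submodule.mem_map, mem_codeOf]
  constructor
  · rintro ⟨y, ⟨u, hu⟩, rfl⟩
    refine ⟨u ᵥ* A, fun j => ?_⟩
    rw [← dotProduct_mulVec, ← hτ, hu]; rfl
  · rintro ⟨u, hu⟩
    refine ⟨x ∘ τ, ⟨u ᵥ* A⁻¹, fun i => ?_⟩, ?_⟩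
    · rw [← τ.symm_apply_apply i, hτ, dotProduct_mulVec, vecMul_vecMul,
        nonsing_inv_mul _ ((isUnit_iff_isUnit_det _).mp hA), vecMul_one, hu]
      simp
    · ext j
      simp [LinearMap.funLeft]

lemma exists_weight_eq {g' : Fin 21 → Vec5} (h : CodePermEquiv (codeOf g) (codeOf g')) (u : Vec5) :
    ∃ v, weight g v = weight g' u := by
  obtain ⟨σ, hσ⟩ := h
  have hmem : (fun i => u ⬝ᵥ g' i) ∈ codeOf g' := mem_codeOf.mpr ⟨u, fun _ => rfl⟩
  rw [← hσ] at hmem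
  obtain ⟨y, hy, hyu⟩ := hmem
  obtain ⟨v, hv⟩ := mem_codeOf.mp hy
  refine ⟨v, ?_⟩
  simp only [weight, hv]
  refine Finset.card_equiv σ.symm fun i => ?_
  have := congrFun hyu (σ.symm i)
  simp only [LinearMap.funLeft_apply, Equiv.apply_symm_apply] at this
  simp [this]

end Code21

/-- Up to coordinate permutation, there are exactly two binary linear
[21,5,10] codes. -/
theorem two_codes_21_5_10 :
    ∃ C₁ C₂ : Submodule (ZMod 2) (Fin 21 → ZMod 2),
      IsCode21_5_10 C₁ ∧ IsCode21_5_10 C₂ ∧ ¬ CodePermEquiv C₁ C₂ ∧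
      ∀ C : Submodule (ZMod 2) (Fin 21 → ZMod 2), IsCode21_5_10 C →
        CodePermEquiv C C₁ ∨ CodePermEquiv C C₂ := by
  refine ⟨Code21.codeOf Code21.belovColumns, Code21.codeOf Code21.frameColumns,
    Code21.isGood_belovColumns.isCode, Code21.isGood_frameColumns.isCode, fun h => ?_,
    fun C hC => ?_⟩
  · obtain ⟨v, hv⟩ := Code21.exists_weight_eq h ![0, 0, 0, 0, 1]
    exact Code21.weight_belovColumns_ne v (hv.trans Code21.weight_frameColumns)
  · obtain ⟨g, hg, rfl⟩ := Code21.exists_codeOf hC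
    rcases hg.exists_weight with ⟨u, hu⟩ | h3
    · obtain ⟨A, hA, h⟩ := hg.exists_frameColumns hu
      exact .inr (Code21.codePermEquiv_of_mulVec hA hg.injective h)
    · obtain ⟨A, hA, h⟩ := hg.exists_belovColumns h3
      exact .inl (Code21.codePermEquiv_of_mulVec hA hg.injective h)
end

section
/- The two inequivalent [21,5,10] codes have automorphism groups of orders 1008 and 1920 respectively. -/
def rowsA : Set (Fin 21 → ZMod 2) :=
  {(![1,1,1,1,1,1,1,1,1,1,0,0,0,0,0,0,0,0,0,0,0] : Fin 21 → ZMod 2),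
    (![1,1,1,0,0,0,0,0,0,0,1,1,1,1,1,1,1,0,0,0,0] : Fin 21 → ZMod 2),
    (![0,0,0,1,1,1,0,0,0,0,1,1,1,0,0,0,0,1,1,1,1] : Fin 21 → ZMod 2),
    (![1,0,0,1,0,0,1,1,0,0,1,1,0,1,1,0,0,1,1,0,0] : Fin 21 → ZMod 2),
    (![0,1,0,0,1,0,1,0,1,0,1,0,1,1,0,1,0,1,0,1,0] : Fin 21 → ZMod 2)}
def rowsB : Set (Fin 21 → ZMod 2) :=
  {(![1,1,1,1,1,1,1,1,1,1,0,0,0,0,0,0,0,0,0,0,0] : Fin 21 → ZMod 2),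
    (![1,1,0,0,0,0,0,0,0,0,1,1,1,1,1,1,1,1,0,0,0] : Fin 21 → ZMod 2),
    (![1,0,1,1,1,1,0,0,0,0,1,1,1,1,0,0,0,0,1,1,1] : Fin 21 → ZMod 2),
    (![0,0,1,1,0,0,1,1,0,0,1,1,0,0,1,1,0,0,1,1,0] : Fin 21 → ZMod 2),
    (![0,0,1,0,1,0,1,0,1,0,1,0,1,0,1,0,1,0,1,0,1] : Fin 21 → ZMod 2)}
/-- The first [21,5,10] code. -/
noncomputable def codeA : Submodule (ZMod 2) (Fin 21 → ZMod 2) :=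
  Submodule.span (ZMod 2) rowsA

/-- The second [21,5,10] code. -/
noncomputable def codeB : Submodule (ZMod 2) (Fin 21 → ZMod 2) :=
  Submodule.span (ZMod 2) rowsB

/-- The value at `s` of the `𝔽₂`-linear map, on natural numbers read as bit vectors, that sends `2 ^ i`
to the `i`-th entry of `l` counted from the end of the list. -/
def xorCombination : List ℕ → ℕ → ℕ
  | [], _ => 0
  | y :: l, s => xorCombination l s ^^^ bif s.testBit l.length then y else 0

/-- The list `[f (m - 1), …, f 1, f 0]`. -/
def revValues (f : ℕ → ℕ) : ℕ → List ℕ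
  | 0 => []
  | m + 1 => f m :: revValues f m

/-- Whether `m` has equal binary digits at the positions `s` and `t`. The operations are those with
built-in kernel evaluation. -/
def sameBit (m s t : ℕ) : Bool :=
  Nat.beq (Nat.land (Nat.shiftRight m s) 1) (Nat.land (Nat.shiftRight m t) 1)

/-- The lists of `k` elements of `cs` whose associated linear map preserves and reflects membership in
the set of bits of `mask`, for the vectors below `2 ^ k`. -/
def partialMaps (cs : List ℕ) (mask : ℕ) : ℕ → List (List ℕ)
  | 0 => [[]]
  | k + 1 => (partialMaps cs mask k).flatMap fun l =>
      (cs.filter fun y => (List.range (2 ^ k)).all fun s =>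
        sameBit mask (Nat.add (Nat.pow 2 k) s) (Nat.xor (xorCombination l s) y)).map (· :: l)

/-- A bit as an element of `𝔽₂`. -/
def bitToZMod (b : Bool) : ZMod 2 := bif b then 1 else 0

/-- The `k`-th row of the generator matrix whose `j`-th column has the binary digits of `coef j`. -/
def digitRow {n : ℕ} (coef : Fin n → ℕ) (k : ℕ) (j : Fin n) : ZMod 2 :=
  bitToZMod ((coef j).testBit k)

/-- The code generated by the rows `digitRow coef k`. -/
def digitCode {n : ℕ} (coef : Fin n → ℕ) : Submodule (ZMod 2) (Fin n → ZMod 2) :=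
  Submodule.span (ZMod 2) (Set.range (digitRow coef))

/-- The columns `coef` are distinct vectors of length `d`, and those at the positions `b k` form the
standard basis. -/
structure IsSystematic {n : ℕ} (coef : Fin n → ℕ) (b : ℕ → Fin n) (d : ℕ) : Prop where
  injective : Function.Injective coef
  lt_two_pow : ∀ j, coef j < 2 ^ d
  basis : ∀ k < d, coef (b k) = 2 ^ k

theorem sameBit_iff {m s t : ℕ} : sameBit m s t ↔ m.testBit s = m.testBit t := by
  have h (i : ℕ) : Nat.land (Nat.shiftRight m i) 1 = (m.testBit i).toNat :=
    (Nat.and_one_is_mod _).trans (by simp [Nat.toNat_testBit, Nat.shiftRight_eq_div_pow])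
  rw [sameBit, h, h, Nat.beq_eq]
  cases m.testBit s <;> cases m.testBit t <;> simp

theorem bitToZMod_injective : Function.Injective bitToZMod := by
  decide

theorem bitToZMod_xor (a b : Bool) : bitToZMod (a ^^ b) = bitToZMod a + bitToZMod b := by
  revert a b; decide

theorem length_revValues (f : ℕ → ℕ) (m : ℕ) : (revValues f m).length = m := by
  induction m with
  | zero => rfl
  | succ m ih => simp [revValues, ih]

theorem revValues_congr {f g : ℕ → ℕ} {m : ℕ} (h : ∀ i < m, f i = g i) :
    revValues f m = revValues g m := by
  induction m with
  | zero => rfl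
  | succ m ih =>
    simp only [revValues]
    rw [h m (by omega), ih fun i hi => h i (by omega)]

theorem map_revValues (g f : ℕ → ℕ) (m : ℕ) :
    (revValues f m).map g = revValues (fun i => g (f i)) m := by
  induction m with
  | zero => rfl
  | succ m ih => simp [revValues, ih]

theorem xorCombination_zero (l : List ℕ) : xorCombination l 0 = 0 := by
  induction l with
  | nil => rfl
  | cons y l ih => simp [xorCombination, ih]

theorem xorCombination_xor (l : List ℕ) (s t : ℕ) :
    xorCombination l (s ^^^ t) = xorCombination l s ^^^ xorCombination l t := by
  induction l with
  | nil => simp [xorCombination]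
  | cons y l ih =>
    simp only [xorCombination, ih, Nat.testBit_xor]
    cases s.testBit l.length <;> cases t.testBit l.length <;>
      apply Nat.eq_of_testBit_eq <;> intro i <;> simp [Nat.testBit_xor] <;> grind

theorem xorCombination_map (l l' : List ℕ) (s : ℕ) :
    xorCombination (l'.map (xorCombination l)) s = xorCombination l (xorCombination l' s) := by
  induction l' with
  | nil => simp [xorCombination, xorCombination_zero]
  | cons y l' ih =>
    simp only [List.map_cons, xorCombination, ih, xorCombination_xor, List.length_map]
    cases s.testBit l'.length <;> simp [xorCombination_zero]

theorem bitToZMod_testBit_xorCombination (f : ℕ → ℕ) (m s k : ℕ) :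
    bitToZMod ((xorCombination (revValues f m) s).testBit k) =
      ∑ i ∈ Finset.range m, bitToZMod (s.testBit i) * bitToZMod ((f i).testBit k) := by
  induction m with
  | zero => simp [revValues, xorCombination, bitToZMod]
  | succ m ih =>
    rw [Finset.sum_range_succ, ← ih]
    simp only [revValues, xorCombination, Nat.testBit_xor, bitToZMod_xor, length_revValues]
    cases s.testBit m <;> simp [bitToZMod]

theorem testBit_xorCombination_two_pow (m s k : ℕ) :
    (xorCombination (revValues (2 ^ ·) m) s).testBit k = (decide (k < m) && s.testBit k) := by
  induction m with
  | zero => simp [revValues, xorCombination]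
  | succ m ih =>
    simp only [revValues, xorCombination, Nat.testBit_xor, ih, length_revValues]
    rcases lt_trichotomy k m with h | rfl | h
    · cases s.testBit m <;> simp [h, h.ne', Nat.lt_succ_of_lt h]
    · cases s.testBit k <;> simp
    · cases s.testBit m <;>
        simp [h.ne, h.not_gt, show ¬ k < m + 1 by omega]

theorem xorCombination_two_pow {m s : ℕ} (hs : s < 2 ^ m) :
    xorCombination (revValues (2 ^ ·) m) s = s := by
  refine Nat.eq_of_testBit_eq fun k => ?_
  rw [testBit_xorCombination_two_pow]
  by_cases hk : k < m
  · simp [hk]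
  · rw [Nat.testBit_lt_two_pow (hs.trans_le (Nat.pow_le_pow_right two_pos (not_lt.1 hk)))]
    simp

theorem xorCombination_two_pow_of_length_le {l : List ℕ} {k : ℕ} (h : l.length ≤ k) :
    xorCombination l (2 ^ k) = 0 := by
  induction l with
  | nil => rfl
  | cons y l ih =>
    rw [List.length_cons] at h
    simp [xorCombination, ih (by omega), show k ≠ l.length by omega]

theorem revValues_xorCombination (l : List ℕ) :
    revValues (fun i => xorCombination l (2 ^ i)) l.length = l := by
  induction l with
  | nil => rfl
  | cons y l ih =>
    rw [List.length_cons, revValues, List.cons.injEq]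
    constructor
    · simp [xorCombination, xorCombination_two_pow_of_length_le le_rfl]
    · refine (revValues_congr fun i hi => ?_).trans ih
      simp [xorCombination, hi.ne]

theorem nodup_partialMaps {cs : List ℕ} (hcs : cs.Nodup) (mask k : ℕ) :
    (partialMaps cs mask k).Nodup := by
  induction k with
  | zero => simp [partialMaps]
  | succ k ih =>
    rw [partialMaps, List.nodup_flatMap]
    refine ⟨fun l _ => (hcs.filter _).map fun x y hxy => by simpa using hxy, ?_⟩
    refine ih.imp fun {l l'} hne => ?_
    simp only [Function.onFun, List.disjoint_left, List.mem_map]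
    rintro _ ⟨y, -, rfl⟩ ⟨y', -, h⟩
    exact hne (List.cons.inj h).2.symm

theorem two_pow_add_eq_xor {k s : ℕ} (hs : s < 2 ^ k) : 2 ^ k + s = 2 ^ k ^^^ s := by
  refine Nat.eq_of_testBit_eq fun i => ?_
  rw [Nat.testBit_xor]
  rcases lt_trichotomy i k with h | rfl | h
  · rw [Nat.testBit_two_pow_add_gt h]
    simp [h.ne']
  · rw [Nat.testBit_two_pow_add_eq]
    simp
  · have hik : 2 ^ (k + 1) ≤ 2 ^ i := Nat.pow_le_pow_right two_pos h
    rw [pow_succ] at hik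
    rw [Nat.testBit_lt_two_pow (by omega : 2 ^ k + s < 2 ^ i),
      Nat.testBit_lt_two_pow (by omega : s < 2 ^ i)]
    simp [h.ne]

theorem xorCombination_cons_of_lt (y : ℕ) {l : List ℕ} {s : ℕ} (hs : s < 2 ^ l.length) :
    xorCombination (y :: l) s = xorCombination l s := by
  simp [xorCombination, Nat.testBit_lt_two_pow hs]

theorem xorCombination_cons_two_pow_add (y : ℕ) {l : List ℕ} {s : ℕ} (hs : s < 2 ^ l.length) :
    xorCombination (y :: l) (2 ^ l.length + s) = xorCombination l s ^^^ y := by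
  rw [two_pow_add_eq_xor hs, xorCombination_xor, xorCombination_cons_of_lt y hs, Nat.xor_comm]
  simp [xorCombination, xorCombination_two_pow_of_length_le le_rfl]

/-- The linear map of `l` preserves and reflects membership in the set of bits of `mask`. -/
def PreservesBits (mask : ℕ) (l : List ℕ) : Prop :=
  ∀ s < 2 ^ l.length, mask.testBit s = mask.testBit (xorCombination l s)

theorem preservesBits_cons {mask y : ℕ} {l : List ℕ} :
    PreservesBits mask (y :: l) ↔ PreservesBits mask l ∧
      ∀ s < 2 ^ l.length,
        mask.testBit (2 ^ l.length + s) = mask.testBit (xorCombination l s ^^^ y) := by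
  simp only [PreservesBits, List.length_cons, pow_succ]
  constructor
  · intro h
    refine ⟨fun s hs => ?_, fun s hs => ?_⟩
    · rw [h s (by omega), xorCombination_cons_of_lt y hs]
    · rw [h _ (by omega), xorCombination_cons_two_pow_add y hs]
  · rintro ⟨h, h'⟩ s hs
    rcases lt_or_ge s (2 ^ l.length) with hs' | hs'
    · rw [h s hs', xorCombination_cons_of_lt y hs']
    · obtain ⟨t, rfl⟩ := Nat.exists_eq_add_of_le hs'
      rw [h' t (by omega), xorCombination_cons_two_pow_add y (by omega)]

theorem mem_partialMaps {cs : List ℕ} {mask k : ℕ} {l : List ℕ} :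
    l ∈ partialMaps cs mask k ↔ l.length = k ∧ (∀ y ∈ l, y ∈ cs) ∧ PreservesBits mask l := by
  induction k generalizing l with
  | zero =>
    rw [partialMaps, List.mem_singleton, List.length_eq_zero_iff]
    constructor
    · rintro rfl
      simp [PreservesBits, xorCombination]
    · exact And.left
  | succ k ih =>
    simp only [partialMaps, List.mem_flatMap, List.mem_map, List.mem_filter, List.all_eq_true,
      List.mem_range, sameBit_iff, ih]
    constructor
    · rintro ⟨l, ⟨rfl, hl, hp⟩, y, ⟨hy, hyp⟩, rfl⟩
      exact ⟨rfl, List.forall_mem_cons.2 ⟨hy, hl⟩, preservesBits_cons.2 ⟨hp, hyp⟩⟩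
    · rintro ⟨hk, hl, hp⟩
      obtain ⟨y, l, rfl⟩ := List.exists_cons_of_length_eq_add_one hk
      obtain rfl : l.length = k := by simpa using hk
      rw [List.forall_mem_cons] at hl
      rw [preservesBits_cons] at hp
      exact ⟨l, ⟨rfl, hl.2, hp.1⟩, y, ⟨hl.1, hp.2⟩, rfl⟩

theorem PreservesBits.injOn {mask : ℕ} {l : List ℕ} (h : PreservesBits mask l)
    (hmask : ∀ u < 2 ^ l.length, u ≠ 0 →
      ∃ s < 2 ^ l.length, mask.testBit s ≠ mask.testBit (s ^^^ u))
    {s t : ℕ} (hs : s < 2 ^ l.length) (ht : t < 2 ^ l.length)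
    (hst : xorCombination l s = xorCombination l t) : s = t := by
  by_contra hne
  obtain ⟨r, hr, hru⟩ := hmask (s ^^^ t) (Nat.xor_lt_two_pow hs ht) (by simpa using hne)
  apply hru
  rw [h r hr, h _ (Nat.xor_lt_two_pow hr (Nat.xor_lt_two_pow hs ht)), xorCombination_xor,
    xorCombination_xor, hst, Nat.xor_self, Nat.xor_zero]

theorem IsSystematic.mem_digitCode {n : ℕ} {coef : Fin n → ℕ} {b : ℕ → Fin n} {d : ℕ}
    (h : IsSystematic coef b d) {c : Fin n → ZMod 2} :
    c ∈ digitCode coef ↔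
      ∀ j, c j = ∑ i ∈ Finset.range d, bitToZMod ((coef j).testBit i) * c (b i) := by
  constructor
  · intro hc j
    induction hc using Submodule.span_induction with
    | mem c hc =>
      obtain ⟨k, rfl⟩ := hc
      have := bitToZMod_testBit_xorCombination (fun i => coef (b i)) d (coef j) k
      rwa [revValues_congr (g := (2 ^ ·)) fun i hi => h.basis i hi,
        xorCombination_two_pow (h.lt_two_pow j)] at this
    | zero => simp
    | add x y _ _ hx hy => simp only [Pi.add_apply, mul_add, Finset.sum_add_distrib, ← hx, ← hy]
    | smul a x _ hx =>
      simp only [Pi.smul_apply, smul_eq_mul, mul_left_comm _ a, ← Finset.mul_sum, ← hx]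
  · intro hc
    have : c = ∑ i ∈ Finset.range d, c (b i) • digitRow coef i := by
      funext j
      rw [hc j, Finset.sum_apply]
      exact Finset.sum_congr rfl fun i _ => mul_comm _ _
    rw [this]
    exact Submodule.sum_mem _ fun i _ =>
      Submodule.smul_mem _ _ (Submodule.subset_span ⟨i, rfl⟩)

theorem IsSystematic.forall_digitRow_comp_mem_iff {n : ℕ} {coef : Fin n → ℕ} {b : ℕ → Fin n}
    {d : ℕ} (h : IsSystematic coef b d) (σ : Equiv.Perm (Fin n)) :
    (∀ k, digitRow coef k ∘ σ ∈ digitCode coef) ↔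
      ∀ j, xorCombination (revValues (fun i => coef (σ (b i))) d) (coef j) = coef (σ j) := by
  have key (k : ℕ) (j : Fin n) :=
    bitToZMod_testBit_xorCombination (fun i => coef (σ (b i))) d (coef j) k
  constructor
  · intro hσ j
    refine Nat.eq_of_testBit_eq fun k => bitToZMod_injective ?_
    rw [key]
    exact (h.mem_digitCode.1 (hσ k) j).symm
  · intro hσ k
    refine h.mem_digitCode.2 fun j => ?_
    have := key k j
    rwa [hσ j] at this

theorem map_funLeft_eq_iff {n : ℕ} (coef : Fin n → ℕ) (σ : Equiv.Perm (Fin n)) :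
    Submodule.map (LinearMap.funLeft (ZMod 2) (ZMod 2) σ) (digitCode coef) = digitCode coef ↔
      ∀ k, digitRow coef k ∘ σ ∈ digitCode coef := by
  constructor
  · intro h k
    have hk : digitRow coef k ∈ digitCode coef := Submodule.subset_span ⟨k, rfl⟩
    have := Submodule.mem_map_of_mem (f := LinearMap.funLeft (ZMod 2) (ZMod 2) σ) hk
    rwa [h] at this
  · intro h
    refine Submodule.eq_of_le_of_finrank_eq ?_
      (LinearEquiv.finrank_map_eq (LinearEquiv.funCongrLeft (ZMod 2) (ZMod 2) σ) _)
    rw [digitCode, Submodule.map_span_le]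
    rintro _ ⟨k, rfl⟩
    exact h k

theorem digitRow_comp_symm_mem {n : ℕ} {coef : Fin n → ℕ} {σ : Equiv.Perm (Fin n)}
    (h : ∀ k, digitRow coef k ∘ σ ∈ digitCode coef) (k : ℕ) :
    digitRow coef k ∘ σ.symm ∈ digitCode coef := by
  have hk : digitRow coef k ∈ digitCode coef := Submodule.subset_span ⟨k, rfl⟩
  rw [← (map_funLeft_eq_iff coef σ).2 h] at hk
  obtain ⟨c, hc, hck⟩ := hk
  have : digitRow coef k ∘ σ.symm = c := by
    funext j
    simp [← hck, LinearMap.funLeft]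
  rwa [this]

theorem IsSystematic.xorCombination_symm {n : ℕ} {coef : Fin n → ℕ} {b : ℕ → Fin n}
    {d : ℕ} (h : IsSystematic coef b d) {σ : Equiv.Perm (Fin n)}
    (hσ : ∀ k, digitRow coef k ∘ σ ∈ digitCode coef) {s : ℕ} (hs : s < 2 ^ d) :
    xorCombination (revValues (fun i => coef (σ.symm (b i))) d)
      (xorCombination (revValues (fun i => coef (σ (b i))) d) s) = s := by
  have hτ := (h.forall_digitRow_comp_mem_iff σ.symm).1 (digitRow_comp_symm_mem hσ)
  rw [← xorCombination_map, map_revValues, revValues_congr (g := (2 ^ ·)),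
    xorCombination_two_pow hs]
  intro i hi
  rw [hτ, Equiv.symm_apply_apply, h.basis i hi]

theorem xorCombination_lt_two_pow {l : List ℕ} {d : ℕ} (hl : ∀ y ∈ l, y < 2 ^ d) (s : ℕ) :
    xorCombination l s < 2 ^ d := by
  induction l with
  | nil => simp [xorCombination]
  | cons y l ih =>
    rw [xorCombination]
    refine Nat.xor_lt_two_pow (ih fun z hz => hl z (List.mem_cons_of_mem _ hz)) ?_
    cases s.testBit l.length
    · exact Nat.two_pow_pos d
    · exact hl y List.mem_cons_self

theorem mem_revValues {f : ℕ → ℕ} {m y : ℕ} : y ∈ revValues f m ↔ ∃ i < m, f i = y := by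
  induction m with
  | zero => simp [revValues]
  | succ m ih =>
    simp only [revValues, List.mem_cons, ih, Nat.lt_succ_iff_lt_or_eq]
    grind

/-- The number of automorphisms of a code in systematic form is the number of linear maps found by the
search `partialMaps`, provided no nonzero translation preserves the set of columns. -/
theorem IsSystematic.card_automorphisms {n : ℕ} {coef : Fin n → ℕ} {b : ℕ → Fin n} {d : ℕ}
    (h : IsSystematic coef b d) {cs : List ℕ} (hcs : List.ofFn coef = cs) {mask : ℕ}
    (hmask : ∀ s < 2 ^ d, mask.testBit s = decide (s ∈ cs))
    (htrans : ∀ u < 2 ^ d, u ≠ 0 → ∃ s < 2 ^ d, mask.testBit s ≠ mask.testBit (s ^^^ u)) :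
    Nat.card {σ : Equiv.Perm (Fin n) //
      Submodule.map (LinearMap.funLeft (ZMod 2) (ZMod 2) σ) (digitCode coef) = digitCode coef} =
      (partialMaps cs mask d).length := by
  have hmem (s : ℕ) : s ∈ cs ↔ ∃ j, coef j = s := by rw [← hcs, List.mem_ofFn]
  have hnodup : (partialMaps cs mask d).Nodup :=
    nodup_partialMaps (hcs ▸ List.nodup_ofFn.2 h.injective) _ _
  let F (σ : Equiv.Perm (Fin n)) : List ℕ := revValues (fun i => coef (σ (b i))) d
  have hF (σ : Equiv.Perm (Fin n))
      (hσ : Submodule.map (LinearMap.funLeft (ZMod 2) (ZMod 2) σ) (digitCode coef) =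
        digitCode coef) : ∀ j, xorCombination (F σ) (coef j) = coef (σ j) :=
    (h.forall_digitRow_comp_mem_iff σ).1 ((map_funLeft_eq_iff coef σ).1 hσ)
  have hlt (l : List ℕ) (hl : ∀ y ∈ l, y ∈ cs) (s : ℕ) : xorCombination l s < 2 ^ d := by
    refine xorCombination_lt_two_pow (fun y hy => ?_) s
    obtain ⟨j, rfl⟩ := (hmem y).1 (hl y hy)
    exact h.lt_two_pow j
  have hF_mem (σ : Equiv.Perm (Fin n))
      (hσ : Submodule.map (LinearMap.funLeft (ZMod 2) (ZMod 2) σ) (digitCode coef) =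
        digitCode coef) : F σ ∈ partialMaps cs mask d := by
    have hσ' := (map_funLeft_eq_iff coef σ).1 hσ
    have hFcs : ∀ y ∈ F σ, y ∈ cs := fun y hy => by
      obtain ⟨i, -, rfl⟩ := mem_revValues.1 hy
      exact (hmem _).2 ⟨_, rfl⟩
    refine mem_partialMaps.2 ⟨length_revValues _ _, hFcs, fun s hs => ?_⟩
    rw [length_revValues] at hs
    rw [hmask s hs, hmask _ (hlt _ hFcs s), decide_eq_decide, hmem, hmem]
    constructor
    · rintro ⟨j, rfl⟩
      exact ⟨σ j, (hF σ hσ j).symm⟩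
    · rintro ⟨j, hj⟩
      refine ⟨σ.symm j, ?_⟩
      rw [← h.xorCombination_symm hσ' hs, ← hj]
      exact ((h.forall_digitRow_comp_mem_iff σ.symm).1 (digitRow_comp_symm_mem hσ') j).symm
  rw [← List.toFinset_card_of_nodup hnodup, ← Fintype.card_coe, ← Nat.card_eq_fintype_card]
  refine Nat.card_congr (Equiv.ofBijective
    (fun σ => ⟨F σ.1, List.mem_toFinset.2 (hF_mem σ.1 σ.2)⟩) ⟨?_, ?_⟩)
  · rintro ⟨σ, hσ⟩ ⟨τ, hτ⟩ hστ
    have hστ' : F σ = F τ := congrArg Subtype.val hστ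
    refine Subtype.ext (Equiv.ext fun j => h.injective ?_)
    rw [← hF σ hσ, hστ', hF τ hτ]
  · rintro ⟨l, hl⟩
    obtain ⟨rfl, hlcs, hp⟩ := mem_partialMaps.1 (List.mem_toFinset.1 hl)
    have himage (j : Fin n) : ∃ i, coef i = xorCombination l (coef j) := by
      have hj : decide (coef j ∈ cs) = decide (xorCombination l (coef j) ∈ cs) := by
        rw [← hmask _ (h.lt_two_pow j), ← hmask _ (hlt l hlcs _), hp _ (h.lt_two_pow j)]
      exact (hmem _).1 ((decide_eq_decide.1 hj).1 ((hmem _).2 ⟨j, rfl⟩))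
    choose τ hτ using himage
    have hinj : Function.Injective τ := fun i j hij => h.injective <|
      hp.injOn htrans (h.lt_two_pow i) (h.lt_two_pow j) (by rw [← hτ, hij, hτ])
    let σ : Equiv.Perm (Fin n) := Equiv.ofBijective τ (Finite.injective_iff_bijective.1 hinj)
    have hσ (j : Fin n) : xorCombination l (coef j) = coef (σ j) := (hτ j).symm
    have hFσ : F σ = l := by
      conv_rhs => rw [← revValues_xorCombination l]
      exact revValues_congr fun i hi => by rw [← hσ, h.basis i hi]
    refine ⟨⟨σ, (map_funLeft_eq_iff coef σ).2
      ((h.forall_digitRow_comp_mem_iff σ).2 fun j => ?_)⟩, Subtype.ext hFσ⟩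
    exact (congrArg (xorCombination · (coef j)) hFσ).trans (hσ j)

theorem IsSystematic.digitCode_le {n : ℕ} {coef : Fin n → ℕ} {b : ℕ → Fin n} {d : ℕ}
    (h : IsSystematic coef b d) {C : Submodule (ZMod 2) (Fin n → ZMod 2)}
    (hC : ∀ k < d, digitRow coef k ∈ C) : digitCode coef ≤ C := by
  rw [digitCode, Submodule.span_le]
  rintro _ ⟨k, rfl⟩
  by_cases hk : k < d
  · exact hC k hk
  · have : digitRow coef k = 0 := by
      funext j
      rw [digitRow, Nat.testBit_lt_two_pow
        ((h.lt_two_pow j).trans_le (Nat.pow_le_pow_right two_pos (not_lt.1 hk)))]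
      rfl
    rw [this]
    exact C.zero_mem

/-- The columns of a systematic generator matrix of `codeA`, read in binary. -/
def columnsA : Fin 21 → ℕ :=
  ![28, 11, 26, 22, 1, 16, 15, 30, 9, 24, 29, 12, 27, 21, 4, 19, 2, 31, 14, 25, 8]

/-- The positions in `columnsA` of the standard basis vectors. -/
def basisA (i : ℕ) : Fin 21 :=
  [4, 16, 14, 20, 5].getD i 0

theorem isSystematicA : IsSystematic columnsA basisA 5 where
  injective := by decide +kernel
  lt_two_pow := by decide +kernel
  basis := by decide +kernel

theorem codeA_eq_digitCode : codeA = digitCode columnsA := by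
  refine le_antisymm (Submodule.span_le.2 ?_) (isSystematicA.digitCode_le fun k hk => ?_)
  · rintro _ (rfl | rfl | rfl | rfl | rfl) <;>
      exact isSystematicA.mem_digitCode.2 (by decide +kernel)
  · have hrow {v : Fin 21 → ZMod 2} (hv : v ∈ rowsA) : v ∈ codeA := Submodule.subset_span hv
    have h₀ := hrow (.inl rfl)
    have h₁ := hrow (.inr (.inl rfl))
    have h₂ := hrow (.inr (.inr (.inl rfl)))
    have h₃ := hrow (.inr (.inr (.inr (.inl rfl))))
    have h₄ := hrow (.inr (.inr (.inr (.inr rfl))))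
    interval_cases k
    · convert h₄ using 1
      decide +kernel
    · convert add_mem h₁ h₃ using 1
      decide +kernel
    · convert h₃ using 1
      decide +kernel
    · convert add_mem h₀ h₂ using 1
      decide +kernel
    · convert add_mem h₀ h₄ using 1
      decide +kernel

theorem card_automorphisms_codeA :
    Nat.card {σ : Equiv.Perm (Fin 21) //
      Submodule.map (LinearMap.funLeft (ZMod 2) (ZMod 2) σ) codeA = codeA} = 1008 := by
  rw [codeA_eq_digitCode, isSystematicA.card_automorphisms
    (cs := [28, 11, 26, 22, 1, 16, 15, 30, 9, 24, 29, 12, 27, 21, 4, 19, 2, 31, 14, 25, 8])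
    (mask := 4285127446) (by rfl) (by decide +kernel) (by decide +kernel)]
  decide +kernel

/-- The columns of a systematic generator matrix of `codeB`, read in binary. -/
def columnsB : Fin 21 → ℕ :=
  ![24, 2, 20, 17, 15, 10, 14, 11, 21, 16, 22, 19, 13, 8, 12, 9, 23, 18, 4, 1, 31]

/-- The positions in `columnsB` of the standard basis vectors. -/
def basisB (i : ℕ) : Fin 21 :=
  [19, 1, 18, 13, 9].getD i 0

theorem isSystematicB : IsSystematic columnsB basisB 5 where
  injective := by decide +kernel
  lt_two_pow := by decide +kernel
  basis := by decide +kernel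

theorem codeB_eq_digitCode : codeB = digitCode columnsB := by
  refine le_antisymm (Submodule.span_le.2 ?_) (isSystematicB.digitCode_le fun k hk => ?_)
  · rintro _ (rfl | rfl | rfl | rfl | rfl) <;>
      exact isSystematicB.mem_digitCode.2 (by decide +kernel)
  · have hrow {v : Fin 21 → ZMod 2} (hv : v ∈ rowsB) : v ∈ codeB := Submodule.subset_span hv
    have h₀ := hrow (.inl rfl)
    have h₁ := hrow (.inr (.inl rfl))
    have h₂ := hrow (.inr (.inr (.inl rfl)))
    have h₃ := hrow (.inr (.inr (.inr (.inl rfl))))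
    have h₄ := hrow (.inr (.inr (.inr (.inr rfl))))
    interval_cases k
    · convert add_mem h₃ h₄ using 1
      decide +kernel
    · convert add_mem (add_mem h₁ h₂) h₃ using 1
      decide +kernel
    · convert h₄ using 1
      decide +kernel
    · convert add_mem h₂ h₃ using 1
      decide +kernel
    · convert add_mem (add_mem (add_mem h₀ h₁) h₂) h₃ using 1
      decide +kernel

theorem card_automorphisms_codeB :
    Nat.card {σ : Equiv.Perm (Fin 21) //
      Submodule.map (LinearMap.funLeft (ZMod 2) (ZMod 2) σ) codeB = codeB} = 1920 := by
  rw [codeB_eq_digitCode, isSystematicB.card_automorphisms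
    (cs := [24, 2, 20, 17, 15, 10, 14, 11, 21, 16, 22, 19, 13, 8, 12, 9, 23, 18, 4, 1, 31])
    (mask := 2181037846) (by rfl) (by decide +kernel) (by decide +kernel)]
  decide +kernel

/-- The two inequivalent [21,5,10] codes have automorphism groups of orders
1008 and 1920 respectively. -/
theorem aut_orders_21_5_10 :
    Nat.card {σ : Equiv.Perm (Fin 21) //
        Submodule.map (LinearMap.funLeft (ZMod 2) (ZMod 2) σ) codeA = codeA} = 1008 ∧
    Nat.card {σ : Equiv.Perm (Fin 21) //
        Submodule.map (LinearMap.funLeft (ZMod 2) (ZMod 2) σ) codeB = codeB} = 1920 :=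
  ⟨card_automorphisms_codeA, card_automorphisms_codeB⟩
end

section
/- Up to coordinate permutation, there are exactly six binary linear [24,7,10] codes. -/
/-- A binary linear [24,7,10] code. -/
def IsCode24_7_10 (C : Submodule (ZMod 2) (Fin 24 → ZMod 2)) : Prop :=
  Module.finrank (ZMod 2) C = 7 ∧ ∀ v ∈ C, v ≠ 0 → 10 ≤ hammingNorm v

/-- Evaluates `n` to a literal before passing it to `f`, under kernel reduction. -/
def force {α : Type} (n : ℕ) (f : ℕ → α) : α :=
  Nat.rec (f 0) (fun k _ => f k.succ) n

/-- Evaluates all entries of a list of pairs before passing it to `f`. -/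
def forcePairs {α : Type} : List (ℕ × ℕ) → (List (ℕ × ℕ) → α) → α
  | [], f => f []
  | a :: l, f => force a.1 fun x => force a.2 fun y => forcePairs l fun l' => f ((x, y) :: l')

/-- Evaluates all entries of a list of lists of pairs before passing it to `f`. -/
def forcePairLists {α : Type} : List (List (ℕ × ℕ)) → (List (List (ℕ × ℕ)) → α) → α
  | [], f => f []
  | a :: l, f => forcePairs a fun a' => forcePairLists l fun l' => f (a' :: l')

/-- Evaluates all entries of a list before passing it to `f`. -/
def forceList {α : Type} : List ℕ → (List ℕ → α) → α
  | [], f => f []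
  | a :: l, f => force a fun x => forceList l fun l' => f (x :: l')

/-- The sums of `B ^ f` over the functionals `f < 2 ^ j` vanishing, respectively not vanishing,
at the point `p`. -/
def lanePair (B p : ℕ) : ℕ → ℕ × ℕ
  | 0 => (1, 0)
  | j + 1 =>
    match lanePair B p j with
    | (a, b) => force a fun a => force b fun b => force (B ^ 2 ^ j) fun q =>
      bif p.testBit j then (a + q * b, b + q * a) else (a + q * a, b + q * b)

/-- The possible numbers of ones of a new word in the zero columns. -/
def tails : ℕ → ℕ → List ℕ
  | 3, m => List.range (m - 4 + 1)
  | 4, m => if m = 4 then [0, 2] else List.range (m + 1)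
  | 5, m => List.range (m - 1 + 1)
  | 6, m => List.range (m + 1)
  | _, m => List.range (m - 6 + 1)

/-- The possible numbers of ones of a normalised new word in the `m` columns equal to `p`. -/
def choices (j p m : ℕ) : List ℕ :=
  if p = 0 then tails j m
  else if (List.range j).any fun l => 2 ^ l == p then List.range (m / 2 + 1)
  else List.range (m + 1)

/-- The packed increments for all choices at the point `p` of multiplicity `m`. -/
def increments (j p m : ℕ) : List (ℕ × ℕ) :=
  match lanePair 128 p j with
  | (a, b) => force a fun a => force b fun b =>
    force (2 * (lanePair (128 ^ 2 ^ j) p j).1) fun q =>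
      (choices j p m).map fun k => (k, q * (k * b + (m - k) * a))

/-- The number all of whose `2 ^ j * 2 ^ j` lanes are one. -/
def allLanes (j : ℕ) : ℕ := (lanePair (128 ^ 2 ^ j) 0 j).1 * (lanePair 128 0 j).1

/-- The packed start value of the search. -/
def startLanes (j : ℕ) (L : List (ℕ × ℕ)) : ℕ :=
  35 * allLanes j +
    (L.map fun e => e.2 * (lanePair (128 ^ 2 ^ j) e.1 j).2 * (lanePair 128 0 j).1).sum

/-- Depth first search through all choices of increments with all lanes staying below `64`. The
leaves, in reverse order of the entries, are prepended to the last argument. -/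
def search (H : ℕ) (es : List (List (ℕ × ℕ))) : ℕ → List ℕ → List (List ℕ) → List (List ℕ) :=
  List.rec (fun _ ks tl => ks :: tl) (fun cs _ ih V ks tl =>
    cs.foldr (fun c r => force (Nat.add V c.2) fun v =>
      bif Nat.beq (Nat.land v H) 0 then ih v (c.1 :: ks) r else r) tl) es

/-- The linear map whose matrix has the base `128` digits of the first argument as columns. -/
def applyCert (n : ℕ) : ℕ → ℕ → ℕ :=
  Nat.rec (fun _ _ => 0) (fun _ ih c p =>
    Nat.xor (Nat.mul (Nat.mod p 2) (Nat.mod c 128)) (ih (Nat.div c 128) (Nat.div p 2))) n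

/-- The profile, as a base `32` number, of the extension of a profile by the choices `ks`, in the
coordinates given by `c`, where `a` is the image of the new unit vector. -/
def extensionCode (j c a : ℕ) (L : List (ℕ × ℕ)) : List ℕ → ℕ :=
  List.rec (fun _ => 0) (fun e _ ih ks => List.rec 0 (fun k ks _ =>
    force (applyCert j c e.1) fun q =>
      Nat.add (Nat.add (Nat.mul (Nat.sub e.2 k) (Nat.pow 32 q))
        (Nat.mul k (Nat.pow 32 (Nat.xor q a)))) (ih ks)) ks) L

/-- A profile as a base `32` number. -/
def profileCode (L : List (ℕ × ℕ)) : ℕ := (L.map fun e => e.2 * 32 ^ e.1).sum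

/-- Each leaf is transformed into a profile with code in `T` by the corresponding entry of the
second list. -/
def checkLeaves (j : ℕ) (T : List ℕ) (L : List (ℕ × ℕ)) : List (List ℕ) → List ℕ → Bool
  | [], _ => true
  | _ :: _, [] => false
  | ks :: l, c :: cs => force (extensionCode j c (c / 128 ^ j) L ks) (fun v => T.any (Nat.beq v)) &&
      checkLeaves j T L l cs

/-- Every extension of the profile `L` has code in `T`. -/
def checkProfile (j : ℕ) (T : List ℕ) (L : List (ℕ × ℕ)) (certs : List ℕ) : Bool :=
  force (64 * allLanes j) fun H => force (startLanes j L) fun V =>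
    forcePairLists (L.map fun e => increments j e.1 e.2) fun es =>
      checkLeaves j T L.reverse (search H es V [] []) certs

/-- The points of a profile are distinct and the multiplicities sum up to `24`. -/
def validProfile (j : ℕ) (L : List (ℕ × ℕ)) : Bool :=
  decide (L.map Prod.fst).Nodup && L.all (fun e => decide (e.1 < 2 ^ j)) &&
    Nat.beq (L.map Prod.snd).sum 24

/-- All profiles of a level are valid, and their extensions have codes in `T`. -/
def checkLevel (j : ℕ) (l : List (List (ℕ × ℕ) × List ℕ)) (T : List ℕ) : Bool :=
  forceList T fun T' => l.all fun e => validProfile j e.1 && checkProfile j T' e.1 e.2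

/-- The base `32` codes of the profiles of a level. -/
def levelCodes (l : List (List (ℕ × ℕ) × List ℕ)) : List ℕ := l.map fun e => profileCode e.1

/-- The possible profiles in dimension 0, each with the coordinate changes normalising its
extensions. -/
def level0 : List (List (ℕ × ℕ) × List ℕ) := [
  ([(0, 24)],
    [1, 1, 1, 1, 1, 1, 1, 1, 1])]

/-- The possible profiles in dimension 1, each with the coordinate changes normalising its
extensions. -/
def level1 : List (List (ℕ × ℕ) × List ℕ) := [
  ([(0, 14), (1, 10)],
    [257, 257, 257, 386, 259, 130, 386, 257, 130, 130]),
  ([(0, 13), (1, 11)],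
    [130, 386, 386, 130, 386, 257]),
  ([(0, 12), (1, 12)],
    [385, 257, 130, 257, 130, 257]),
  ([(0, 11), (1, 13)],
    [130, 257, 386]),
  ([(0, 10), (1, 14)],
    [130, 385, 130]),
  ([(0, 9), (1, 15)],
    [386]),
  ([(0, 8), (1, 16)],
    [130]),
  ([(0, 7), (1, 17)],
    []),
  ([(0, 6), (1, 18)],
    [])]

/-- The possible profiles in dimension 2, each with the coordinate changes normalising its
extensions. -/
def level2 : List (List (ℕ × ℕ) × List ℕ) := [
  ([(0, 9), (2, 5), (1, 5), (3, 5)],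
    [65793]),
  ([(0, 8), (2, 6), (1, 6), (3, 4)],
    [82177]),
  ([(0, 8), (2, 6), (1, 5), (3, 5)],
    []),
  ([(0, 7), (2, 7), (1, 3), (3, 7)],
    []),
  ([(0, 7), (2, 7), (1, 4), (3, 6)],
    []),
  ([(0, 7), (1, 7), (2, 5), (3, 5)],
    []),
  ([(0, 6), (2, 8), (1, 2), (3, 8)],
    []),
  ([(0, 6), (2, 8), (1, 7), (3, 3)],
    []),
  ([(0, 6), (1, 8), (2, 6), (3, 4)],
    []),
  ([(0, 6), (1, 8), (2, 5), (3, 5)],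
    []),
  ([(0, 7), (2, 6), (1, 5), (3, 6)],
    []),
  ([(0, 6), (2, 7), (1, 4), (3, 7)],
    []),
  ([(0, 6), (2, 7), (1, 6), (3, 5)],
    []),
  ([(0, 6), (2, 6), (1, 6), (3, 6)],
    [])]

/-- The possible profiles in dimension 3, each with the coordinate changes normalising its
extensions. -/
def level3 : List (List (ℕ × ℕ) × List ℕ) := [
  ([(0, 6), (4, 3), (2, 3), (6, 2), (1, 3), (3, 2), (5, 2), (7, 3)],
    [21086981, 14926467, 14763907, 14828163, 6472578])]

/-- The possible profiles in dimension 4, each with the coordinate changes normalising its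
extensions. -/
def level4 : List (List (ℕ × ℕ) × List ℕ) := [
  ([(0, 4), (6, 2), (8, 1), (14, 2), (2, 1), (4, 1), (10, 2), (12, 1), (1, 1), (3, 1), (5, 2),
   (7, 2), (9, 1), (11, 1), (13, 1), (15, 1)],
    [2718402057, 3537912735, 2693236233, 1359005595, 2693236229, 3537912728, 2718402053,
     1359005588, 5417437574, 5404852358, 5373395713, 7025475856, 7012909197, 2437140231,
     6996131981, 7006601480, 6742606343, 5425466246, 6727910017, 6742606339, 6727910020,
     5425466257, 7277379741, 2695040772, 3538028312, 1384366472, 2737045644, 7250331650,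
     7250331666, 5907793540, 5408657154, 5381312273, 5370908418, 5408689030, 6725812865,
     6776160775, 6725812868, 5408689041, 6776160771, 7310934173, 2703491212, 3554805528,
     1399046536, 2703429380, 6721635204, 6985842823, 6987940609, 6996312836, 6996312834,
     2709930501, 1384253455, 6721635203, 1384253471, 2709930497, 2695103361, 5430019864,
     4848665473, 4834050440, 7025593990, 4857151880, 6505482114, 7006716673, 5431902465,
     2736980496, 4601364744, 1376094751, 4861247636, 2694991617, 2736930975, 4863312387,
     4863312391, 5425430814, 6717294597, 4838574617, 3538405121, 5404460034, 5429561601,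
     4848813831, 7265009936, 4894886917, 2692894593, 2699186049, 4848632196, 4888478084,
     7265009938, 4848632199, 4888478087, 5429545118, 1887471885, 1388760985, 4861643924,
     1359400857, 4846963860, 5416963473, 7801586178, 5431755543, 6981632260, 6981632262,
     1348601744, 5431755537, 1348601759, 2747532801, 2686568453, 5425565342, 6983778436,
     6983647366, 2424425103, 2686650372, 5431902365, 2747336223, 3492135822, 2686944396,
     2749858956, 2481177477, 2472788610, 2449720197, 2458108546, 7040650000, 6984026896,
     3223603477, 2686944389, 2749858949, 3223603463, 6984026886, 7040649990, 6987744897,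
     6991939201, 6994020099, 6987810440, 6991922947, 6983616136, 2426834306, 2718155149,
     2749612429, 2745436291, 2481360258, 7040174861, 7044369165, 2686960772, 4882252803,
     2747778180, 3234187905, 6983994116, 3236285441, 7044811524, 1394658703, 3519041415,
     2470691077, 2711668624, 2745225103, 2474885381, 2720057359, 1638337552, 6988220438,
     6981928982, 1617365016, 1394658708, 3519041432, 6988220422, 1638337544, 1617365000,
     6981928966, 6987728898, 6991922178, 2460205982, 4859151881, 7040238605, 6447090078,
     6981518349, 2745418253, 2470774789, 2431027202, 2430928901, 2720253571, 4584620937,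
     2734932493, 2726545027, 2458290178, 6991922192, 2420458759, 6987728904, 4897262983,
     4874292616, 4874194311, 1395117448, 6992380932, 5907874946, 6981895172, 1627770499,
     6736298117, 3257025409, 7040352770, 7040352774, 3808837895, 2747679364, 6736298116,
     3808837893, 2747679361, 1407435779, 4896965635, 2747384464, 6992170884, 1663059592,
     1669350403, 7040401921, 1394853640, 4846653315, 6736101520, 2747384479, 4896965657,
     6736315268, 3254928129, 3269607559, 7044547330, 7044547332, 1394739215, 2749776389,
     6736315267, 2749776385, 1394739231, 2749629313, 3491892238, 4884317057, 4873896328,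
     6987845254, 5930909967, 1658864008, 7044465409, 3493989784, 2749563408, 5391991048,
     1348831775, 1407519491, 2709671681, 2718056607, 4861215235, 4861215239, 5429625118,
     6719391749, 4882614809, 3506947841, 5417042946, 5433755905, 4840425223, 6717423749,
     7013089798, 7013089794, 3271705473, 3760603399, 2699444868, 6717423748, 3760603397,
     2699444865, 1375978499, 2736898704, 4882285571, 1660962440, 7025725316, 7006847489,
     1671447555, 1388562184, 6719410051, 6742392976, 4882285593, 2736898719, 5373035287,
     7025672454, 7025672452, 1371670416, 5373035281, 1371670431, 2693006849, 5371039390,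
     2709637125, 7013007494, 2437008015, 6996361348, 2699233284, 5425610909, 3546678273,
     2717976095, 6776144389, 6776144385, 2703638661, 2703638660, 6725617665, 5408837249,
     3555051271, 4888513025, 5419156482, 6725698179, 5381571613, 6713246084, 5370939543,
     6713246087, 5370939526, 1398935439, 1398935440, 4848665217, 4613948418, 4896900097,
     1399164820, 2703298444, 2703347589, 4888579208, 5406572808, 7262669826, 6713115013,
     4567729796, 7298566416, 7298566402, 4857021315, 4857021316, 4896867204, 4896867203,
     5398102162, 5419073682, 4834132878, 7814168836, 4897047438, 5641405832, 7298123528,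
     5398102151, 6744687109, 6744687105, 2718318725, 2718318724, 6719326209, 5373185665,
     1373962646, 3506816775, 7281541250, 4840359683, 5417223197, 2737275532, 2699526796,
     2737275529, 2699526793, 1671889936, 1671889944, 3271836565, 1374143515, 4847027227,
     4834017672, 7013351958, 7007060502, 7007060488, 7013351944, 6717374599, 6742540423,
     4863414145, 4848734081, 3760279449, 1374143510, 4847027201, 1388366351, 3506457607,
     3506457631, 1388366363, 7007093520, 7007093526, 6996607766, 6996607760, 4838540187,
     2710028809, 2737291785, 4849025947, 3259351189, 1644544413, 5926748425, 3259351192,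
     6721569665, 4572022146, 6744638337, 2695349124, 4861706376, 1384631048, 2718417796,
     6727926148, 5429659799, 6727926151, 5429659782, 3823518343, 1388449679, 1388449680,
     6721422337, 5371020290, 2692861829, 4861316232, 1359318932, 2699104140, 7285738498,
     5383405838, 1887653659, 4888592782]),
  ([(0, 4), (3, 2), (8, 1), (11, 2), (4, 1), (7, 2), (15, 2), (1, 1), (2, 1), (5, 2), (6, 1),
   (9, 2), (10, 1), (13, 1), (14, 1)],
    [4854927006, 5398104449, 4626385797, 7560333471, 4572285829, 7529121951, 2955086611,
     1394705922, 6503646993, 3493988113, 1887699969, 3491858193, 4601235076, 1346800515,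
     1935804417, 5922426261, 4567747461, 2741095299, 1912669185, 3502262033, 4628547204,
     1396738947, 5914103189, 4582312837, 1896269825, 2709785475, 1902626817, 1944242177,
     3001453331, 6728040705, 4580688516, 6176590082, 4628546180, 6234851586, 3810853762,
     3498279057, 841107332, 7560331807, 4846535839, 4890690719, 837093508, 5373133977, 4626384005,
     3255143833, 4849077919, 5408572446, 3255144095, 5408574732, 1935802881, 3772844033,
     4892804127, 3282488089, 2718106499, 2741092483, 1346800542, 5398184577, 6182799618,
     6715147265, 847528976, 3506471697, 6715149214, 5371298828, 6503645329, 3819176833, 824461188,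
     847497348, 5398103193, 4890693279, 3267628703, 7529120287, 4572284037, 5371120908,
     3519086737, 4626384031, 4849075359, 3223440793, 5371118622, 3766601729, 4851188767,
     3278325791, 5383619201, 1896268289, 2709783427, 2709782659, 1396738974, 6224414978,
     4622500357, 841106180, 4890689695, 4846535711, 7520668304, 4612096517, 824460036, 4834119316,
     5373136769, 4849074335, 2977975070, 4834051103, 7551879824, 4842799262, 5434032385,
     1382220546, 4892737694, 5949689733, 5956420101, 5926994437, 866223236, 866224004, 5409064705,
     5970985474, 5962367493, 3282158863, 6471843977, 5949688834, 866224644, 815943572, 866224260,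
     5434033305, 818365572, 818366980, 824266644, 2730901648, 1367655170, 818366340, 818366596,
     5409064089, 2737143952, 7520666399, 6451071889, 7551877919, 849773211, 847495940, 837092100,
     5379344793, 4626386437, 3223439391, 6471879569, 4572286469, 3223440153, 6750929153,
     2686829443, 4586685060, 4851187871, 4582313477, 5393957121, 5433754241, 1390657795,
     3766602241, 4582310405, 7520666143, 4622500997, 3498279697, 4612096261, 837092484, 870582932,
     841107972, 4846538399, 870583579, 5398102657, 4626383109, 3792126850, 6719308801, 841286672,
     5431641100, 3493987089, 6719310750, 6491160721, 1374011651, 4892803231, 3772844545,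
     2732606339, 4567748101, 4567745029, 5398184193, 4590846596, 5373411969, 4622500101,
     7551877663, 847496324, 839372059, 4612097157, 839371412, 824461828, 5373133441, 3519087377,
     4572283141, 4626383135, 3819176834, 1902625281, 3007695646, 6444862353, 1944240641,
     6482316177, 3491857425, 4601234436, 6482316945, 6759252254, 6203670658, 4574184452,
     6211993730, 2686830595, 4586685444, 4582313733, 4851191327, 5393957761, 5433754497,
     3766601730, 3278323871, 4582310431, 5393960833, 2699479043, 1390657822, 6224414466,
     1887702401, 3007692958, 3491856913, 5385912460, 6203673602, 4601234820, 4601283074,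
     4567748357, 5922426773, 2741094403, 2732607491, 4892806687, 3282486169, 4567745055,
     1374011678, 4590846980, 5379392385, 5373412225, 5398187905, 6182799106, 1912671617,
     3001452051, 5423368606, 3502260753, 4580475394, 6211996674, 4628546948, 6715147777,
     832703632, 6503645713, 6715148702, 6719309313, 1394706818, 2692762384, 6491161105,
     6719310238, 4622503685, 7520668319, 3498279953, 4612099845, 860177044, 837095044, 841109124,
     4846538271, 7529120016, 847498884, 824462980, 5379346329, 3255141273, 4622500383, 3519087633,
     4626386463, 3255140511, 4612096543, 6736363806]),
  ([(0, 4), (2, 2), (8, 1), (10, 2), (4, 1), (6, 2), (14, 2), (1, 1), (3, 2), (7, 2), (11, 2),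
   (13, 1), (15, 2)],
    [1669645968, 4605641864, 3814933124, 8355366554, 3785802372, 8361608858, 2449639557,
     8376338054, 2437154949, 8361772678, 1650722463, 8376289798, 3796058756, 8355482630,
     2717974913, 6446711181, 8355481222, 6446858628, 2437153669, 8361445018, 2449983621,
     2437399429, 8376339462, 1650968208, 8376125968, 8355153562, 2437400709, 8355367430,
     2449638277, 8334395034, 6469747076, 2481195141, 2481095557, 8361774086, 1675937424,
     8334510608, 8334345882, 2481096837, 8361609734, 2449982341, 2481193861, 8361445904,
     2686520080, 8361447194, 2449981573, 2481193093, 6469780354, 8361774854, 2481193221,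
     8334348058, 8355480070, 3785802756, 4628712200, 1650724639, 8376339334, 1669646480,
     2449637509, 8376123664, 3814936324, 2481094917, 8355152410, 1650970384, 8376336646,
     8355365382, 2481094789, 8376126352, 6469747588, 8376287494, 3785655300, 8376290182,
     2686714116, 8376340230, 2449981701, 8355155738, 3814933508, 4601662216, 1669648144,
     8376287750, 1650724511, 8361773958, 2437152901, 8361773968, 3785805572, 2437398789,
     8334344730, 1675939600, 8361771270, 2437398661, 8361607686, 8334510992, 8355483398,
     8334508560, 8376123920, 8361771526, 8376336902, 1650722591, 4605642632, 3796289028,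
     3815015940, 2437154181, 2449638789, 1669644560, 3796058244, 4605640840, 1675939472,
     8334396314, 1650970256, 8361446298, 8361443856, 8361443866, 1675937552, 4601663240,
     3796059652, 1650968336, 4628713224, 4867620998, 4605641608, 4888854668, 4605643528,
     1650968720, 4628711304, 3785655812, 1675937936, 4601661320, 8361445520, 8361445530,
     1650966800, 8361443600, 1675936016, 8361446288, 3796061956, 4605642760, 1669648016,
     2449637637, 2437153029, 3814934020, 3785803268, 1650722975, 4605644552, 8355367046,
     8361609350, 8355154074, 8334346394, 8376287366, 8361610138, 8361773190, 2481095173,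
     1675935888, 8361610118, 8334510224, 2437399941, 3785801860, 8334347162, 2481193477,
     1650721055, 8361607430, 8355481734, 1669644432, 3815015428, 4601660296, 8376123536,
     2449982853, 8355364998, 6446859140, 8355479814, 3796059140, 8355482502, 2717925636,
     8355367834, 2437399045, 8376338566, 1650966672, 8355367814, 8376125584, 2481096069,
     3814932612, 8355154842, 2449981957, 1669646096, 1650720927, 8355365126, 3796288516,
     4628710280, 8376289414, 8334508176, 2481194373, 8361607302, 2717974785, 2437153285,
     2449637893, 8361443472])]

/-- The possible profiles in dimension 5, each with the coordinate changes normalising its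
extensions. -/
def level5 : List (List (ℕ × ℕ) × List ℕ) := [
  ([(0, 2), (18, 2), (2, 1), (16, 1), (8, 1), (10, 2), (4, 1), (12, 1), (22, 1), (28, 1), (30, 1),
   (1, 1), (5, 1), (7, 1), (9, 1), (17, 2), (23, 1), (25, 1), (29, 1), (31, 1)],
    [1926628447112, 1136638428046, 182092499367, 1589687376264, 1769334444832, 393820048645,
     317384021675, 1895695831701, 1835643961614, 428715186855, 1525062549788, 1999640764339,
     1035993731110, 551748179590, 451621820325, 2070191325314, 1409354274981, 625188735155,
     80019194899, 275484250118, 1077235746433, 291579692929, 622613994375, 386826240146,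
     1280009535623, 380171984553, 176183970336, 1512651374900, 2072078720134, 76841898940,
     1755870582788, 1756668905402, 1279659219995, 936653361189, 276287553720, 560044464772,
     1071984547110, 290305448595, 291609626034, 489739651476, 1758800318468, 2105366679079,
     870872219953, 460400394766, 687842809362, 865981307777, 150402172704, 565640170680]),
  ([(0, 2), (20, 2), (4, 1), (16, 1), (8, 1), (24, 1), (28, 1), (2, 1), (6, 2), (14, 1), (30, 1),
   (1, 1), (7, 1), (13, 2), (17, 1), (19, 1), (23, 1), (27, 1), (29, 1), (31, 1)],
    [276033658126, 451047579548, 80851967240, 874141486364, 80891813183, 860110050074,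
     1550785826820, 80027959428, 76557337630, 1210468155528, 490554246183, 860082887312,
     1169422391990, 875674537510, 585227374112, 875764500368, 1560532844680, 460488858156,
     1183894995135, 875638671285, 874153789455, 80061513908, 456980496959, 860070304399,
     1550764770367, 77094126650, 874040543285, 76586697760, 71775670048, 564818511496,
     80833151489, 80052903816, 875752132122, 1169386740363, 77123033604, 77100418111,
     860105855772, 1210409435316, 71725338376, 289914950039, 285145603747, 557274631075]),
  ([(0, 2), (12, 2), (4, 1), (8, 1), (16, 1), (20, 1), (24, 1), (2, 1), (14, 1), (18, 2), (22, 1),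
   (1, 1), (3, 1), (5, 2), (7, 1), (15, 1), (25, 1), (27, 1), (29, 1), (31, 1)],
    [2167160002974, 317882352270, 317861695646, 757362302645, 153363177227, 1855992941453,
     146123804947, 564041751449, 1594515479304, 318666524548, 320552325405, 2175213066672,
     142627868832, 556574557237, 1764235790264, 1866461924240, 1589952076593, 317331099936,
     313029380000, 276084199738, 290999274754, 317056389290, 174000948399, 1206158139159,
     1273462341776, 560015219610, 141828837671, 556842992678, 147996577936, 1859779942825,
     146134765712, 141820452640, 1593704287907, 1582698434228, 1491789105170, 40283064760,
     51070164368, 1482930735155]),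
  ([(0, 2), (24, 2), (8, 1), (16, 1), (4, 1), (20, 2), (2, 1), (6, 1), (14, 1), (26, 1), (30, 1),
   (1, 1), (13, 2), (17, 1), (19, 1), (23, 1), (27, 1), (29, 1), (31, 2)],
    [49158279575, 1556521850116, 797526072604, 1754358515744, 248957177992, 1103838743681,
     1931772756098, 1720136703133, 1109716834817, 1720222683165, 1718591001885, 150087617665,
     1103916335361, 628519442475, 627166730923, 2077187244164, 586007709064, 1317853136900,
     1624879892104, 2067760826372, 1559943484292, 591387116296, 1620303939976, 2067874073860,
     1559966556036, 137824962327, 1109765064577, 1341458025858, 1718643425437, 1443658997686,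
     248932014728, 1342462532878, 1993215428360, 1620278777864, 628435551275, 627082839723,
     1624940707976]),
  ([(0, 2), (3, 2), (16, 1), (19, 1), (1, 1), (2, 1), (17, 1), (8, 1), (9, 1), (11, 1), (26, 2),
   (4, 1), (6, 1), (13, 1), (14, 1), (15, 1), (20, 1), (21, 1), (22, 1), (29, 1), (31, 1)],
    [1925031379978, 1694712987820, 1649626094911, 1649626799423, 1756407208578, 1756406864514,
     1899753505696, 1353546088608, 218278026781, 1353546203296, 1518885524774, 218278141469,
     902853363754, 902854166570, 1518886262054, 1033000524048, 2000130001025, 1821697903018,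
     1033001195792, 1821698263466, 1821666050945, 47530102707, 34991920006, 34991870854,
     1414508069942, 1459224264841, 1459224002697, 1689293817891, 972596316202, 1114015552692,
     1694205709444, 1206890697248, 2170871106963, 2170871319955, 482949468325, 1109844427962,
     551664752182, 1518907394099, 1109844329658, 1518906443827, 1924496245813, 2009053007661,
     255341103386, 255341676826, 550844367141, 1450980445499, 2009052778285, 764303297848,
     1927920241813, 1520508619012, 37940370062, 1444468022304, 1930873083168]),
  ([(0, 2), (17, 2), (1, 1), (16, 1), (8, 1), (9, 2), (4, 1), (12, 1), (20, 1), (21, 1), (29, 1),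
   (2, 1), (7, 1), (10, 1), (15, 1), (18, 1), (19, 1), (22, 1), (27, 1), (30, 1), (31, 1)],
    [665026760716, 665026763532, 655255208123, 655255215675, 938750461980, 79765310108,
     657146796834, 657146793634, 655256125627, 655256126011, 654508625959, 654508625575,
     938750510748, 655255166523, 655255159355, 79765441180, 657147661986, 657147658402,
     654509031975, 654509035559, 665026305548, 79765521436, 654509081127, 654509084327,
     79765522460, 665026304780, 665026665996, 657147255586, 657147248802, 665026662412,
     1660641038735, 1890423882528, 1660640876175, 1649544400676]),
  ([(0, 2), (18, 2), (2, 1), (16, 1), (8, 1), (10, 2), (4, 1), (12, 1), (14, 1), (20, 2), (1, 1),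
   (3, 1), (5, 1), (7, 1), (15, 1), (23, 1), (25, 2), (27, 1), (31, 1)],
    [561917221306, 1962643670042, 1135311028738, 794571135422, 1137189421570, 1894660081696,
     2141580706343, 1557738144016, 39791630722, 665831491588, 2031631092128, 1076971457720,
     554938915258, 798918526862, 1960210141313, 1866499329668, 1960719749430, 1356438804872,
     2132454359591, 1890096924704, 391725154561, 1526410992136, 2135974515073, 2096298528946,
     653483755524, 104199963306, 1972021383297, 1963179901978, 2111868735666, 1561764397328,
     49992948098, 1974678475062, 388979990288, 1616061530267, 869032839170, 869312416136,
     860174862338, 1825377929089, 860453095816, 1630019960987, 1521309784584, 1859788590724]),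
  ([(0, 2), (20, 2), (4, 1), (16, 1), (1, 1), (17, 2), (8, 1), (13, 2), (24, 1), (29, 1), (2, 1),
   (7, 1), (14, 1), (18, 1), (23, 2), (27, 2), (30, 1), (31, 1)],
    [930951301797, 1762883011598, 930951300012, 1344602391608, 930968079014, 930968076844,
     1762933343269, 1762933343146, 1348744249487, 1759661555871, 1756939682848, 943093811856,
     1762874392720, 1344648534300, 930938717094, 1759648973855, 1759628002325, 1347306984712,
     1347323759240, 1100112314541]),
  ([(0, 2), (24, 2), (8, 1), (16, 1), (4, 1), (12, 2), (2, 1), (10, 2), (22, 2), (1, 1), (3, 2),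
   (7, 1), (13, 1), (19, 1), (25, 1), (29, 2), (31, 1)],
    [1836394792851, 1892204256258, 1836394467775, 1830489573267, 1906169136257, 1831608737726,
     1899988409346, 1825120866751, 1824629841854, 1892204256291, 1899988409379, 1900045453577,
     1890933218306, 1897375276034, 1897339585665, 1890134740515, 1890360380963, 1890440495241,
     1894636339747, 1906239884835, 1899298324617]),
  ([(0, 2), (26, 2), (8, 1), (18, 1), (2, 1), (16, 1), (24, 1), (4, 1), (6, 1), (12, 2), (14, 1),
   (1, 1), (3, 1), (7, 1), (9, 1), (15, 1), (17, 1), (19, 1), (21, 1), (23, 1), (31, 1)],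
    [1552916529700, 1554249779097, 1592099638586, 2144539509786, 1870491834810, 2145120682549,
     1116172076432, 1116159428250, 1102744257598, 76244894727, 84037501447, 1857070220164,
     965063482383, 1113775244043, 1555884261913, 1856597115782, 1870473631494, 76253446688,
     84029015072, 176700261804, 1116178383884, 2144548094519, 153063440662, 2145077120166,
     1102750499458, 1106577162504, 1111948477200, 2029470633743, 1102477071632, 2140513715255,
     1100066145676, 2137336365606, 1103817147394, 46286886024, 149523270934, 800594108323,
     176173909419, 38221121194, 2144583818295, 46199183530, 77345079836, 1106518673416,
     1111357245064, 70607751324, 2140622064823, 183679589010, 1103861761470, 1102552630069,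
     2140521349658, 149574058241, 36534950798, 1100059053328, 2137291754677, 800556588323]),
  ([(0, 2), (18, 2), (2, 1), (16, 1), (8, 1), (10, 1), (24, 1), (4, 1), (6, 2), (12, 1), (28, 1),
   (1, 1), (3, 1), (9, 1), (13, 1), (15, 1), (19, 1), (21, 1), (23, 1), (25, 1), (29, 1)],
    [725877545405, 996825272456, 45476938763, 1007830454462, 531018405183, 528602569126,
     37692785710, 734735374748, 1351950538396, 529363735084, 1135006290439, 1348729509520,
     1697718635680, 527485095975, 1695034444943, 1445280011137, 1318337774596, 996709929096,
     736324769290, 1008788921356, 1134970638855, 1007715111102, 874594304132, 37359424809,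
     721830139433, 1344121930035, 1340689142058, 1351858263708, 528608860582, 1409664352392,
     1013180406442, 46741509388, 736335255050, 1691982255652, 37686494254, 527535427623,
     1013109103274, 1355184578438, 1349710496063, 1692250916532, 729088514178, 1348637234832,
     530968073535, 37346841897, 1351327602306, 998685776513, 529357443628, 1344073695539,
     1352500387728, 1683929683514, 45470647307, 1410953610499, 998614473345, 1691957089828,
     725852379581, 1356950457508, 734710208924, 1694910712975, 1409588854920, 1683904517690,
     2176508579202, 1445292594049, 1116502819898, 1318291637252, 1109714405381, 1458191745563,
     1109804582917, 1100666094593, 1458145608219]),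
  ([(0, 2), (24, 2), (8, 1), (16, 1), (2, 1), (10, 1), (18, 1), (4, 1), (12, 1), (22, 2), (30, 1),
   (1, 1), (5, 1), (7, 1), (9, 1), (15, 1), (17, 1), (19, 1), (21, 1), (27, 1), (29, 1)],
    [1306033722499, 2004757992065, 492870782465, 1320707085456, 2002342315792, 2000429468304,
     2002342315797, 2000429468289, 495555298325, 2002341890062, 1319658504592, 1306033783209,
     1993509325454, 482183699713, 2009352849168, 1993509325477, 482184364168, 2004758446245,
     2009353211918, 484656091137, 2000429826197, 2000429826192, 492870828188, 1996461903873,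
     1306033571881, 2003919917710, 2000429385749, 1319658194947, 2000429385729, 482184283137]),
  ([(0, 2), (20, 2), (4, 1), (16, 1), (1, 1), (17, 2), (8, 1), (13, 1), (24, 1), (29, 2), (2, 1),
   (7, 2), (11, 1), (14, 1), (15, 1), (18, 1), (23, 1), (27, 1), (30, 1)],
    [594639753911, 594639176759, 594639966890, 594639963143, 597894271666, 597894664858,
     594589417998, 597921137690, 597921530882, 79304294536, 77372917775, 597820867134,
     1834803495483, 597820867634, 597821260826, 79220408496, 79220703390]),
  ([(0, 2), (20, 2), (4, 1), (16, 1), (2, 1), (18, 2), (8, 1), (14, 2), (24, 1), (30, 1), (1, 1),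
   (3, 1), (5, 1), (7, 1), (13, 1), (21, 1), (25, 1), (27, 1), (29, 1), (31, 1)],
    [939004068742, 939004953473, 939004075270, 939004124455, 939004075327, 82472884872,
     1581895343514, 932293755015, 1581894360481, 932294148230, 1581895311029, 1581894360712,
     1583505493633, 1857632321717, 1581894360737, 1583505496705, 1581895336090, 1581895303346,
     1859779969281, 932294148228, 1581894360456, 70662086536, 70662476688, 1581895311026,
     1581895303349, 932294153092, 2032148714270, 1583773811773, 941420839681, 1583774204981,
     80056813585, 77670957236, 2032148714272, 941420839738, 558942313089, 2030270153218,
     80056943627, 1583773522209, 2041544409218, 1583774204987, 723711348670, 1583773522177,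
     80056943679, 80056813607, 2032149217592, 1583773519105, 633307288483, 550834328072,
     319774315322, 324606581795, 550834323592, 633307284643, 324606578211, 319774310714,
     633306502017, 562377163777, 324606041090, 635453854089]),
  ([(0, 2), (9, 2), (1, 1), (8, 1), (16, 1), (17, 1), (24, 1), (4, 1), (5, 1), (13, 1), (20, 1),
   (28, 1), (2, 1), (3, 1), (7, 1), (10, 1), (15, 1), (23, 1), (26, 1), (27, 1), (30, 1),
   (31, 1)],
    [1794256962227, 722695720332, 550148903813, 497956999956, 964040475687, 550112526596,
     1104895084478, 146939305779, 283476483845, 1310504131728, 1855818587273, 1855719511688,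
     1305984763930, 1316953607475, 1103823439761, 290019560886, 498059641899, 971012905760,
     1925519838496, 964055499296, 1320973043984, 49707373324, 1864020548742, 486244287533,
     280058708263, 1867531190408, 1322155837698, 1870731087878, 1320988017540, 1926620235827,
     1870850982025, 1931156587168, 1864088083088, 1103555774481, 284304674062, 1867575646867,
     1114284084797, 144450557838, 282235149366, 1107036347325, 283227308167, 283560952109,
     964308501415, 1940897646627, 38758142762, 976650834080, 725690550273, 1318372869029,
     1925322113952, 560349397125, 283476860805, 275494537639, 153323477274, 1729295663409,
     1788640773633, 1869724454928, 154187338163, 550381633668, 483290843565, 1934105149980,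
     38722176059, 560787755954, 278743588794, 1107146098689, 1869722195603, 36325131314,
     481666323260, 1940587203747, 286750150446, 288952374148, 77345131909, 285917795235,
     1925242181384]),
  ([(0, 2), (16, 1), (8, 1), (24, 1), (4, 1), (12, 1), (20, 1), (28, 1), (2, 1), (6, 1), (10, 2),
   (22, 1), (1, 1), (3, 1), (11, 1), (13, 1), (15, 1), (17, 1), (19, 1), (25, 1), (29, 1),
   (31, 1)],
    [35979266107, 146111367169, 1039396787490, 289409096096, 146111367217, 278372406068,
     278372406047, 278372455220, 278372455199, 1039453456566, 146132107559, 1271613234080,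
     1039453456519, 1726701126325, 1273507056305, 1726701126288, 557385435789, 1352502579360,
     1421209476762, 1726692835902, 1352394676896, 1352394676923, 278433618306, 278477031455,
     278477031426, 278433618356, 1726700602000, 557385632388, 1726700602037, 557385632397,
     1352501825696, 1421208723098, 240791622314, 1421152755104, 1352395299515, 240875144846,
     1421164495002, 240875144834, 1421164495029, 1726611101499, 1306849018043, 557281006518,
     289440629009, 1726611101493, 557281072054, 284938405261, 289440629037, 557281072013,
     1273550292375, 284837304765, 966460134313, 284837304739, 1271645995920, 146031122727,
     240875112078, 240875112066, 1421164445850, 1421164445877, 2077516612102, 36094498692,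
     278433536386, 278477080607, 278477080578, 278433536436]),
  ([(0, 2), (17, 2), (1, 1), (16, 1), (8, 1), (9, 1), (25, 1), (4, 1), (12, 1), (13, 1), (20, 1),
   (28, 1), (2, 1), (6, 1), (7, 1), (10, 1), (15, 1), (18, 1), (19, 1), (23, 1), (26, 1),
   (31, 1)],
    []),
  ([(0, 2), (25, 2), (21, 2), (16, 1), (28, 2), (1, 1), (4, 1), (8, 1), (13, 2), (2, 1), (7, 2),
   (11, 1), (14, 1), (19, 1), (22, 1), (26, 2), (31, 1)],
    [1137479090690, 1145276531202, 1148931637762, 1149807694594, 1150603297282, 1146611634946]),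
  ([(0, 2), (18, 2), (2, 1), (16, 1), (1, 1), (3, 2), (8, 1), (9, 1), (11, 1), (26, 1), (27, 1),
   (4, 1), (5, 1), (7, 1), (13, 1), (14, 1), (20, 1), (21, 1), (29, 1), (30, 1), (31, 1)],
    [863351361794, 2036154436010, 290294599452, 978529748232, 2030517639868, 453393911810,
     1719159947936, 2043339774604, 1935692336288, 1099900226838, 1512187363612, 1114607698051,
     44896735004, 41133674530, 1112751314214, 278374322464, 286761369985, 1113021830309,
     1109982973724, 151222309798, 861686242305, 2028875285046, 1787325120696, 1925079302408,
     153090989995, 1801837510786, 147772150707, 2038508226977, 447222353945, 1107055791911,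
     153627825709, 1514047689657, 41897119527, 2031559479584, 1519426683137, 976137109889,
     47891121416, 2035926536464, 1726650385028, 2041831752198, 1926345900291, 1684825474598,
     69013740296, 564603668000, 1560718118961, 41117570835, 563272027317, 1595146502291,
     1584946577717, 558398539319, 39572133657, 36604222082, 1559382282294, 45927664416]),
  ([(0, 2), (20, 2), (4, 1), (16, 1), (2, 1), (18, 2), (8, 1), (10, 1), (14, 1), (28, 1), (30, 1),
   (1, 1), (3, 1), (5, 1), (9, 1), (15, 1), (19, 1), (23, 1), (25, 1), (27, 1), (31, 1)],
    [2066695692180, 2176832046735, 2178387838338, 2174354522407, 1113021745581, 2101317404673,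
     2176051123842, 2102689007762, 1548736404779, 1101185225645, 2030186616105, 1824376259111,
     1115658080057, 1112994531385, 2102686666753, 1795298640399, 2097858993921, 1798544835599,
     1830042621230, 1101741053241, 2110838849810, 1824354539822, 1548634457093, 2061920584762,
     1798639321265, 2027539661358, 2074564100794, 1797998418353, 1101141754425, 2030259837614,
     2061943051924, 2097931061138, 2165003518722, 1796915371953, 1101693355181, 2178463471119,
     1556724650757, 2175141777410, 2101380124178, 1551306313771, 2027604217897, 1115626639021,
     2043704906665, 2110766750081, 73828160910, 83014272654, 81682498574, 74090354190,
     83036951215, 74105684527, 81696788527, 73847718063]),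
  ([(0, 2), (22, 2), (16, 1), (6, 1), (8, 1), (14, 2), (2, 1), (4, 1), (20, 1), (28, 2), (1, 1),
   (5, 1), (7, 1), (11, 1), (17, 1), (21, 1), (25, 1), (27, 1), (29, 1), (31, 1)],
    [1683912660627, 146111136769, 1856053707796, 1214947281305, 1486186634242, 1491519684920,
     426852487483, 762975488386, 144983267744, 1347554803848, 145066723622, 146084272776,
     1860797472400, 1099870280339, 1106316921269, 2107252408834, 908394617248, 772892918035,
     1790491821087, 903395001400, 1478097918472, 357558338073, 421483780896, 142382370311,
     1113828917422, 1859813906818, 138064363656, 1104706309264, 420382776738, 141468013330,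
     119470966788, 1409353370244, 1524820379400, 355467480196, 1938406445885, 420120629302,
     147642025888, 428167401245, 1934379915930, 420925935262, 1527406171568, 1515693578283]),
  ([(0, 2), (20, 2), (4, 1), (16, 1), (1, 1), (5, 2), (8, 1), (9, 1), (12, 1), (25, 2), (2, 1),
   (3, 1), (11, 2), (15, 1), (19, 1), (22, 1), (23, 1), (26, 1), (30, 1)],
    [1480692142134, 1726584081921, 1836718215188, 1184094112181, 1173344895143, 1764167242501,
     1897956147713, 1821419341344, 1007753707667, 1628888223516, 1836718020141, 1480692976046,
     1173344509341, 1184094896295, 1728465227265, 1764166227336, 756286342156, 1486153713201,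
     1829673686573, 1619205672732, 733374667186, 996768011576, 860162443650, 523021469704,
     1762576586120, 1891985555969, 1168613334429, 1168612936117, 525332531208, 280899721346,
     146836655278, 288340416642, 1482680242230, 1008277181752, 863356406146, 1486153959854]),
  ([(0, 2), (20, 2), (4, 1), (16, 1), (2, 1), (6, 1), (18, 1), (8, 1), (12, 1), (14, 2), (30, 1),
   (1, 1), (5, 2), (13, 1), (15, 1), (19, 1), (23, 1), (25, 1), (27, 1), (29, 1)],
    [391219989664, 1035104454304, 1351363759385, 1890916550300, 451039281412, 1351344888089,
     1356496804866, 423056902928, 1043524011649, 1346758412074, 1698450887553, 391949358254,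
     460643647776, 1105434679952, 1043475776001, 426578299649, 453765858318, 1348672542995,
     1045940044296, 386644001841, 392018560046, 1035089773088, 1103304104584, 455295910964,
     1045891810952, 1342230744348, 1698488633985, 1690879445660, 860178664968, 1356431789186,
     412669990709, 412676282037]),
  ([(0, 2), (17, 2), (1, 1), (16, 1), (8, 1), (9, 2), (4, 1), (5, 1), (13, 1), (29, 2), (2, 1),
   (7, 2), (10, 1), (11, 1), (18, 1), (27, 1), (30, 2), (31, 1)],
    [1148187496761, 1967690750850, 289990821943, 2036624067765, 1141958672930, 2105880414608,
     2104538191248, 275417504912, 1136143473801, 1136133067012, 1134521746564, 1271938323249,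
     1134442683554, 2104536108179, 275494491447, 550137728147, 2040474393241, 563559994771,
     1903224427524, 275954277264, 562401773995, 1148222865929, 1959369381762, 1142012773561,
     1892841685565, 1899283748413, 1897687815732, 996986326830, 2101315733523, 2107764475947,
     2040380752950]),
  ([(0, 2), (12, 2), (4, 1), (8, 1), (16, 1), (20, 1), (24, 1), (2, 1), (10, 2), (22, 1), (30, 1),
   (1, 1), (3, 2), (7, 1), (13, 1), (17, 1), (25, 1), (27, 1), (29, 1), (31, 1)],
    [863101993132, 656687988903, 861143765901, 1005337740804, 655064320555, 1649643144964,
     861175094556, 863141891633, 1309707444010, 1661096247570, 1306068604191, 654985254558,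
     1343305862792, 655002377477, 863047897119, 861216702769, 1661189886639, 863054500354,
     861233237920, 1305945704452, 1305943198469, 1661131360691, 653374739348, 861208268716,
     861168735105, 655046137473, 997037031948, 1661117120776, 1237512752391, 655073184295,
     653462409005, 1340627911681, 654993792265, 653414552449, 861244162340, 656675242157,
     653497992378, 861200473360, 1237504428711, 1649577888915, 1661177467573, 1661108797972,
     1660909340930, 1660839598483, 1660862908932, 1307851162040, 1660826983077, 1307948253846]),
  ([(0, 2), (22, 2), (16, 1), (6, 1), (8, 1), (24, 1), (30, 1), (2, 1), (4, 1), (10, 1), (12, 1),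
   (26, 1), (1, 1), (5, 1), (11, 1), (15, 1), (21, 1), (23, 1), (25, 1), (27, 1), (29, 1),
   (31, 1)],
    [966483006107, 970511848072, 970719464759, 1105547746730, 140933273791, 73087910072,
     968872270746, 1007006286389, 1001546154497, 565950960516, 1009936913696, 978485025726,
     559793476411, 147734714512, 2141681353650, 1528212456450, 1993150798466, 900069184276,
     973399429173, 2062761548161, 2130922570650, 452854829712, 996720656915, 998850467078,
     254213526950, 550833771452, 141798955174, 78148411145, 456185105961, 550301554346,
     903826834433, 978751347645, 83771457680, 564319377054, 448858279426, 154460133517,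
     493661462281, 906536158221, 48712685216, 1005134386482, 1010726863399, 558459868040,
     557028807445, 969164086169, 551966692256, 998083138825, 906802693006, 561156806274,
     1446935025975, 557825676982, 893752181799, 550337413260, 967033065489, 561690771634,
     895291806480, 896948438065, 1110790167958, 975779679544]),
  ([(0, 2), (12, 2), (4, 1), (8, 1), (16, 1), (20, 1), (24, 1), (2, 1), (10, 1), (14, 1), (18, 1),
   (30, 1), (1, 1), (5, 1), (7, 1), (9, 1), (15, 1), (19, 1), (21, 1), (27, 1), (29, 1), (31, 1)],
    [903318950276, 907111285428, 1548671274654, 1548671274666, 1548724552234, 1548724552222,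
     907404691251, 908453463845, 1557567684738, 1554254512310, 1554254512258, 1557567684790,
     1560700588937, 1546741942665, 1560700588944, 1546741942672, 1557582926729, 1554361698697,
     1557582926736, 894429267124, 1554361698704, 895503008436, 1548620995202, 1548620995254,
     1548730450050, 1548730450102, 1546738323102, 1560788913834, 1560788913822, 1546738323114,
     907077048196, 903353189556, 1560696963614, 1546830266922, 1546830266910, 1560696963626,
     1550500036790, 1550500036738, 1550609504950, 1550609504898, 1557529643401, 1554308420489,
     908387915652, 1557529643408, 1554308420496, 908387915656, 1560810047888, 1546851406736,
     1560810047881, 1546851406729, 1550603603626, 1550603603614, 1550550319646, 1550550319658,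
     908478431539, 1554346465974, 1557475744386, 907379720485, 1557475744438, 1554346465922,
     276343839775, 276343839769, 283233648806, 283233648800, 276225196198, 276225196192,
     283323159811, 283323159813, 285083571459, 283477251333, 283477251331, 285112704025]),
  ([(0, 2), (24, 2), (8, 1), (16, 1), (2, 1), (10, 1), (18, 1), (4, 1), (6, 1), (14, 1), (28, 1),
   (30, 1), (1, 1), (7, 1), (9, 1), (11, 1), (13, 1), (19, 1), (23, 1), (27, 1), (29, 1),
   (31, 1)],
    []),
  ([(0, 2), (18, 2), (2, 1), (16, 1), (8, 1), (10, 1), (24, 1), (4, 1), (6, 1), (12, 1), (22, 1),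
   (30, 1), (1, 1), (7, 1), (9, 1), (15, 1), (17, 1), (19, 1), (21, 1), (27, 1), (29, 1),
   (31, 1)],
    [2176215472314, 2176215472316, 2176210966716, 2180237774893, 2176211065018, 2180237414445,
     2177822004661, 2177822004646, 2177822037429, 2177822037408, 2173258390833, 2177821316518,
     2180241723435, 2180241723437, 2180329803777, 2176303552656, 2180774646573, 2164936674710,
     2174868971042, 2171916419253, 2174869003810, 2174869003825, 2174868381192, 2174868381233]),
  ([(0, 2), (18, 2), (2, 1), (16, 1), (8, 1), (24, 1), (26, 1), (4, 1), (12, 1), (14, 1), (22, 1),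
   (28, 1), (1, 1), (7, 1), (11, 1), (13, 1), (19, 1), (21, 1), (25, 1), (27, 1), (29, 1),
   (31, 1)],
    [])]

/-- The possible profiles in dimension 6, each with the coordinate changes normalising its
extensions. -/
def level6 : List (List (ℕ × ℕ) × List ℕ) := [
  ([(0, 1), (32, 1), (16, 1), (8, 1), (56, 1), (2, 1), (26, 1), (42, 1), (50, 1), (4, 1), (12, 1),
   (22, 1), (36, 1), (46, 1), (1, 1), (7, 1), (9, 1), (19, 1), (21, 1), (29, 1), (33, 1), (39, 1),
   (57, 1), (63, 1)],
    [249162347307016, 249162360807432, 249024906321929, 246551005159440, 492857260343455,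
     246551250133008, 249024999890953]),
  ([(0, 1), (32, 1), (16, 1), (8, 1), (56, 1), (4, 1), (28, 1), (44, 1), (52, 1), (2, 1), (10, 1),
   (14, 1), (26, 1), (54, 1), (1, 1), (7, 1), (13, 1), (27, 1), (31, 1), (33, 1), (37, 1),
   (39, 1), (51, 1), (53, 1)],
    [73427359078384, 70518055638990]),
  ([(0, 1), (32, 1), (16, 1), (48, 1), (4, 1), (20, 1), (8, 1), (44, 1), (60, 1), (2, 1), (14, 1),
   (30, 1), (38, 1), (58, 1), (1, 1), (5, 1), (9, 1), (19, 1), (39, 1), (43, 1), (45, 1), (51, 1),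
   (53, 1), (63, 1)],
    []),
  ([(0, 1), (32, 1), (2, 1), (34, 1), (8, 1), (42, 1), (16, 1), (56, 1), (58, 1), (4, 1), (6, 1),
   (30, 1), (46, 1), (54, 1), (1, 1), (7, 1), (11, 1), (17, 1), (27, 1), (39, 1), (45, 1),
   (51, 1), (53, 1), (63, 1)],
    [208911739200823, 207759918796471, 283848008581250, 208929188570457]),
  ([(0, 1), (32, 1), (4, 1), (36, 1), (16, 1), (52, 1), (8, 1), (28, 1), (44, 1), (2, 1), (26, 1),
   (38, 1), (42, 1), (58, 1), (1, 1), (13, 1), (15, 1), (25, 1), (31, 1), (39, 1), (45, 1),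
   (49, 1), (51, 1), (63, 1)],
    [253754724150020, 262543453980751, 164694931773411]),
  ([(0, 1), (32, 1), (16, 1), (8, 1), (56, 1), (2, 1), (26, 1), (42, 1), (50, 1), (4, 1), (12, 1),
   (22, 1), (46, 1), (62, 1), (1, 1), (5, 1), (11, 1), (29, 1), (33, 1), (39, 1), (41, 1),
   (53, 1), (59, 1), (61, 1)],
    [7357356645322, 493623982493390, 244264487846128, 130090452416590]),
  ([(0, 1), (52, 2), (32, 1), (4, 1), (16, 1), (8, 1), (28, 1), (56, 1), (2, 1), (14, 1), (22, 1),
   (26, 1), (42, 1), (1, 1), (21, 1), (25, 1), (27, 1), (31, 1), (37, 1), (39, 1), (51, 1),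
   (55, 1), (61, 1)],
    []),
  ([(0, 1), (32, 1), (16, 1), (48, 1), (2, 1), (18, 1), (8, 1), (58, 2), (4, 1), (14, 1), (20, 1),
   (44, 1), (54, 1), (1, 1), (13, 1), (19, 1), (25, 1), (37, 1), (43, 1), (47, 1), (51, 1),
   (53, 1), (61, 1)],
    [143544579513246, 11581500858372, 9036979111104, 151478951280263, 152098009666288,
     11175102274704, 151435256794927, 142250506538723]),
  ([(0, 1), (32, 1), (2, 1), (34, 1), (16, 1), (50, 1), (4, 1), (6, 1), (54, 1), (8, 1), (12, 1),
   (30, 1), (42, 1), (60, 1), (1, 1), (9, 1), (19, 1), (29, 1), (33, 1), (39, 1), (45, 1),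
   (53, 1), (57, 1), (59, 1)],
    [118034417811681]),
  ([(0, 1), (32, 1), (16, 1), (8, 1), (56, 1), (2, 1), (26, 1), (42, 1), (50, 1), (4, 1), (14, 1),
   (28, 1), (44, 1), (62, 1), (1, 1), (7, 1), (13, 1), (17, 1), (37, 1), (39, 1), (41, 1),
   (49, 1), (51, 1), (55, 1)],
    []),
  ([(0, 1), (16, 1), (2, 1), (18, 1), (8, 1), (26, 1), (32, 1), (42, 1), (56, 1), (4, 1), (20, 1),
   (28, 1), (38, 1), (62, 1), (1, 1), (7, 1), (15, 1), (17, 1), (25, 1), (51, 1), (53, 1),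
   (55, 1), (57, 1), (61, 1)],
    [306175520545763, 132080987297728, 395756714714044]),
  ([(0, 1), (32, 1), (21, 1), (53, 1), (4, 1), (49, 1), (1, 1), (16, 1), (52, 1), (8, 1), (13, 1),
   (28, 1), (41, 1), (57, 1), (2, 1), (15, 1), (19, 1), (27, 1), (35, 1), (39, 1), (46, 1),
   (55, 1), (62, 1), (63, 1)],
    [237533170723887]),
  ([(0, 1), (32, 1), (16, 1), (8, 1), (56, 1), (4, 1), (28, 1), (44, 1), (52, 1), (2, 1), (18, 1),
   (30, 1), (34, 1), (38, 1), (1, 1), (5, 1), (11, 1), (15, 1), (33, 1), (43, 1), (51, 1),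
   (53, 1), (59, 1), (61, 1)],
    []),
  ([(0, 1), (32, 1), (16, 1), (8, 1), (56, 1), (4, 1), (28, 1), (44, 1), (52, 1), (2, 1), (10, 1),
   (14, 1), (38, 1), (58, 1), (1, 1), (3, 1), (21, 1), (27, 1), (41, 1), (43, 1), (45, 1),
   (49, 1), (55, 1), (63, 1)],
    []),
  ([(0, 1), (50, 2), (32, 1), (2, 1), (16, 1), (8, 1), (42, 1), (56, 1), (4, 1), (22, 1), (38, 1),
   (44, 1), (62, 1), (1, 1), (3, 1), (5, 1), (15, 1), (19, 1), (25, 1), (29, 1), (31, 1), (53, 1),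
   (59, 1)],
    [264986705436798, 264999589546055]),
  ([(0, 1), (32, 1), (24, 1), (56, 1), (8, 1), (16, 1), (4, 1), (28, 1), (44, 1), (2, 1), (22, 2),
   (38, 1), (42, 1), (1, 1), (5, 1), (11, 1), (17, 1), (27, 1), (39, 1), (41, 1), (47, 1),
   (51, 1), (53, 1)],
    [536598352498544, 344340868375198, 537852983152416, 538460647853856, 537835137404761,
     538464110464772, 536622744751876, 538540077256560, 539268371205977, 347256767144606]),
  ([(0, 1), (44, 2), (32, 1), (16, 1), (28, 1), (4, 1), (8, 1), (56, 1), (2, 1), (14, 1), (18, 1),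
   (38, 1), (58, 1), (1, 1), (9, 1), (13, 1), (23, 1), (35, 1), (39, 1), (55, 1), (57, 1),
   (61, 1), (63, 1)],
    [379229625782575, 379243743205282, 379229569798408, 379247018111368, 325499797921891,
     325508387852387, 379247074095535, 379236495442978]),
  ([(0, 1), (32, 1), (16, 1), (8, 1), (56, 1), (1, 1), (25, 1), (41, 1), (49, 1), (4, 1), (29, 1),
   (44, 1), (52, 1), (61, 1), (2, 1), (11, 1), (30, 1), (35, 1), (39, 1), (46, 1), (54, 1),
   (55, 1), (59, 2)],
    [194789796963648, 194073969337689, 196589478025104, 19207695376441]),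
  ([(0, 1), (32, 1), (16, 1), (8, 1), (56, 1), (4, 1), (28, 1), (44, 1), (52, 1), (2, 1), (14, 1),
   (26, 1), (50, 1), (62, 1), (1, 1), (5, 1), (9, 1), (15, 1), (21, 1), (23, 1), (35, 1), (37, 1),
   (47, 1), (51, 1)],
    [18505629454396, 554239546104238]),
  ([(0, 1), (32, 1), (16, 1), (28, 1), (44, 1), (1, 1), (13, 1), (49, 1), (61, 1), (4, 1), (8, 1),
   (21, 1), (37, 1), (41, 1), (2, 1), (11, 1), (14, 1), (23, 1), (35, 1), (39, 1), (51, 1),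
   (54, 1), (58, 1), (62, 1)],
    [435545956314325]),
  ([(0, 1), (32, 1), (8, 1), (40, 1), (2, 1), (34, 1), (16, 1), (26, 1), (58, 1), (4, 1), (22, 1),
   (38, 1), (46, 1), (60, 1), (1, 1), (7, 1), (27, 1), (37, 1), (43, 1), (45, 1), (49, 1),
   (51, 1), (53, 1), (63, 1)],
    [140788110782594, 312828096834046, 377231115649537, 142937157202108, 142502339832194]),
  ([(0, 1), (32, 1), (26, 1), (58, 1), (16, 1), (42, 1), (2, 1), (8, 1), (50, 1), (4, 1), (14, 1),
   (22, 1), (28, 1), (60, 1), (1, 1), (19, 1), (23, 1), (25, 1), (27, 1), (35, 1), (39, 1),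
   (53, 1), (55, 1), (63, 1)],
    [435544316678896, 435974887129224, 435559531630383]),
  ([(0, 1), (32, 1), (16, 1), (48, 1), (4, 1), (36, 1), (1, 1), (21, 2), (8, 1), (25, 1), (45, 1),
   (57, 1), (60, 1), (2, 1), (6, 1), (15, 1), (30, 1), (35, 1), (39, 1), (42, 1), (47, 1),
   (55, 1), (59, 1)],
    []),
  ([(0, 1), (32, 1), (16, 1), (4, 1), (52, 1), (2, 1), (22, 1), (38, 1), (50, 1), (8, 1), (12, 1),
   (26, 1), (42, 1), (44, 1), (1, 1), (7, 1), (21, 1), (27, 1), (37, 1), (41, 1), (47, 1),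
   (49, 1), (57, 1), (59, 1)],
    []),
  ([(0, 1), (32, 1), (2, 1), (34, 1), (16, 1), (18, 1), (8, 1), (26, 1), (58, 1), (4, 1), (28, 1),
   (36, 1), (46, 1), (54, 1), (1, 1), (7, 1), (9, 1), (15, 1), (23, 1), (25, 1), (49, 1), (53, 1),
   (59, 1), (63, 1)],
    []),
  ([(0, 1), (32, 1), (16, 1), (4, 1), (52, 1), (2, 1), (22, 1), (38, 1), (50, 1), (8, 1), (26, 1),
   (28, 1), (56, 1), (62, 1), (1, 1), (13, 1), (21, 1), (23, 1), (25, 1), (31, 1), (51, 1),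
   (53, 1), (59, 1), (61, 1)],
    []),
  ([(0, 1), (32, 1), (16, 1), (4, 1), (52, 1), (2, 1), (22, 1), (38, 1), (50, 1), (8, 1), (28, 1),
   (42, 1), (56, 1), (62, 1), (1, 1), (13, 1), (19, 1), (33, 1), (41, 1), (47, 1), (49, 1),
   (55, 1), (59, 1), (61, 1)],
    [6158895284534]),
  ([(0, 1), (32, 1), (16, 1), (8, 1), (56, 1), (4, 1), (28, 1), (44, 1), (52, 1), (2, 1), (10, 1),
   (30, 1), (34, 1), (50, 1), (1, 1), (3, 1), (13, 1), (25, 1), (39, 1), (43, 1), (47, 1),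
   (55, 1), (57, 1), (61, 1)],
    [436346131284232]),
  ([(0, 1), (60, 2), (32, 1), (16, 1), (12, 1), (4, 1), (8, 1), (40, 1), (2, 1), (22, 1), (46, 1),
   (50, 1), (54, 1), (1, 1), (19, 1), (25, 1), (35, 1), (43, 1), (45, 1), (49, 1), (53, 1),
   (55, 1), (59, 1)],
    [538253356735240, 495435261175104])]

/-- The columns of generator matrices of the six codes. -/
def sixColumns : Fin 6 → List ℕ := ![
  [1, 2, 4, 7, 8, 9, 16, 28, 32, 34, 47, 53, 56, 59, 64, 74, 79, 83, 85, 89, 99, 108, 125, 126],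
  [1, 2, 4, 8, 13, 16, 26, 31, 32, 42, 47, 51, 54, 60, 64, 78, 83, 86, 88, 93, 103, 105, 112, 123],
  [1, 2, 4, 8, 16, 29, 30, 32, 34, 37, 44, 47, 55, 57, 64, 69, 74, 78, 81, 86, 89, 99, 112, 122],
  [1, 2, 4, 8, 16, 22, 23, 26, 32, 46, 51, 53, 60, 63, 64, 71, 74, 76, 83, 89, 97, 107, 112, 126],
  [1, 2, 4, 7, 8, 11, 16, 22, 26, 32, 46, 51, 53, 60, 64, 70, 85, 89, 95, 98, 111, 112, 125, 126],
  [1, 2, 3, 4, 8, 15, 16, 27, 30, 32, 37, 44, 49, 54, 64, 74, 80, 86, 93, 99, 105, 109, 116, 122]]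

theorem force_eq {α : Type} (n : ℕ) (f : ℕ → α) : force n f = f n := by
  cases n <;> rfl

theorem forcePairs_eq {α : Type} (l : List (ℕ × ℕ)) (f : List (ℕ × ℕ) → α) :
    forcePairs l f = f l := by
  induction l generalizing f with
  | nil => rfl
  | cons a l ih => simp [forcePairs, force_eq, ih]

theorem forcePairLists_eq {α : Type} (l : List (List (ℕ × ℕ)))
    (f : List (List (ℕ × ℕ)) → α) : forcePairLists l f = f l := by
  induction l generalizing f with
  | nil => rfl
  | cons a l ih => simp [forcePairLists, forcePairs_eq, ih]

theorem forceList_eq {α : Type} (l : List ℕ) (f : List ℕ → α) : forceList l f = f l := by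
  induction l generalizing f with
  | nil => rfl
  | cons a l ih => simp [forceList, force_eq, ih]

/-- The parity of the number of common binary digits of `f` and `p` below the `j`-th. -/
def dot : ℕ → ℕ → ℕ → Bool
  | 0, _, _ => false
  | j + 1, f, p => dot j f p ^^ (f.testBit j && p.testBit j)

theorem dot_add_two_pow {j i : ℕ} (h : j ≤ i) (f p : ℕ) : dot j (2 ^ i + f) p = dot j f p := by
  induction j with
  | zero => rfl
  | succ j ih => rw [dot, dot, ih (by omega), Nat.testBit_two_pow_add_gt (by omega)]

theorem dot_succ_of_lt {j f : ℕ} (h : f < 2 ^ j) (p : ℕ) : dot (j + 1) f p = dot j f p := by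
  simp [dot, Nat.testBit_lt_two_pow h]

theorem dot_succ_add {j f : ℕ} (h : f < 2 ^ j) (p : ℕ) :
    dot (j + 1) (2 ^ j + f) p = (dot j f p ^^ p.testBit j) := by
  rw [dot, dot_add_two_pow le_rfl, Nat.testBit_two_pow_add_eq, Nat.testBit_lt_two_pow h]; simp

theorem dot_zero_right (j f : ℕ) : dot j f 0 = false := by
  induction j with
  | zero => rfl
  | succ j ih => simp [dot, ih]

theorem lanePair_eq (B p j : ℕ) :
    lanePair B p j = (∑ f ∈ Finset.range (2 ^ j), (!dot j f p).toNat * B ^ f,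
      ∑ f ∈ Finset.range (2 ^ j), (dot j f p).toNat * B ^ f) := by
  induction j with
  | zero => simp [lanePair, dot]
  | succ j ih =>
    have key : ∀ g : Bool → Bool,
        ∑ f ∈ Finset.range (2 ^ (j + 1)), (g (dot (j + 1) f p)).toNat * B ^ f =
          ∑ f ∈ Finset.range (2 ^ j), (g (dot j f p)).toNat * B ^ f +
          B ^ 2 ^ j * ∑ f ∈ Finset.range (2 ^ j), (g (dot j f p ^^ p.testBit j)).toNat * B ^ f := by
      intro g
      rw [pow_succ, mul_two, Finset.sum_range_add, Finset.mul_sum]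
      refine congrArg₂ _ (Finset.sum_congr rfl fun f hf => ?_)
        (Finset.sum_congr rfl fun f hf => ?_)
      · rw [dot_succ_of_lt (Finset.mem_range.1 hf)]
      · rw [dot_succ_add (Finset.mem_range.1 hf), pow_add]; ring
    have k0 := key fun b => b
    have k1 := key fun b => !b
    beta_reduce at k0 k1
    rw [lanePair, ih, k0, k1]
    simp only [force_eq]
    cases p.testBit j <;> simp

/-- The number with lanes `F h f`, where `h, f < 2 ^ j`. -/
def pack (j : ℕ) (F : ℕ → ℕ → ℕ) : ℕ :=
  ∑ h ∈ Finset.range (2 ^ j), (∑ f ∈ Finset.range (2 ^ j), F h f * 128 ^ f) * (128 ^ 2 ^ j) ^ h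

theorem pack_add (j : ℕ) (F G : ℕ → ℕ → ℕ) :
    pack j (fun h f => F h f + G h f) = pack j F + pack j G := by
  simp [pack, add_mul, Finset.sum_add_distrib]

theorem mul_pack (j a : ℕ) (F : ℕ → ℕ → ℕ) :
    a * pack j F = pack j fun h f => a * F h f := by
  simp only [pack, Finset.mul_sum, Finset.sum_mul, mul_assoc]

theorem sum_mul_sum_eq_pack (j : ℕ) (a b : ℕ → ℕ) :
    (∑ h ∈ Finset.range (2 ^ j), a h * (128 ^ 2 ^ j) ^ h) *
      (∑ f ∈ Finset.range (2 ^ j), b f * 128 ^ f) = pack j fun h f => a h * b f := by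
  rw [pack, Finset.sum_mul]
  refine Finset.sum_congr rfl fun h _ => ?_
  rw [Finset.mul_sum, Finset.sum_mul]
  exact Finset.sum_congr rfl fun f _ => by ring

theorem allLanes_eq (j : ℕ) : allLanes j = pack j fun _ _ => 1 := by
  simp [allLanes, lanePair_eq, dot_zero_right, ← sum_mul_sum_eq_pack j
    (fun _ => 1) fun _ => 1]

theorem sum_mul_pow_lt {s n : ℕ} {a : ℕ → ℕ} (h : ∀ i < n, a i < 2 ^ s) :
    ∑ i ∈ Finset.range n, a i * (2 ^ s) ^ i < (2 ^ s) ^ n := by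
  induction n with
  | zero => simp
  | succ n ih =>
    rw [Finset.sum_range_succ, pow_succ]
    have h1 := ih fun i hi => h i (by omega)
    have h2 : (a n + 1) * (2 ^ s) ^ n ≤ 2 ^ s * (2 ^ s) ^ n :=
      Nat.mul_le_mul_right _ (h n (by omega))
    nlinarith

theorem sum_mul_pow_land_eq_zero {s n : ℕ} {a b : ℕ → ℕ} (ha : ∀ i < n, a i < 2 ^ s)
    (hb : ∀ i < n, b i < 2 ^ s) (hab : ∀ i < n, a i &&& b i = 0) :
    (∑ i ∈ Finset.range n, a i * (2 ^ s) ^ i) &&& (∑ i ∈ Finset.range n, b i * (2 ^ s) ^ i) =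
      0 := by
  induction n with
  | zero => simp
  | succ n ih =>
    have h1 := sum_mul_pow_lt fun i (hi : i < n) => ha i (by omega)
    have h2 := sum_mul_pow_lt fun i (hi : i < n) => hb i (by omega)
    have h3 := ih (fun i hi => ha i (by omega)) (fun i hi => hb i (by omega))
      (fun i hi => hab i (by omega))
    rw [Finset.sum_range_succ, Finset.sum_range_succ]
    generalize ∑ i ∈ Finset.range n, a i * (2 ^ s) ^ i = u at *
    generalize ∑ i ∈ Finset.range n, b i * (2 ^ s) ^ i = v at *
    rw [← pow_mul] at *
    refine Nat.eq_of_testBit_eq fun t => ?_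
    rw [add_comm u, add_comm v, mul_comm (a n), mul_comm (b n), Nat.testBit_and,
      Nat.testBit_two_pow_mul_add _ h1, Nat.testBit_two_pow_mul_add _ h2, Nat.zero_testBit]
    split
    · rw [← Nat.testBit_and, h3, Nat.zero_testBit]
    · rw [← Nat.testBit_and, hab n (by omega), Nat.zero_testBit]

theorem pack_land_eq_zero {j : ℕ} {F : ℕ → ℕ → ℕ}
    (hF : ∀ h < 2 ^ j, ∀ f < 2 ^ j, F h f < 64) : pack j F &&& 64 * allLanes j = 0 := by
  rw [allLanes_eq, mul_pack]
  have key : ∀ {G : ℕ → ℕ}, (∀ f < 2 ^ j, G f < 2 ^ 7) →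
      ∑ f ∈ Finset.range (2 ^ j), G f * (2 ^ 7) ^ f < 2 ^ (7 * 2 ^ j) := fun h => by
    rw [pow_mul]; exact sum_mul_pow_lt h
  have h7 : (128 : ℕ) ^ 2 ^ j = 2 ^ (7 * 2 ^ j) := by rw [pow_mul]; rfl
  simp only [pack]
  rw [h7]
  refine sum_mul_pow_land_eq_zero (fun h hh => key fun f hf => ?_) (fun h hh => key fun f hf => ?_)
    fun h hh => sum_mul_pow_land_eq_zero (s := 7) (fun f hf => ?_) (fun f hf => ?_) fun f hf => ?_
  · have := hF h hh f hf; omega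
  · norm_num
  · have := hF h hh f hf; omega
  · norm_num
  · refine Nat.eq_of_testBit_eq fun t => ?_
    have h6 : (64 * 1 : ℕ) = 2 ^ 6 := rfl
    rw [Nat.testBit_and, h6, Nat.testBit_two_pow, Nat.zero_testBit]
    by_cases ht : 6 = t
    · subst ht; rw [Nat.testBit_lt_two_pow (hF h hh f hf)]; rfl
    · simp [ht]

/-- The start values of the lanes. -/
def startLane (j : ℕ) (L : List (ℕ × ℕ)) (h : ℕ) : ℕ :=
  35 + (L.map fun e => e.2 * (dot j h e.1).toNat).sum

/-- The increments of the lanes for `k` ones at the point `p` of multiplicity `m`. -/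
def laneIncrement (j p m k h f : ℕ) : ℕ :=
  2 * (!dot j h p).toNat * (k * (dot j f p).toNat + (m - k) * (!dot j f p).toNat)

theorem startLanes_eq (j : ℕ) (L : List (ℕ × ℕ)) :
    startLanes j L = pack j fun h _ => startLane j L h := by
  have h1 : ∀ L : List (ℕ × ℕ),
      (L.map fun e => e.2 * (lanePair (128 ^ 2 ^ j) e.1 j).2 * (lanePair 128 0 j).1).sum =
        pack j fun h _ => (L.map fun e => e.2 * (dot j h e.1).toNat).sum := by
    intro L
    induction L with
    | nil => simp [pack]
    | cons e L ih =>
      simp only [List.map_cons, List.sum_cons, ih, pack_add]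
      rw [mul_assoc, lanePair_eq, lanePair_eq, sum_mul_sum_eq_pack, mul_pack]
      simp [dot_zero_right]
  rw [startLanes, h1, allLanes_eq, mul_pack, ← pack_add]
  rfl

theorem increments_eq (j p m : ℕ) :
    increments j p m = (choices j p m).map fun k => (k, pack j (laneIncrement j p m k)) := by
  rw [increments, lanePair_eq]
  simp only [force_eq]
  refine List.map_congr_left fun k _ => ?_
  rw [lanePair_eq, mul_assoc, Finset.mul_sum, Finset.mul_sum, ← Finset.sum_add_distrib]
  have h1 : ∀ f, k * ((dot j f p).toNat * 128 ^ f) + (m - k) * ((!dot j f p).toNat * 128 ^ f) =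
      (k * (dot j f p).toNat + (m - k) * (!dot j f p).toNat) * 128 ^ f := fun f => by ring
  simp only [h1]
  rw [sum_mul_sum_eq_pack, mul_pack]
  simp only [← mul_assoc]
  rfl

theorem search_cons (H : ℕ) (cs : List (ℕ × ℕ)) (es : List (List (ℕ × ℕ))) (V : ℕ)
    (ks : List ℕ) (tl : List (List ℕ)) : search H (cs :: es) V ks tl =
      cs.foldr (fun c r =>
        bif Nat.beq (V + c.2 &&& H) 0 then search H es (V + c.2) (c.1 :: ks) r else r) tl := by
  simp only [search, force_eq]
  rfl

theorem mem_search_of_mem {H : ℕ} {es : List (List (ℕ × ℕ))} {V : ℕ} {ks x : List ℕ}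
    {tl : List (List ℕ)} (hx : x ∈ tl) : x ∈ search H es V ks tl := by
  induction es generalizing V ks tl with
  | nil => exact List.mem_cons_of_mem _ hx
  | cons cs es ih =>
    rw [search_cons]
    induction cs with
    | nil => exact hx
    | cons c cs ih' =>
      rw [List.foldr_cons]
      cases Nat.beq (V + c.2 &&& H) 0
      · exact ih'
      · exact ih ih'

theorem mem_search {j : ℕ} {L : List (ℕ × ℕ)} {K : ℕ → ℕ} {F : ℕ → ℕ → ℕ}
    (hK : ∀ e ∈ L, K e.1 ∈ choices j e.1 e.2)
    (hF : ∀ h < 2 ^ j, ∀ f < 2 ^ j,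
      F h f + (L.map fun e => laneIncrement j e.1 e.2 (K e.1) h f).sum < 64)
    (ks : List ℕ) (tl : List (List ℕ)) :
    (L.map fun e => K e.1).reverse ++ ks ∈
      search (64 * allLanes j) (L.map fun e => increments j e.1 e.2) (pack j F) ks tl := by
  induction L generalizing F ks tl with
  | nil => exact List.mem_cons_self
  | cons e L ih =>
    simp only [List.map_cons, List.sum_cons, List.forall_mem_cons] at hK hF ⊢
    rw [search_cons, increments_eq]
    obtain ⟨s, t, hst⟩ := List.append_of_mem hK.1
    rw [hst, List.map_append, List.map_cons, List.foldr_append, List.foldr_cons]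
    generalize List.foldr _ tl _ = r
    have h1 : pack j F + pack j (laneIncrement j e.1 e.2 (K e.1)) =
        pack j fun h f => F h f + laneIncrement j e.1 e.2 (K e.1) h f := (pack_add ..).symm
    have h2 := ih (F := fun h f => F h f + laneIncrement j e.1 e.2 (K e.1) h f) hK.2
      (fun h hh f hf => by rw [add_assoc]; exact hF h hh f hf) (K e.1 :: ks) r
    have h3 := pack_land_eq_zero (j := j)
      (F := fun h f => F h f + laneIncrement j e.1 e.2 (K e.1) h f)
      fun h hh f hf => by have := hF h hh f hf; omega
    simp only [h1, h3]
    rw [List.reverse_cons, List.append_assoc, List.singleton_append]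
    have h4 : ∀ (s : List ℕ) (r : List (List ℕ)) (x : List ℕ), x ∈ r → x ∈ List.foldr (fun c r =>
        bif Nat.beq (pack j F + c.2 &&& 64 * allLanes j) 0 then
          search (64 * allLanes j) (L.map fun e => increments j e.1 e.2) (pack j F + c.2)
            (c.1 :: ks) r else r) r (s.map fun k => (k, pack j (laneIncrement j e.1 e.2 k))) := by
      intro s r x hx
      rw [← search_cons (es := L.map fun e => increments j e.1 e.2)]
      exact mem_search_of_mem hx
    exact h4 _ _ _ h2

theorem extensionCode_eq (j c a : ℕ) (L : List (ℕ × ℕ)) (K : ℕ → ℕ) :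
    extensionCode j c a L (L.map fun e => K e.1) =
      (L.map fun e => (e.2 - K e.1) * 32 ^ applyCert j c e.1 +
        K e.1 * 32 ^ (applyCert j c e.1 ^^^ a)).sum := by
  induction L with
  | nil => rfl
  | cons e L ih =>
    rw [List.map_cons, List.map_cons, List.sum_cons, ← ih]
    simp only [extensionCode, force_eq]
    rfl

theorem exists_of_checkLeaves {j : ℕ} {T : List ℕ} {L : List (ℕ × ℕ)} {l : List (List ℕ)}
    {cs : List ℕ} (h : checkLeaves j T L l cs = true) {ks : List ℕ} (hks : ks ∈ l) :
    ∃ c, extensionCode j c (c / 128 ^ j) L ks ∈ T := by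
  induction l generalizing cs with
  | nil => simp at hks
  | cons x l ih =>
    cases cs with
    | nil => simp [checkLeaves] at h
    | cons c cs =>
      rw [checkLeaves, Bool.and_eq_true, force_eq, List.any_eq_true] at h
      rcases List.mem_cons.1 hks with rfl | hks
      · obtain ⟨⟨y, hy, hy'⟩, -⟩ := h
        exact ⟨c, Nat.eq_of_beq_eq_true hy' ▸ hy⟩
      · exact ih h.2 hks

theorem exists_of_checkProfile {j : ℕ} {T : List ℕ} {L : List (ℕ × ℕ)} {certs : List ℕ}
    (h : checkProfile j T L certs = true) {K : ℕ → ℕ}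
    (hK : ∀ e ∈ L, K e.1 ∈ choices j e.1 e.2)
    (hF : ∀ h < 2 ^ j, ∀ f < 2 ^ j,
      startLane j L h + (L.map fun e => laneIncrement j e.1 e.2 (K e.1) h f).sum < 64) :
    ∃ c a, (L.map fun e => (e.2 - K e.1) * 32 ^ applyCert j c e.1 +
      K e.1 * 32 ^ (applyCert j c e.1 ^^^ a)).sum ∈ T := by
  simp only [checkProfile, force_eq, forcePairLists_eq, startLanes_eq] at h
  have h1 := mem_search hK hF [] []
  rw [List.append_nil, ← List.map_reverse] at h1
  obtain ⟨c, hc⟩ := exists_of_checkLeaves h h1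
  rw [extensionCode_eq, List.map_reverse, List.sum_reverse] at hc
  exact ⟨c, _, hc⟩

/-- The binary digit as an element of the field with two elements. -/
def bitZ (n l : ℕ) : ZMod 2 := if n.testBit l then 1 else 0

theorem bitZ_xor (a b l : ℕ) : bitZ (a ^^^ b) l = bitZ a l + bitZ b l := by
  simp only [bitZ, Nat.testBit_xor]
  cases a.testBit l <;> cases b.testBit l <;> decide

theorem bitZ_applyCert_mem {ι : Type*} {D : Submodule (ZMod 2) (ι → ZMod 2)} {d : ι → ℕ}
    (hd : ∀ l, (fun i => bitZ (d i) l) ∈ D) (n c t : ℕ) :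
    (fun i => bitZ (applyCert n c (d i)) t) ∈ D := by
  induction n generalizing c d with
  | zero => convert D.zero_mem using 1; ext i; simp [applyCert, bitZ]
  | succ n ih =>
    have h1 := ih (d := fun i => d i / 2) (fun l => by
      convert hd (l + 1) using 2 with i
      simp [bitZ, Nat.testBit_succ]) (c / 128)
    convert D.add_mem (D.smul_mem (bitZ (c % 128) t) (hd 0)) h1 using 1
    ext i
    have h2 : applyCert (n + 1) c (d i) =
      (d i % 2 * (c % 128)) ^^^ applyCert n (c / 128) (d i / 2) := rfl
    simp only [h2, bitZ_xor, Pi.add_apply, Pi.smul_apply, smul_eq_mul]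
    congr 1
    rcases Nat.mod_two_eq_zero_or_one (d i) with h | h <;> simp [h, bitZ, Nat.testBit_zero]

theorem eq_of_sum_mul_pow_eq {n : ℕ} {f g : ℕ → ℕ} (hf : ∀ p < n, f p < 32)
    (hg : ∀ p < n, g p < 32)
    (h : ∑ p ∈ Finset.range n, f p * 32 ^ p = ∑ p ∈ Finset.range n, g p * 32 ^ p) :
    ∀ p < n, f p = g p := by
  induction n with
  | zero => simp
  | succ n ih =>
    have h1 := sum_mul_pow_lt (s := 5) fun i (hi : i < n) => hf i (by omega)
    have h2 := sum_mul_pow_lt (s := 5) fun i (hi : i < n) => hg i (by omega)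
    norm_num at h1 h2
    rw [Finset.sum_range_succ, Finset.sum_range_succ] at h
    have h3 : f n = g n := by
      have := congrArg (· / 32 ^ n) h
      simpa [Nat.add_mul_div_right, Nat.div_eq_of_lt h1, Nat.div_eq_of_lt h2] using this
    rw [h3, Nat.add_right_cancel_iff] at h
    intro p hp
    rcases Nat.lt_succ_iff_lt_or_eq.1 hp with hp | rfl
    · exact ih (fun p hp => hf p (by omega)) (fun p hp => hg p (by omega)) h p hp
    · exact h3

theorem multiset_eq_of_sum_pow_eq {s t : Multiset ℕ} (hs : s.card < 32) (ht : t.card < 32)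
    (h : (s.map fun p => 32 ^ p).sum = (t.map fun p => 32 ^ p).sum) : s = t := by
  have key : ∀ u : Multiset ℕ, ∀ n, (∀ p ∈ u, p < n) →
      (u.map fun p => 32 ^ p).sum = ∑ p ∈ Finset.range n, u.count p * 32 ^ p := by
    intro u n hu
    rw [Finset.sum_multiset_map_count]
    refine Finset.sum_subset (fun p hp => Finset.mem_range.2 (hu p (by simpa using hp)))
      fun p _ hp => ?_
    rw [Multiset.count_eq_zero_of_notMem (by simpa using hp), zero_smul]
  obtain ⟨n, hn⟩ : ∃ n, ∀ p ∈ s + t, p < n :=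
    ⟨(s + t).sup + 1, fun p hp => Nat.lt_succ_of_le (Multiset.le_sup hp)⟩
  rw [key s n fun p hp => hn p (Multiset.mem_add.2 (Or.inl hp)),
    key t n fun p hp => hn p (Multiset.mem_add.2 (Or.inr hp))] at h
  have h1 := eq_of_sum_mul_pow_eq (fun p _ => (Multiset.count_le_card p s).trans_lt hs)
    (fun p _ => (Multiset.count_le_card p t).trans_lt ht) h
  ext p
  by_cases hp : p < n
  · exact h1 p hp
  · rw [Multiset.count_eq_zero_of_notMem fun hp' => hp (hn p (Multiset.mem_add.2 (Or.inl hp'))),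
      Multiset.count_eq_zero_of_notMem fun hp' => hp (hn p (Multiset.mem_add.2 (Or.inr hp')))]

/-- The list of points of a profile, with multiplicities. -/
def profilePoints (L : List (ℕ × ℕ)) : List ℕ := L.flatMap fun e => List.replicate e.2 e.1

theorem count_profilePoints {L : List (ℕ × ℕ)} (hL : (L.map Prod.fst).Nodup) {e : ℕ × ℕ}
    (he : e ∈ L) : (profilePoints L).count e.1 = e.2 := by
  induction L with
  | nil => simp at he
  | cons a L ih =>
    have h1 : profilePoints (a :: L) = List.replicate a.2 a.1 ++ profilePoints L := rfl
    rw [List.map_cons, List.nodup_cons] at hL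
    rw [h1, List.count_append, List.count_replicate]
    rcases List.mem_cons.1 he with rfl | he
    · rw [List.count_eq_zero_of_not_mem]
      · simp
      · intro h
        obtain ⟨b, hb, hb'⟩ := List.mem_flatMap.1 h
        exact hL.1 (List.mem_map.2 ⟨b, hb, (List.eq_of_mem_replicate hb').symm⟩)
    · have h2 : a.1 ≠ e.1 := fun h => hL.1 (h ▸ List.mem_map_of_mem he)
      simp [h2, ih hL.2 he]

theorem length_profilePoints (L : List (ℕ × ℕ)) :
    (profilePoints L).length = (L.map Prod.snd).sum := by
  simp [profilePoints, List.length_flatMap]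

theorem sum_profilePoints (L : List (ℕ × ℕ)) :
    ((profilePoints L).map fun p => 32 ^ p).sum = profileCode L := by
  induction L with
  | nil => rfl
  | cons e L ih =>
    have h1 : profilePoints (e :: L) = List.replicate e.2 e.1 ++ profilePoints L := rfl
    rw [h1, List.map_append, List.sum_append, ih]
    simp [profileCode]

/-- The number of columns equal to `p`. -/
def columnCount (c : Fin 24 → ℕ) (p : ℕ) : ℕ := (Finset.univ.filter fun i => c i = p).card

/-- The number of ones of a word in the columns equal to `p`. -/
def onesCount (c : Fin 24 → ℕ) (x : Fin 24 → ZMod 2) (p : ℕ) : ℕ :=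
  (Finset.univ.filter fun i => c i = p ∧ x i = 1).card

theorem onesCount_le (c : Fin 24 → ℕ) (x : Fin 24 → ZMod 2) (p : ℕ) :
    onesCount c x p ≤ columnCount c p :=
  Finset.card_le_card fun i hi => by simp_all

theorem profile_of_sum_eq {j : ℕ} {L : List (ℕ × ℕ)} (hL : validProfile j L = true)
    {c : Fin 24 → ℕ} (h : ∑ i, 32 ^ c i = profileCode L) :
    (L.map Prod.fst).Nodup ∧ (∀ e ∈ L, e.2 = columnCount c e.1) ∧
      ∀ i, c i ∈ L.map Prod.fst := by
  simp only [validProfile, Bool.and_eq_true, decide_eq_true_eq] at hL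
  obtain ⟨⟨hL, -⟩, h24⟩ := hL
  have h24 := Nat.eq_of_beq_eq_true h24
  have h1 : (Finset.univ.val.map c : Multiset ℕ) = (profilePoints L : Multiset ℕ) := by
    apply multiset_eq_of_sum_pow_eq
    · simp
    · rw [Multiset.coe_card, length_profilePoints, h24]
      norm_num
    · rw [Multiset.map_map, Multiset.map_coe, Multiset.sum_coe, sum_profilePoints]
      exact h
  refine ⟨hL, fun e he => ?_, fun i => ?_⟩
  · rw [← count_profilePoints hL he, ← Multiset.coe_count, ← h1, Multiset.count_map, columnCount,
      Finset.card_def, Finset.filter_val]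
    simp only [eq_comm]
  · have h2 : c i ∈ (profilePoints L : Multiset ℕ) := by
      rw [← h1]; exact Multiset.mem_map_of_mem c (Finset.mem_univ_val i)
    obtain ⟨e, he, he'⟩ := List.mem_flatMap.1 (Multiset.mem_coe.1 h2)
    exact List.mem_map.2 ⟨e, he, (List.eq_of_mem_replicate he').symm⟩

theorem zmod_two_eq (b : ZMod 2) : b = 0 ∨ b = 1 := by
  revert b; decide

theorem sum_columns {L : List (ℕ × ℕ)} {c : Fin 24 → ℕ} (hL : (L.map Prod.fst).Nodup)
    (hm : ∀ e ∈ L, e.2 = columnCount c e.1) (hc : ∀ i, c i ∈ L.map Prod.fst)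
    (x : Fin 24 → ZMod 2) (G : ℕ → ZMod 2 → ℕ) :
    ∑ i, G (c i) (x i) = (L.map fun e => (e.2 - onesCount c x e.1) * G e.1 0 +
      onesCount c x e.1 * G e.1 1).sum := by
  have h1 : (L.map fun e => (e.2 - onesCount c x e.1) * G e.1 0 + onesCount c x e.1 * G e.1 1) =
      (L.map Prod.fst).map fun p => (columnCount c p - onesCount c x p) * G p 0 +
        onesCount c x p * G p 1 := by
    rw [List.map_map]
    exact List.map_congr_left fun e he => by simp [hm e he]
  rw [h1, ← List.sum_toFinset _ hL,
    ← Finset.sum_fiberwise_of_maps_to (s := Finset.univ) (g := c) fun i _ =>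
      List.mem_toFinset.2 (hc i)]
  refine Finset.sum_congr rfl fun p _ => ?_
  rw [← Finset.sum_filter_add_sum_filter_not (Finset.univ.filter fun i => c i = p)
    (fun i => x i = 1), Finset.filter_filter, Finset.filter_filter, add_comm]
  have h2 : columnCount c p - onesCount c x p =
      (Finset.univ.filter fun i => c i = p ∧ ¬ x i = 1).card := by
    have := Finset.card_filter_add_card_filter_not (s := Finset.univ.filter fun i => c i = p)
      (fun i => x i = 1)
    rw [Finset.filter_filter, Finset.filter_filter] at this
    rw [columnCount, onesCount]
    omega
  rw [h2, onesCount]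
  congr 1
  · rw [Finset.card_eq_sum_ones, Finset.sum_mul]
    refine Finset.sum_congr rfl fun i hi => ?_
    obtain ⟨hi, hi'⟩ := (Finset.mem_filter.1 hi).2
    rw [hi, (zmod_two_eq (x i)).resolve_right hi', one_mul]
  · rw [Finset.card_eq_sum_ones, Finset.sum_mul]
    refine Finset.sum_congr rfl fun i hi => ?_
    obtain ⟨hi, hi'⟩ := (Finset.mem_filter.1 hi).2
    rw [hi, hi', one_mul]

/-- The word whose entries are the `l`-th digits of the columns. -/
def bitWord (c : Fin 24 → ℕ) (l : ℕ) : Fin 24 → ZMod 2 := fun i => bitZ (c i) l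

/-- The word given by evaluating the functional `f` at the columns. -/
def functionalWord (j : ℕ) (c : Fin 24 → ℕ) (f : ℕ) : Fin 24 → ZMod 2 :=
  fun i => if dot j f (c i) then 1 else 0

/-- The span of the words given by the first `j` digits of the columns. -/
def bitSpan (j : ℕ) (c : Fin 24 → ℕ) : Submodule (ZMod 2) (Fin 24 → ZMod 2) :=
  Submodule.span (ZMod 2) (Set.range fun l : Fin j => bitWord c l)

theorem bitWord_mem_bitSpan {j l : ℕ} (h : l < j) (c : Fin 24 → ℕ) :
    bitWord c l ∈ bitSpan j c :=
  Submodule.subset_span ⟨⟨l, h⟩, rfl⟩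

theorem functionalWord_mem_bitSpan (j : ℕ) (c : Fin 24 → ℕ) (f : ℕ) :
    functionalWord j c f ∈ bitSpan j c := by
  have h1 : ∀ n ≤ j, functionalWord n c f ∈ bitSpan j c := by
    intro n hn
    induction n with
    | zero => exact (bitSpan j c).zero_mem
    | succ n ih =>
      convert (bitSpan j c).add_mem (ih (by omega)) ((bitSpan j c).smul_mem (bitZ f n)
        (bitWord_mem_bitSpan (show n < j by omega) c)) using 1
      ext i
      simp only [functionalWord, bitWord, dot, bitZ, Pi.add_apply, Pi.smul_apply, smul_eq_mul]
      have h2 : ∀ a b d : Bool, (if (a ^^ (b && d)) = true then (1 : ZMod 2) else 0) =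
        (if a = true then 1 else 0) + (if b = true then 1 else 0) * if d = true then 1 else 0 := by
        decide
      exact h2 _ _ _
  exact h1 j le_rfl

theorem finrank_bitSpan_le (j : ℕ) (c : Fin 24 → ℕ) :
    Module.finrank (ZMod 2) (bitSpan j c) ≤ j :=
  (finrank_range_le_card _).trans_eq (Fintype.card_fin j)

theorem exists_normalised (j : ℕ) (c : Fin 24 → ℕ) (x : Fin 24 → ZMod 2) :
    ∃ y, y - x ∈ bitSpan j c ∧ ∀ l < j, 2 * onesCount c y (2 ^ l) ≤ columnCount c (2 ^ l) := by
  have h1 : ∀ n ≤ j, ∃ y, y - x ∈ bitSpan j c ∧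
      ∀ l < n, 2 * onesCount c y (2 ^ l) ≤ columnCount c (2 ^ l) := by
    intro n hn
    induction n with
    | zero => exact ⟨x, by simp, by simp⟩
    | succ n ih =>
      obtain ⟨y, hy, hl⟩ := ih (by omega)
      by_cases h : 2 * onesCount c y (2 ^ n) ≤ columnCount c (2 ^ n)
      · refine ⟨y, hy, fun l hl' => ?_⟩
        rcases Nat.lt_succ_iff_lt_or_eq.1 hl' with h' | rfl
        · exact hl l h'
        · exact h
      · refine ⟨y + bitWord c n, ?_, fun l hl' => ?_⟩
        · rw [add_sub_right_comm]
          exact Submodule.add_mem _ hy (bitWord_mem_bitSpan (by omega) c)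
        · rcases Nat.lt_succ_iff_lt_or_eq.1 hl' with h' | rfl
          · convert hl l h' using 2
            unfold onesCount
            congr 1
            ext i
            simp only [Finset.mem_filter, Finset.mem_univ, true_and, and_congr_right_iff]
            intro hi
            simp [bitWord, hi, bitZ, h'.ne]
          · have h2 : onesCount c (y + bitWord c l) (2 ^ l) + onesCount c y (2 ^ l) =
                columnCount c (2 ^ l) := by
              have := Finset.card_filter_add_card_filter_not
                (s := Finset.univ.filter fun i => c i = 2 ^ l) (fun i => y i = 1)
              rw [Finset.filter_filter, Finset.filter_filter] at this
              rw [columnCount, ← this, add_comm, onesCount, onesCount]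
              congr 2
              ext i
              simp only [Finset.mem_filter, Finset.mem_univ, true_and, and_congr_right_iff]
              intro hi
              simp only [Pi.add_apply, bitWord, hi, bitZ, Nat.testBit_two_pow_self, if_true]
              generalize y i = b
              revert b; decide
            omega
  exact h1 j le_rfl

theorem card_eq_add_hammingNorm_sub (x w : Fin 24 → ZMod 2) :
    (Finset.univ.filter fun i => x i = w i).card + hammingNorm (x - w) = 24 := by
  have := Finset.card_filter_add_card_filter_not (s := Finset.univ) (fun i => x i = w i)
  rw [Finset.card_univ, Fintype.card_fin] at this
  simpa [hammingNorm, sub_eq_zero] using this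

/-- The contribution of a column `p` with entry `b` in the new word to a lane. -/
def laneContribution (j h f p : ℕ) (b : ZMod 2) : ℕ :=
  (dot j h p).toNat +
    2 * (!dot j h p).toNat * (if b = 1 then dot j f p else !dot j f p).toNat

theorem laneContribution_eq (j h f : ℕ) (c : Fin 24 → ℕ) (x : Fin 24 → ZMod 2) (i : Fin 24) :
    laneContribution j h f (c i) (x i) = (if x i = functionalWord j c f i then 1 else 0) +
      if x i = (functionalWord j c f + functionalWord j c h) i then 1 else 0 := by
  simp only [laneContribution, functionalWord, Pi.add_apply]
  have h1 : ∀ (s t : Bool) (b : ZMod 2),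
      s.toNat + 2 * (!s).toNat * (if b = 1 then t else !t).toNat =
        (if b = (if t = true then 1 else 0) then 1 else 0) +
          if b = (if t = true then 1 else 0) + (if s = true then 1 else 0) then 1 else 0 := by
    decide
  exact h1 _ _ _

theorem startLane_add_sum_laneIncrement {j : ℕ} {L : List (ℕ × ℕ)} {c : Fin 24 → ℕ}
    (hL : (L.map Prod.fst).Nodup) (hm : ∀ e ∈ L, e.2 = columnCount c e.1)
    (hc : ∀ i, c i ∈ L.map Prod.fst) (x : Fin 24 → ZMod 2) (h f : ℕ) :
    startLane j L h + (L.map fun e => laneIncrement j e.1 e.2 (onesCount c x e.1) h f).sum =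
      35 + (24 - hammingNorm (x - functionalWord j c f)) +
        (24 - hammingNorm (x - (functionalWord j c f + functionalWord j c h))) := by
  have h1 := card_eq_add_hammingNorm_sub x (functionalWord j c f)
  have h2 := card_eq_add_hammingNorm_sub x (functionalWord j c f + functionalWord j c h)
  have h3 : ∑ i, laneContribution j h f (c i) (x i) =
      (Finset.univ.filter fun i => x i = functionalWord j c f i).card +
      (Finset.univ.filter fun i =>
        x i = (functionalWord j c f + functionalWord j c h) i).card := by
    simp only [laneContribution_eq, Finset.sum_add_distrib, Finset.card_filter]
  rw [sum_columns hL hm hc] at h3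
  have h4 : (L.map fun e => (e.2 - onesCount c x e.1) * laneContribution j h f e.1 0 +
      onesCount c x e.1 * laneContribution j h f e.1 1) =
      L.map fun e => e.2 * (dot j h e.1).toNat +
        laneIncrement j e.1 e.2 (onesCount c x e.1) h f := by
    refine List.map_congr_left fun e he => ?_
    have := onesCount_le c x e.1
    rw [← hm e he] at this
    obtain ⟨d, hd⟩ := Nat.exists_eq_add_of_le this
    rw [laneContribution, laneContribution, laneIncrement, hd]
    cases dot j h e.1 <;> cases dot j f e.1 <;> simp <;> ring
  rw [h4, List.sum_map_add] at h3
  rw [startLane]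
  omega

/-- The digit words of some 24 columns lie in `D`, and the profile of the columns, as a base `32`
number, is in `T`. -/
def HasColumns (D : Submodule (ZMod 2) (Fin 24 → ZMod 2)) (T : List ℕ) : Prop :=
  ∃ c : Fin 24 → ℕ, (∀ l, bitWord c l ∈ D) ∧ ∑ i, 32 ^ c i ∈ T

theorem onesCount_mem_choices {j : ℕ} {c : Fin 24 → ℕ} {x : Fin 24 → ZMod 2}
    (h0 : onesCount c x 0 ∈ tails j (columnCount c 0))
    (hx : ∀ l < j, 2 * onesCount c x (2 ^ l) ≤ columnCount c (2 ^ l)) (p : ℕ) :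
    onesCount c x p ∈ choices j p (columnCount c p) := by
  unfold choices
  split_ifs with hp hp'
  · rw [hp]; exact h0
  · obtain ⟨l, hl, hl'⟩ := List.any_eq_true.1 hp'
    have := hx l (List.mem_range.1 hl)
    rw [eq_of_beq hl'] at this
    rw [List.mem_range]
    omega
  · rw [List.mem_range]
    have := onesCount_le c x p
    omega

theorem HasColumns.extend {D D' : Submodule (ZMod 2) (Fin 24 → ZMod 2)} (hD : D ≤ D') {j : ℕ}
    (hrank : j < Module.finrank (ZMod 2) D') (hmin : ∀ v ∈ D', v ≠ 0 → 10 ≤ hammingNorm v)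
    (htail : ∀ x ∈ D', ∀ Z : Finset (Fin 24), (∀ i, (∀ v ∈ D, v i = 0) → i ∈ Z) →
      (Z.filter fun i => x i = 1).card ∈ tails j Z.card)
    {l : List (List (ℕ × ℕ) × List ℕ)} {T : List ℕ} (hl : checkLevel j l T = true)
    (h : HasColumns D (levelCodes l)) : HasColumns D' T := by
  obtain ⟨c, hc, hcode⟩ := h
  obtain ⟨⟨L, certs⟩, he, hcode⟩ := List.mem_map.1 hcode
  rw [checkLevel, forceList_eq, List.all_eq_true] at hl
  obtain ⟨hvalid, hcheck⟩ := Bool.and_eq_true_iff.1 (hl _ he)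
  obtain ⟨hL, hm, hcL⟩ := profile_of_sum_eq hvalid hcode.symm
  have hW : bitSpan j c ≤ D' := by
    rw [bitSpan, Submodule.span_le]
    rintro _ ⟨t, rfl⟩
    exact hD (hc t)
  obtain ⟨x₀, hx₀, hx₀'⟩ : ∃ x ∈ D', x ∉ bitSpan j c := by
    by_contra! hcon
    have := Submodule.finrank_mono (show D' ≤ bitSpan j c from hcon)
    have := finrank_bitSpan_le j c
    omega
  obtain ⟨x, hxx, hnorm⟩ := exists_normalised j c x₀
  have hx : x ∈ D' := by simpa using D'.add_mem (hW hxx) hx₀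
  have hx' : x ∉ bitSpan j c := fun h => hx₀' (by simpa using Submodule.sub_mem _ h hxx)
  have hdist : ∀ w ∈ bitSpan j c, 10 ≤ hammingNorm (x - w) := fun w hw =>
    hmin _ (D'.sub_mem hx (hW hw)) fun h0 => hx' (sub_eq_zero.1 h0 ▸ hw)
  have h0 : onesCount c x 0 ∈ tails j (columnCount c 0) := by
    have h1 := htail x hx (Finset.univ.filter fun i => c i = 0) fun i hi => by
      refine Finset.mem_filter.2 ⟨Finset.mem_univ i, Nat.eq_of_testBit_eq fun t => ?_⟩
      have := hi _ (hc t)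
      rw [Nat.zero_testBit]
      by_contra h1
      simp [bitWord, bitZ, h1] at this
    rwa [Finset.filter_filter] at h1
  obtain ⟨cert, a, hT⟩ := exists_of_checkProfile hcheck (K := onesCount c x)
    (fun e he => by rw [hm e he]; exact onesCount_mem_choices h0 hnorm e.1)
    fun h hh f hf => by
      rw [startLane_add_sum_laneIncrement hL hm hcL]
      have h1 := hdist _ (functionalWord_mem_bitSpan j c f)
      have h2 := hdist _ (Submodule.add_mem _ (functionalWord_mem_bitSpan j c f)
        (functionalWord_mem_bitSpan j c h))
      omega
  refine ⟨fun i => applyCert j cert (c i) ^^^ if x i = 1 then a else 0, fun t => ?_, ?_⟩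
  · convert D'.add_mem (bitZ_applyCert_mem (d := c) (fun l => hD (hc l)) j cert t)
      (D'.smul_mem (bitZ a t) hx) using 1
    ext i
    rw [bitWord, bitZ_xor]
    simp only [Pi.add_apply, Pi.smul_apply, smul_eq_mul]
    congr 1
    rcases zmod_two_eq (x i) with h | h <;> simp [h, bitZ]
  · rw [sum_columns hL hm hcL x fun p b => 32 ^ (applyCert j cert p ^^^ if b = 1 then a else 0)]
    simpa using hT

theorem exists_ne_eq_on {ι : Type*} [Fintype ι] (D : Submodule (ZMod 2) (Fin 24 → ZMod 2))
    (e : ι → (Fin 24 → ZMod 2) →ₗ[ZMod 2] ZMod 2)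
    (h : 2 ^ Module.finrank (ZMod 2) D < Fintype.card ι) :
    ∃ a b, a ≠ b ∧ ∀ x ∈ D, e a x = e b x := by
  have : Finite (Module.Dual (ZMod 2) D) := Module.finite_of_finite (ZMod 2)
  have := Fintype.ofFinite (Module.Dual (ZMod 2) D)
  obtain ⟨a, b, hab, h'⟩ := Fintype.exists_ne_map_eq_of_card_lt
    (fun i => ((e i).comp D.subtype : Module.Dual (ZMod 2) D)) (by
      rwa [Module.card_eq_pow_finrank (K := ZMod 2), Subspace.dual_finrank_eq, ZMod.card])
  exact ⟨a, b, hab, fun x hx => LinearMap.congr_fun h' ⟨x, hx⟩⟩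

/-- The evaluation at a coordinate. -/
def coordinate (q : Fin 24) : (Fin 24 → ZMod 2) →ₗ[ZMod 2] ZMod 2 := LinearMap.proj q

theorem exists_le_finrank_eq (D : Submodule (ZMod 2) (Fin 24 → ZMod 2)) {n : ℕ}
    (h : n ≤ Module.finrank (ZMod 2) D) : ∃ D' ≤ D, Module.finrank (ZMod 2) D' = n := by
  obtain ⟨f, hf⟩ := exists_linearIndependent_of_le_finrank h
  refine ⟨Submodule.span (ZMod 2) (Set.range (D.subtype ∘ f)), ?_, ?_⟩
  · rw [Submodule.span_le]
    rintro _ ⟨i, rfl⟩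
    exact (f i).2
  · rw [finrank_span_eq_card (hf.map' _ D.ker_subtype), Fintype.card_fin]

/-- The words of `D` vanishing at the coordinate `q`. -/
def shorten (D : Submodule (ZMod 2) (Fin 24 → ZMod 2)) (q : Fin 24) :
    Submodule (ZMod 2) (Fin 24 → ZMod 2) :=
  D ⊓ LinearMap.ker (coordinate q)

theorem mem_shorten {D : Submodule (ZMod 2) (Fin 24 → ZMod 2)} {q : Fin 24}
    {x : Fin 24 → ZMod 2} : x ∈ shorten D q ↔ x ∈ D ∧ x q = 0 := by
  simp [shorten, coordinate]

theorem finrank_le_finrank_shorten (D : Submodule (ZMod 2) (Fin 24 → ZMod 2)) (q : Fin 24) :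
    Module.finrank (ZMod 2) D ≤ Module.finrank (ZMod 2) (shorten D q) + 1 := by
  have h1 := Submodule.finrank_sup_add_finrank_inf_eq D (LinearMap.ker (coordinate q))
  have h2 := (coordinate q).finrank_range_add_finrank_ker
  have h3 := (LinearMap.range (coordinate q)).finrank_le
  have h4 := (D ⊔ LinearMap.ker (coordinate q)).finrank_le
  rw [Module.finrank_fin_fun] at h2 h4
  rw [Module.finrank_self] at h3
  rw [shorten]
  omega

theorem exists_dependent_coordinates {C : Submodule (ZMod 2) (Fin 24 → ZMod 2)}
    (hC : Module.finrank (ZMod 2) C = 7) : ∃ q₁ q₂ q₃ q₄ : Fin 24,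
      ({q₁, q₂, q₃, q₄} : Finset (Fin 24)).card = 4 ∧
        ∀ x ∈ C, x q₁ = 0 → x q₂ = 0 → x q₃ = x q₄ := by
  have key : ∀ u v : Fin 24, u ≠ v → (∀ x ∈ C, x u = x v) → ∃ q₁ q₂ q₃ q₄ : Fin 24,
      ({q₁, q₂, q₃, q₄} : Finset (Fin 24)).card = 4 ∧
        ∀ x ∈ C, x q₁ = 0 → x q₂ = 0 → x q₃ = x q₄ := by
    intro u v huv h
    have h2 := Finset.card_pair huv
    obtain ⟨q₂, -, hq₂⟩ := Finset.exists_mem_notMem_of_card_lt_card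
      (s := {u, v}) (t := (Finset.univ : Finset (Fin 24))) (by rw [h2]; decide)
    have h3 := Finset.card_insert_of_notMem hq₂
    obtain ⟨q₁, -, hq₁⟩ := Finset.exists_mem_notMem_of_card_lt_card
      (s := {q₂, u, v}) (t := (Finset.univ : Finset (Fin 24))) (by rw [h3, h2]; decide)
    exact ⟨q₁, q₂, u, v, by rw [Finset.card_insert_of_notMem hq₁, h3, h2],
      fun x hx _ _ => h x hx⟩
  obtain ⟨⟨⟨a, b⟩, hab⟩, ⟨⟨c, d⟩, hcd⟩, hne, h⟩ := exists_ne_eq_on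
    (ι := {p : Fin 24 × Fin 24 // p.1 < p.2}) C
    (fun p => coordinate p.1.1 + coordinate p.1.2)
    (by rw [hC]; decide +kernel)
  simp only [LinearMap.add_apply, coordinate, LinearMap.proj_apply] at h
  simp only at hab hcd
  rw [ne_eq, Subtype.mk.injEq, Prod.mk.injEq, not_and_or] at hne
  by_cases h1 : a = c
  · subst h1
    exact key b d (by tauto) fun x hx => add_left_cancel (h x hx)
  by_cases h2 : b = d
  · subst h2
    exact key a c h1 fun x hx => add_right_cancel (h x hx)
  by_cases h3 : a = d
  · subst h3
    exact key b c (hcd.trans hab).ne' fun x hx => by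
      have := h x hx
      rw [add_comm (x c)] at this
      exact add_left_cancel this
  by_cases h4 : b = c
  · subst h4
    exact key a d (hab.trans hcd).ne fun x hx => by
      have := h x hx
      rw [add_comm (x b)] at this
      exact add_right_cancel this
  refine ⟨a, b, c, d, ?_, fun x hx ha hb => ?_⟩
  · rw [Finset.card_insert_of_notMem, Finset.card_insert_of_notMem, Finset.card_pair hcd.ne]
    · simp [h2, h4]
    · simp [h1, h3, hab.ne]
  · have := h x hx
    rw [ha, hb, zero_add] at this
    have h5 : ∀ s t : ZMod 2, 0 = s + t → s = t := by decide
    exact h5 _ _ this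

theorem card_filter_mem_range {D D' : Submodule (ZMod 2) (Fin 24 → ZMod 2)}
    (hD : D ≤ D') {K : Finset (Fin 24)} (hK : ∀ v ∈ D', ∀ i ∈ K, v i = 0) :
    ∀ x ∈ D', ∀ Z : Finset (Fin 24), (∀ i, (∀ v ∈ D, v i = 0) → i ∈ Z) →
      (Z.filter fun i => x i = 1).card ∈ List.range (Z.card - K.card + 1) := by
  intro x hx Z hZ
  have h1 : (Z.filter fun i => x i = 1) ⊆ Z \ K := by
    intro i hi
    obtain ⟨hi, hi'⟩ := Finset.mem_filter.1 hi
    refine Finset.mem_sdiff.2 ⟨hi, fun hiK => ?_⟩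
    rw [hK x hx i hiK] at hi'
    exact zero_ne_one hi'
  have h2 := Finset.card_le_card h1
  rw [Finset.card_sdiff_of_subset fun i hi => hZ i fun v hv => hK v (hD hv) i hi] at h2
  rw [List.mem_range]
  omega

theorem card_filter_mem_tails_four {D D' : Submodule (ZMod 2) (Fin 24 → ZMod 2)}
    {q₁ q₂ q₃ q₄ : Fin 24} (hq : ({q₁, q₂, q₃, q₄} : Finset (Fin 24)).card = 4)
    (hD : ∀ v ∈ D, ∀ i ∈ ({q₁, q₂, q₃, q₄} : Finset (Fin 24)), v i = 0)
    (hD' : ∀ v ∈ D', v q₁ = 0 ∧ v q₂ = 0 ∧ v q₃ = v q₄) :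
    ∀ x ∈ D', ∀ Z : Finset (Fin 24), (∀ i, (∀ v ∈ D, v i = 0) → i ∈ Z) →
      (Z.filter fun i => x i = 1).card ∈ tails 4 Z.card := by
  intro x hx Z hZ
  rw [tails]
  split_ifs with h
  · have h1 : Z = {q₁, q₂, q₃, q₄} :=
      (Finset.eq_of_subset_of_card_le (fun i hi => hZ i fun v hv => hD v hv i hi)
        (by rw [h, hq])).symm
    have h34 : q₃ ≠ q₄ := by
      rintro rfl
      have := Finset.card_le_three (a := q₁) (b := q₂) (c := q₃)
      simp only [Finset.pair_eq_singleton] at hq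
      omega
    obtain ⟨h2, h3, h4⟩ := hD' x hx
    rw [h1, Finset.filter_insert, Finset.filter_insert, Finset.filter_insert,
      Finset.filter_singleton, h2, h3, ← h4]
    rcases zmod_two_eq (x q₃) with h5 | h5 <;> simp [h5, h34]
  · rw [List.mem_range]
    exact Nat.lt_succ_of_le (Finset.card_filter_le _ _)

/-- The base `32` codes of the profiles of the six codes. -/
def finalCodes : List ℕ :=
  (List.finRange 6).map fun i => ((sixColumns i).map fun p => 32 ^ p).sum

theorem checkLevel_zero : checkLevel 0 level0 (levelCodes level1) = true := by decide +kernel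
theorem checkLevel_one : checkLevel 1 level1 (levelCodes level2) = true := by decide +kernel
theorem checkLevel_two : checkLevel 2 level2 (levelCodes level3) = true := by decide +kernel
theorem checkLevel_three : checkLevel 3 level3 (levelCodes level4) = true := by decide +kernel
theorem checkLevel_four : checkLevel 4 level4 (levelCodes level5) = true := by decide +kernel
theorem checkLevel_five : checkLevel 5 level5 (levelCodes level6) = true := by decide +kernel
theorem checkLevel_six : checkLevel 6 level6 finalCodes = true := by decide +kernel

theorem hasColumns_finalCodes {C : Submodule (ZMod 2) (Fin 24 → ZMod 2)} (hC : IsCode24_7_10 C) :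
    HasColumns C finalCodes := by
  obtain ⟨h7, hmin⟩ := hC
  obtain ⟨q₁, q₂, q₃, q₄, hq, hdep⟩ := exists_dependent_coordinates h7
  set Q : Finset (Fin 24) := {q₁, q₂, q₃, q₄} with hQ
  set D₆ := shorten C q₁ with hD₆
  set D₅ := shorten D₆ q₂ with hD₅
  have h67 : D₆ ≤ C := inf_le_left
  have h56 : D₅ ≤ D₆ := inf_le_left
  have h6 : 6 ≤ Module.finrank (ZMod 2) D₆ := by
    have : _ ≤ Module.finrank (ZMod 2) D₆ + 1 := finrank_le_finrank_shorten C q₁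
    omega
  have h5 : 5 ≤ Module.finrank (ZMod 2) D₅ := by
    have : _ ≤ Module.finrank (ZMod 2) D₅ + 1 := finrank_le_finrank_shorten D₆ q₂
    omega
  obtain ⟨D₄, h45', h4⟩ := exists_le_finrank_eq (shorten D₅ q₃) (n := 4) (by
    have := finrank_le_finrank_shorten D₅ q₃
    omega)
  have h45 : D₄ ≤ D₅ := h45'.trans inf_le_left
  have hv5 : ∀ v ∈ D₅, v q₁ = 0 ∧ v q₂ = 0 ∧ v q₃ = v q₄ := by
    intro v hv
    have h1 := (mem_shorten.1 (h56 hv)).2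
    have h2 := (mem_shorten.1 hv).2
    exact ⟨h1, h2, hdep v (h67 (h56 hv)) h1 h2⟩
  have hv4 : ∀ v ∈ D₄, ∀ i ∈ Q, v i = 0 := by
    intro v hv i hi
    obtain ⟨h1, h2, h3⟩ := hv5 v (h45 hv)
    have h3' := (mem_shorten.1 (h45' hv)).2
    simp only [hQ, Finset.mem_insert, Finset.mem_singleton] at hi
    rcases hi with rfl | rfl | rfl | rfl
    · exact h1
    · exact h2
    · exact h3'
    · exact h3 ▸ h3'
  obtain ⟨⟨p₁, hp₁⟩, ⟨p₂, hp₂⟩, hne, hp⟩ := exists_ne_eq_on (ι := {i // i ∉ Q}) D₄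
    (fun i => coordinate i.1) (by
      rw [h4, Fintype.card_subtype_compl, Fintype.card_fin, Fintype.card_coe, hq]
      norm_num)
  set D₃ := shorten D₄ p₁ with hD₃
  have h34 : D₃ ≤ D₄ := inf_le_left
  have h3 : 3 ≤ Module.finrank (ZMod 2) D₃ := by
    have : _ ≤ Module.finrank (ZMod 2) D₃ + 1 := finrank_le_finrank_shorten D₄ p₁
    omega
  set K : Finset (Fin 24) := insert p₁ (insert p₂ Q) with hK
  have hK6 : K.card = 6 := by
    rw [hK, Finset.card_insert_of_notMem, Finset.card_insert_of_notMem hp₂, hq]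
    rw [Finset.mem_insert, not_or]
    exact ⟨fun h => hne (Subtype.ext h), hp₁⟩
  have hv3 : ∀ v ∈ D₃, ∀ i ∈ K, v i = 0 := by
    intro v hv i hi
    have h1 := (mem_shorten.1 hv).2
    rcases Finset.mem_insert.1 hi with rfl | hi
    · exact h1
    rcases Finset.mem_insert.1 hi with rfl | hi
    · exact (hp v (h34 hv)).symm.trans h1
    · exact hv4 v (h34 hv) i hi
  have htail3 := card_filter_mem_range le_rfl hv3
  rw [hK6] at htail3
  have htail4 := card_filter_mem_range h34 hv4
  rw [hq] at htail4
  have htail6 := card_filter_mem_range h56 (K := {q₁}) fun v hv i hi => by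
    rw [Finset.mem_singleton.1 hi]
    exact (mem_shorten.1 hv).2
  have hmin6 : ∀ v ∈ D₆, v ≠ 0 → 10 ≤ hammingNorm v := fun v hv => hmin v (h67 hv)
  have hmin5 : ∀ v ∈ D₅, v ≠ 0 → 10 ≤ hammingNorm v := fun v hv => hmin6 v (h56 hv)
  have hmin4 : ∀ v ∈ D₄, v ≠ 0 → 10 ≤ hammingNorm v := fun v hv => hmin5 v (h45 hv)
  have hmin3 : ∀ v ∈ D₃, v ≠ 0 → 10 ≤ hammingNorm v := fun v hv => hmin4 v (h34 hv)
  have s0 : HasColumns D₃ (levelCodes level0) :=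
    ⟨fun _ => 0, fun l => by convert D₃.zero_mem using 1; ext i; simp [bitWord, bitZ], by decide⟩
  have s1 := s0.extend (j := 0) le_rfl (by omega) hmin3 htail3 checkLevel_zero
  have s2 := s1.extend (j := 1) le_rfl (by omega) hmin3 htail3 checkLevel_one
  have s3 := s2.extend (j := 2) le_rfl (by omega) hmin3 htail3 checkLevel_two
  have s4 := s3.extend (j := 3) h34 (by omega) hmin4 htail4 checkLevel_three
  have s5 := s4.extend (j := 4) h45 (by omega) hmin5
    (card_filter_mem_tails_four hq hv4 hv5) checkLevel_four
  have s6 := s5.extend (j := 5) h56 (by omega) hmin6 htail6 checkLevel_five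
  exact s6.extend (j := 6) h67 (by omega) hmin
    (card_filter_mem_range h67 (K := ∅) fun v _ i hi => absurd hi (Finset.notMem_empty i))
    checkLevel_six

theorem exists_perm_of_map_eq {ι α : Type*} [Fintype ι] [DecidableEq α] {c d : ι → α}
    (h : Finset.univ.val.map c = Finset.univ.val.map d) :
    ∃ σ : Equiv.Perm ι, ∀ i, c (σ i) = d i := by
  have h1 : ∀ p, Nonempty ({i // d i = p} ≃ {i // c i = p}) := fun p => by
    rw [← Fintype.card_eq, Fintype.card_subtype, Fintype.card_subtype]
    have := congrArg (Multiset.count p) h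
    rw [Multiset.count_map, Multiset.count_map, ← Finset.filter_val, ← Finset.filter_val] at this
    simpa only [Finset.card_val, eq_comm] using this.symm
  exact ⟨Equiv.ofFiberEquiv fun p => (h1 p).some, Equiv.ofFiberEquiv_map _⟩

theorem dot_xor (j f g p : ℕ) : dot j (f ^^^ g) p = (dot j f p ^^ dot j g p) := by
  induction j with
  | zero => rfl
  | succ j ih =>
    rw [dot, dot, dot, ih, Nat.testBit_xor]
    cases dot j f p <;> cases dot j g p <;> cases f.testBit j <;> cases g.testBit j <;>
      cases p.testBit j <;> rfl

theorem dot_zero_left (j p : ℕ) : dot j 0 p = false := by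
  induction j with
  | zero => rfl
  | succ j ih => simp [dot, ih]

theorem functionalWord_xor (j : ℕ) (c : Fin 24 → ℕ) (f g : ℕ) :
    functionalWord j c (f ^^^ g) = functionalWord j c f + functionalWord j c g := by
  ext i
  simp only [functionalWord, dot_xor, Pi.add_apply]
  cases dot j f (c i) <;> cases dot j g (c i) <;> decide

theorem functionalWord_zero (j : ℕ) (c : Fin 24 → ℕ) : functionalWord j c 0 = 0 := by
  ext i
  simp [functionalWord, dot_zero_left]

/-- The code of all words given by evaluating the functionals on `𝔽₂ ^ j` at the columns. -/
def functionalCode (j : ℕ) (c : Fin 24 → ℕ) : Submodule (ZMod 2) (Fin 24 → ZMod 2) where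
  carrier := Set.image (functionalWord j c) (Set.Iio (2 ^ j))
  zero_mem' := ⟨0, by simp, functionalWord_zero j c⟩
  add_mem' := by
    rintro _ _ ⟨f, hf, rfl⟩ ⟨g, hg, rfl⟩
    exact ⟨f ^^^ g, Nat.xor_lt_two_pow hf hg, functionalWord_xor j c f g⟩
  smul_mem' := by
    rintro a _ ⟨f, hf, rfl⟩
    rcases zmod_two_eq a with rfl | rfl
    · exact ⟨0, by simp, by rw [functionalWord_zero, zero_smul]⟩
    · exact ⟨f, hf, (one_smul _ _).symm⟩

theorem mem_functionalCode {j : ℕ} {c : Fin 24 → ℕ} {v : Fin 24 → ZMod 2} :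
    v ∈ functionalCode j c ↔ ∃ f < 2 ^ j, functionalWord j c f = v := Iff.rfl

theorem functionalCode_le_bitSpan (j : ℕ) (c : Fin 24 → ℕ) : functionalCode j c ≤ bitSpan j c := by
  rintro _ ⟨f, -, rfl⟩
  exact functionalWord_mem_bitSpan j c f

theorem card_filter_eq_countP {l : List ℕ} {c : Fin 24 → ℕ} (hc : List.ofFn c = l)
    (P : ℕ → Bool) : (Finset.univ.filter fun i => P (c i) = true).card = l.countP P := by
  have h := Multiset.coe_countP (fun p => P p = true) l
  simp only [Bool.decide_eq_true] at h
  rw [← h, ← hc, ← Fin.univ_val_map, Multiset.countP_map, Finset.card_def, Finset.filter_val]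

theorem functionalWord_apply_eq_one {j f : ℕ} {c : Fin 24 → ℕ} {i : Fin 24} :
    functionalWord j c f i = 1 ↔ dot j f (c i) = true := by
  simp [functionalWord]

theorem hammingNorm_functionalWord {l : List ℕ} {c : Fin 24 → ℕ} (hc : List.ofFn c = l)
    (j f : ℕ) : hammingNorm (functionalWord j c f) = l.countP (dot j f) := by
  rw [← card_filter_eq_countP hc, hammingNorm]
  simp [functionalWord]

theorem functionalWord_injOn {j : ℕ} {c : Fin 24 → ℕ}
    (h : ∀ f < 2 ^ j, f ≠ 0 → functionalWord j c f ≠ 0) :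
    Set.InjOn (functionalWord j c) (Set.Iio (2 ^ j)) := by
  intro f hf g hg hfg
  by_contra hne
  refine h (f ^^^ g) (Nat.xor_lt_two_pow hf hg) (by simpa using hne) ?_
  rw [functionalWord_xor, hfg]
  exact CharTwo.add_self_eq_zero _

theorem finrank_functionalCode {j : ℕ} {c : Fin 24 → ℕ}
    (h : Set.InjOn (functionalWord j c) (Set.Iio (2 ^ j))) :
    Module.finrank (ZMod 2) (functionalCode j c) = j := by
  have h1 := Module.natCard_eq_pow_finrank (K := ZMod 2) (V := functionalCode j c)
  have h2 : Nat.card (functionalCode j c) = 2 ^ j := by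
    change (Set.image (functionalWord j c) (Set.Iio (2 ^ j))).ncard = 2 ^ j
    rw [h.ncard_image, ← Finset.coe_Iio, Set.ncard_coe_finset, Nat.card_Iio]
  rw [h2, Nat.card_zmod] at h1
  exact (Nat.pow_right_injective le_rfl h1).symm

/-- The sum over all coordinates of the squared number of words of weight ten with entry one. -/
noncomputable def squareSum (C : Submodule (ZMod 2) (Fin 24 → ZMod 2)) : ℕ :=
  ∑ i, {v | v ∈ C ∧ hammingNorm v = 10 ∧ v i = 1}.ncard ^ 2

theorem hammingNorm_comp_perm (σ : Equiv.Perm (Fin 24)) (v : Fin 24 → ZMod 2) :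
    hammingNorm (v ∘ σ) = hammingNorm v := by
  simp only [hammingNorm, Finset.card_filter, Function.comp_apply]
  exact Equiv.sum_comp σ fun i => if v i ≠ 0 then 1 else 0

theorem squareSum_eq_of_codePermEquiv {C D : Submodule (ZMod 2) (Fin 24 → ZMod 2)}
    (h : CodePermEquiv C D) : squareSum C = squareSum D := by
  obtain ⟨σ, rfl⟩ := h
  rw [squareSum, squareSum, ← Equiv.sum_comp σ]
  refine Finset.sum_congr rfl fun i _ => ?_
  rw [← Set.ncard_image_of_injective _
    (LinearMap.funLeft_injective_of_surjective (ZMod 2) (ZMod 2) σ σ.surjective)]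
  congr 2
  ext v
  constructor
  · rintro ⟨u, ⟨hu, h10, h1⟩, rfl⟩
    exact ⟨⟨u, hu, rfl⟩, (hammingNorm_comp_perm σ u).trans h10, h1⟩
  · rintro ⟨⟨u, hu, rfl⟩, h10, h1⟩
    exact ⟨u, ⟨hu, (hammingNorm_comp_perm σ u).symm.trans h10, h1⟩, rfl⟩

theorem squareSum_functionalCode {l : List ℕ} {j : ℕ} {c : Fin 24 → ℕ} (hc : List.ofFn c = l)
    (h : Set.InjOn (functionalWord j c) (Set.Iio (2 ^ j))) :
    squareSum (functionalCode j c) = (l.map fun p =>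
      (((List.range (2 ^ j)).filter fun f => l.countP (dot j f) == 10).countP
        fun f => dot j f p) ^ 2).sum := by
  have h1 : ∀ i, {v | v ∈ functionalCode j c ∧ hammingNorm v = 10 ∧ v i = 1}.ncard =
      ((List.range (2 ^ j)).filter fun f => l.countP (dot j f) == 10).countP
        fun f => dot j f (c i) := fun i => by
    have h2 : {v | v ∈ functionalCode j c ∧ hammingNorm v = 10 ∧ v i = 1} =
        Set.image (functionalWord j c) ((Finset.range (2 ^ j)).filter fun f =>
          (dot j f (c i) && (l.countP (dot j f) == 10)) = true : Finset ℕ) := by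
      ext v
      simp only [Set.mem_ofPred_eq, Set.mem_image, SetLike.mem_coe, Finset.mem_filter,
        Finset.mem_range, mem_functionalCode, Bool.and_eq_true, beq_iff_eq]
      constructor
      · rintro ⟨⟨f, hf, rfl⟩, h10, h1⟩
        exact ⟨f, ⟨hf, functionalWord_apply_eq_one.1 h1,
          (hammingNorm_functionalWord hc j f).symm.trans h10⟩, rfl⟩
      · rintro ⟨f, ⟨hf, h1, h10⟩, rfl⟩
        exact ⟨⟨f, hf, rfl⟩, (hammingNorm_functionalWord hc j f).trans h10,
          functionalWord_apply_eq_one.2 h1⟩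
    rw [h2, (h.mono fun f hf => by
      exact Finset.mem_range.1 (Finset.mem_filter.1 hf).1).ncard_image, Set.ncard_coe_finset,
      List.countP_filter, Finset.card_def, Finset.filter_val, ← Multiset.countP_eq_card_filter,
      Finset.range_val, Multiset.range, Multiset.coe_countP]
    simp only [Bool.decide_eq_true]
  rw [squareSum, ← hc, List.map_ofFn, List.sum_ofFn, hc]
  exact Finset.sum_congr rfl fun i _ => by rw [h1]; rfl

/-- The columns of the six codes. -/
def sixCodeColumns (i : Fin 6) (k : Fin 24) : ℕ := (sixColumns i).getD k 0

theorem ofFn_sixCodeColumns (i : Fin 6) : List.ofFn (sixCodeColumns i) = sixColumns i := by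
  revert i
  decide

theorem ten_le_countP_dot_sixColumns (i : Fin 6) :
    ∀ f < 2 ^ 7, f ≠ 0 → 10 ≤ (sixColumns i).countP (dot 7 f) := by
  revert i
  decide +kernel

theorem ten_le_hammingNorm_functionalWord (i : Fin 6) {f : ℕ} (hf : f < 2 ^ 7) (h0 : f ≠ 0) :
    10 ≤ hammingNorm (functionalWord 7 (sixCodeColumns i) f) := by
  rw [hammingNorm_functionalWord (ofFn_sixCodeColumns i)]
  exact ten_le_countP_dot_sixColumns i f hf h0

theorem functionalWord_sixCodeColumns_injOn (i : Fin 6) :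
    Set.InjOn (functionalWord 7 (sixCodeColumns i)) (Set.Iio (2 ^ 7)) :=
  functionalWord_injOn fun f hf h0 h => by
    have := ten_le_hammingNorm_functionalWord i hf h0
    rw [h, hammingNorm_zero] at this
    omega

theorem squareSum_functionalCode_sixCodeColumns (i : Fin 6) :
    squareSum (functionalCode 7 (sixCodeColumns i)) =
      ![10884, 10460, 10866, 10444, 9600, 12156] i := by
  rw [squareSum_functionalCode (ofFn_sixCodeColumns i) (functionalWord_sixCodeColumns_injOn i)]
  revert i
  decide +kernel

theorem exists_codePermEquiv_functionalCode {C : Submodule (ZMod 2) (Fin 24 → ZMod 2)}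
    (hC : IsCode24_7_10 C) : ∃ i, CodePermEquiv C (functionalCode 7 (sixCodeColumns i)) := by
  obtain ⟨c, hc, hT⟩ := hasColumns_finalCodes hC
  obtain ⟨i, -, hi⟩ := List.mem_map.1 hT
  have h1 : Finset.univ.val.map c = Finset.univ.val.map (sixCodeColumns i) := by
    refine multiset_eq_of_sum_pow_eq (by simp) (by simp) ?_
    rw [Multiset.map_map, Multiset.map_map]
    refine hi.symm.trans ?_
    rw [← ofFn_sixCodeColumns, List.map_ofFn, List.sum_ofFn]
    rfl
  obtain ⟨σ, hσ⟩ := exists_perm_of_map_eq h1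
  refine ⟨i, σ, (Submodule.eq_of_le_of_finrank_eq
    ((functionalCode_le_bitSpan 7 _).trans ?_) ?_).symm⟩
  · rw [bitSpan, Submodule.span_le]
    rintro _ ⟨l, rfl⟩
    exact ⟨bitWord c l, hc l, funext fun k => congrArg (bitZ · l) (hσ k)⟩
  · rw [finrank_functionalCode (functionalWord_sixCodeColumns_injOn i), ← hC.1]
    exact (LinearEquiv.finrank_map_eq (LinearEquiv.funCongrLeft (ZMod 2) (ZMod 2) σ) C).symm

/-- Up to coordinate permutation, there are exactly six binary linear
[24,7,10] codes. -/
theorem six_codes_24_7_10 :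
    ∃ Cs : Fin 6 → Submodule (ZMod 2) (Fin 24 → ZMod 2),
      (∀ i, IsCode24_7_10 (Cs i)) ∧
      (∀ i j, i ≠ j → ¬ CodePermEquiv (Cs i) (Cs j)) ∧
      ∀ C : Submodule (ZMod 2) (Fin 24 → ZMod 2), IsCode24_7_10 C →
        ∃ i, CodePermEquiv C (Cs i) := by
  refine ⟨fun i => functionalCode 7 (sixCodeColumns i),
    fun i => ⟨finrank_functionalCode (functionalWord_sixCodeColumns_injOn i), ?_⟩,
    fun i j hij h => hij ?_, fun C hC => exists_codePermEquiv_functionalCode hC⟩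
  · rintro _ ⟨f, hf, rfl⟩ h0
    exact ten_le_hammingNorm_functionalWord i hf fun h => h0 (by rw [h, functionalWord_zero])
  · have h1 := squareSum_eq_of_codePermEquiv h
    rw [squareSum_functionalCode_sixCodeColumns, squareSum_functionalCode_sixCodeColumns] at h1
    clear h hij
    revert i j
    decide
end
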